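/- Full completeness of the generic linear-use CPS self-translation: suppose R̲ is either a computation-type constant or the type I̲. Then: (1) if Γ ⊢ t, u : A and Γᶜ ⊢ tᶜ = uᶜ : Aᶜ, then Γ ⊢ t = u : A; (2) if Γᶜ ⊢ t : Aᶜ, then there exists Γ ⊢ u : A with Γᶜ ⊢ t = uᶜ : Aᶜ; (3) if Γ | z:A̲ ⊢ t, u : B̲ and Γᶜ | k_z:B̲ᶜ ⊢ tᶜ = uᶜ : A̲ᶜ, then Γ | z:A̲ ⊢ t = u : B̲; (4) if Γᶜ | k_z:B̲ᶜ ⊢ t : A̲ᶜ, then there exists Γ | z:A̲ ⊢ u : B̲ with Γᶜ | k_z:B̲ᶜ ⊢ t = uᶜ : A̲ᶜ. All equalities are in the equational theory of EEC. -/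

import Mathlib

set_option autoImplicit false

namespace EEC

/-! # The enriched effect calculus (EEC)

A deep embedding of the enriched effect calculus of Egger, Møgelberg and
Simpson: value types and computation types, raw terms (de Bruijn indices for
value variables, together with a designated stoup variable `svar`), typing
derivations with an (at most singleton) stoup, the βη-equational theory, the
simply-typed λ-calculus together with βη-equality and Moggi's computational
λ-calculus equality, the standard cbv/cbn translations of typed λ-calculus
into EEC, Hasegawa's linear-use CPS translations, and the generic linear-use
CPS self-translation of EEC. -/

mutual
  /-- Value types of EEC. -/
  inductive VType : Type
    | base : ℕ → VType                 -- value type constants α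
    | unit : VType                     -- 1
    | prod : VType → VType → VType     -- A × B
    | arr : VType → VType → VType      -- A → B
    | comp : CType → VType             -- every computation type is a value type
    | lin : CType → CType → VType      -- A̲ ⊸ B̲
  /-- Computation types of EEC. -/
  inductive CType : Type
    | base : ℕ → CType                 -- computation type constants α̲
    | cunit : CType                    -- 1̲
    | cand : CType → CType → CType     -- A̲ & B̲
    | carr : VType → CType → CType     -- A ⇒ B̲
    | iunit : CType                    -- I̲
    | bang : VType → CType             -- !A
    | copow : VType → CType → CType    -- !A ⊗ B̲
    | czero : CType                    -- 0̲
    | csum : CType → CType → CType     -- A̲ ⊕ B̲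
end

/-- Raw terms of EEC.  Value variables are de Bruijn indices (`var n`, with
`var 0` the innermost bound variable); the unique stoup variable is `svar`
(the constructs `llam`, `copowlet` (in its body) and `ccase` (in its
branches) bind the stoup variable). -/
inductive Tm : Type
  | var : ℕ → Tm                -- value variable
  | svar : Tm                   -- the stoup variable
  | unit : Tm                   -- * : 1
  | vpair : Tm → Tm → Tm        -- ⟨t,u⟩
  | vfst : Tm → Tm
  | vsnd : Tm → Tm
  | vlam : VType → Tm → Tm      -- λx:A. t
  | vapp : Tm → Tm → Tm
  | cunit : Tm                  -- ⋆ : 1̲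
  | cpair : Tm → Tm → Tm        -- ⟨t,u⟩ : A̲ & B̲
  | cfst : Tm → Tm
  | csnd : Tm → Tm
  | clam : VType → Tm → Tm      -- λx:A ⇒ t
  | capp : Tm → Tm → Tm         -- s ⋅ t
  | top : Tm                    -- ⊤ : I̲
  | ilet : Tm → Tm → Tm         -- t to ⊤. u
  | bang : Tm → Tm              -- !t
  | banglet : Tm → Tm → Tm      -- let !x = t in u   (binds a value variable in u)
  | copow : Tm → Tm → Tm        -- !t ⊗ u
  | copowlet : Tm → Tm → Tm     -- let !x⊗y = s in t (binds a value variable and the stoup variable in t)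
  | cimage : CType → Tm → Tm    -- image_{A̲}(t)
  | cinl : Tm → Tm
  | cinr : Tm → Tm
  | ccase : Tm → Tm → Tm → Tm   -- case s of (x. t | y. u)  (branches bind the stoup variable)
  | llam : CType → Tm → Tm      -- λ°z:A̲. t (binds the stoup variable)
  | lapp : Tm → Tm → Tm         -- s[t]

namespace Tm

/-- Lift a renaming of value variables under a binder. -/
def liftN (f : ℕ → ℕ) : ℕ → ℕ
  | 0 => 0
  | n + 1 => f n + 1

/-- Renaming of value variables. -/
def rename (f : ℕ → ℕ) : Tm → Tm
  | .var n => .var (f n)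
  | .svar => .svar
  | .unit => .unit
  | .vpair t u => .vpair (rename f t) (rename f u)
  | .vfst t => .vfst (rename f t)
  | .vsnd t => .vsnd (rename f t)
  | .vlam A t => .vlam A (rename (liftN f) t)
  | .vapp s t => .vapp (rename f s) (rename f t)
  | .cunit => .cunit
  | .cpair t u => .cpair (rename f t) (rename f u)
  | .cfst t => .cfst (rename f t)
  | .csnd t => .csnd (rename f t)
  | .clam A t => .clam A (rename (liftN f) t)
  | .capp s t => .capp (rename f s) (rename f t)
  | .top => .top
  | .ilet t u => .ilet (rename f t) (rename f u)
  | .bang t => .bang (rename f t)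
  | .banglet t u => .banglet (rename f t) (rename (liftN f) u)
  | .copow t u => .copow (rename f t) (rename f u)
  | .copowlet s t => .copowlet (rename f s) (rename (liftN f) t)
  | .cimage A t => .cimage A (rename f t)
  | .cinl t => .cinl (rename f t)
  | .cinr t => .cinr (rename f t)
  | .ccase s t u => .ccase (rename f s) (rename f t) (rename f u)
  | .llam A t => .llam A (rename f t)
  | .lapp s t => .lapp (rename f s) (rename f t)

/-- Weakening of value variables. -/
def shift (t : Tm) : Tm := rename Nat.succ t

/-- Lift a parallel substitution of value variables under a binder. -/
def liftS (σ : ℕ → Tm) : ℕ → Tm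
  | 0 => .var 0
  | n + 1 => shift (σ n)

/-- Parallel (capture-avoiding) substitution for value variables. -/
def psubst (σ : ℕ → Tm) : Tm → Tm
  | .var n => σ n
  | .svar => .svar
  | .unit => .unit
  | .vpair t u => .vpair (psubst σ t) (psubst σ u)
  | .vfst t => .vfst (psubst σ t)
  | .vsnd t => .vsnd (psubst σ t)
  | .vlam A t => .vlam A (psubst (liftS σ) t)
  | .vapp s t => .vapp (psubst σ s) (psubst σ t)
  | .cunit => .cunit
  | .cpair t u => .cpair (psubst σ t) (psubst σ u)
  | .cfst t => .cfst (psubst σ t)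
  | .csnd t => .csnd (psubst σ t)
  | .clam A t => .clam A (psubst (liftS σ) t)
  | .capp s t => .capp (psubst σ s) (psubst σ t)
  | .top => .top
  | .ilet t u => .ilet (psubst σ t) (psubst σ u)
  | .bang t => .bang (psubst σ t)
  | .banglet t u => .banglet (psubst σ t) (psubst (liftS σ) u)
  | .copow t u => .copow (psubst σ t) (psubst σ u)
  | .copowlet s t => .copowlet (psubst σ s) (psubst (liftS σ) t)
  | .cimage A t => .cimage A (psubst σ t)
  | .cinl t => .cinl (psubst σ t)
  | .cinr t => .cinr (psubst σ t)
  | .ccase s t u => .ccase (psubst σ s) (psubst σ t) (psubst σ u)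
  | .llam A t => .llam A (psubst σ t)
  | .lapp s t => .lapp (psubst σ s) (psubst σ t)

/-- Capture-avoiding substitution `t[u/x]` of a term `u` for the innermost
value variable of `t`. -/
def subst0 (u : Tm) (t : Tm) : Tm :=
  psubst (fun n => match n with | 0 => u | m + 1 => .var m) t

/-- Capture-avoiding substitution `t[u/z]` of a term `u` for the stoup
variable of `t`.  The substitution stops at the stoup-variable binders
(`llam`-bodies, `copowlet`-bodies and `ccase`-branches). -/
def ssubst (u : Tm) : Tm → Tm
  | .var n => .var n
  | .svar => u
  | .unit => .unit
  | .vpair t t' => .vpair (ssubst u t) (ssubst u t')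
  | .vfst t => .vfst (ssubst u t)
  | .vsnd t => .vsnd (ssubst u t)
  | .vlam A t => .vlam A (ssubst (shift u) t)
  | .vapp s t => .vapp (ssubst u s) (ssubst u t)
  | .cunit => .cunit
  | .cpair t t' => .cpair (ssubst u t) (ssubst u t')
  | .cfst t => .cfst (ssubst u t)
  | .csnd t => .csnd (ssubst u t)
  | .clam A t => .clam A (ssubst (shift u) t)
  | .capp s t => .capp (ssubst u s) (ssubst u t)
  | .top => .top
  | .ilet t t' => .ilet (ssubst u t) (ssubst u t')
  | .bang t => .bang (ssubst u t)
  | .banglet t t' => .banglet (ssubst u t) (ssubst (shift u) t')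
  | .copow t t' => .copow (ssubst u t) (ssubst u t')
  | .copowlet s t => .copowlet (ssubst u s) t
  | .cimage A t => .cimage A (ssubst u t)
  | .cinl t => .cinl (ssubst u t)
  | .cinr t => .cinr (ssubst u t)
  | .ccase s t t' => .ccase (ssubst u s) t t'
  | .llam A t => .llam A t
  | .lapp s t => .lapp (ssubst u s) (ssubst u t)

end Tm

/-- Typing derivations of EEC (Figure 1 of the paper).  `Deriv Γ none t A`
is the judgement `Γ ⊢ t : A` (empty stoup); `Deriv Γ (some A̲) t (.comp B̲)`
is the judgement `Γ | z:A̲ ⊢ t : B̲`.  In the rules below `Δ` ranges over an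
arbitrary (possibly empty) stoup. -/
inductive Deriv : List VType → Option CType → Tm → VType → Type
  | var (Γ : List VType) (n : ℕ) (A : VType) :
      Γ[n]? = some A → Deriv Γ none (.var n) A
  | svar (Γ : List VType) (A : CType) : Deriv Γ (some A) .svar (.comp A)
  | unit (Γ : List VType) : Deriv Γ none .unit .unit
  | vpair (Γ : List VType) (t u : Tm) (A B : VType) :
      Deriv Γ none t A → Deriv Γ none u B → Deriv Γ none (.vpair t u) (.prod A B)
  | vfst (Γ : List VType) (t : Tm) (A B : VType) :
      Deriv Γ none t (.prod A B) → Deriv Γ none (.vfst t) A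
  | vsnd (Γ : List VType) (t : Tm) (A B : VType) :
      Deriv Γ none t (.prod A B) → Deriv Γ none (.vsnd t) B
  | vlam (Γ : List VType) (t : Tm) (A B : VType) :
      Deriv (A :: Γ) none t B → Deriv Γ none (.vlam A t) (.arr A B)
  | vapp (Γ : List VType) (s t : Tm) (A B : VType) :
      Deriv Γ none s (.arr A B) → Deriv Γ none t A → Deriv Γ none (.vapp s t) B
  | cunit (Γ : List VType) (Δ : Option CType) : Deriv Γ Δ .cunit (.comp .cunit)
  | cpair (Γ : List VType) (Δ : Option CType) (t u : Tm) (A B : CType) :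
      Deriv Γ Δ t (.comp A) → Deriv Γ Δ u (.comp B) →
      Deriv Γ Δ (.cpair t u) (.comp (.cand A B))
  | cfst (Γ : List VType) (Δ : Option CType) (t : Tm) (A B : CType) :
      Deriv Γ Δ t (.comp (.cand A B)) → Deriv Γ Δ (.cfst t) (.comp A)
  | csnd (Γ : List VType) (Δ : Option CType) (t : Tm) (A B : CType) :
      Deriv Γ Δ t (.comp (.cand A B)) → Deriv Γ Δ (.csnd t) (.comp B)
  | clam (Γ : List VType) (Δ : Option CType) (t : Tm) (A : VType) (B : CType) :
      Deriv (A :: Γ) Δ t (.comp B) → Deriv Γ Δ (.clam A t) (.comp (.carr A B))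
  | capp (Γ : List VType) (Δ : Option CType) (s t : Tm) (A : VType) (B : CType) :
      Deriv Γ Δ s (.comp (.carr A B)) → Deriv Γ none t A →
      Deriv Γ Δ (.capp s t) (.comp B)
  | top (Γ : List VType) : Deriv Γ none .top (.comp .iunit)
  | ilet (Γ : List VType) (Δ : Option CType) (t u : Tm) (A : CType) :
      Deriv Γ Δ t (.comp .iunit) → Deriv Γ none u (.comp A) →
      Deriv Γ Δ (.ilet t u) (.comp A)
  | bang (Γ : List VType) (t : Tm) (A : VType) :
      Deriv Γ none t A → Deriv Γ none (.bang t) (.comp (.bang A))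
  | banglet (Γ : List VType) (Δ : Option CType) (t u : Tm) (A : VType) (B : CType) :
      Deriv Γ Δ t (.comp (.bang A)) → Deriv (A :: Γ) none u (.comp B) →
      Deriv Γ Δ (.banglet t u) (.comp B)
  | copow (Γ : List VType) (Δ : Option CType) (t u : Tm) (A : VType) (B : CType) :
      Deriv Γ none t A → Deriv Γ Δ u (.comp B) →
      Deriv Γ Δ (.copow t u) (.comp (.copow A B))
  | copowlet (Γ : List VType) (Δ : Option CType) (s t : Tm) (A : VType) (B C : CType) :
      Deriv Γ Δ s (.comp (.copow A B)) → Deriv (A :: Γ) (some B) t (.comp C) →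
      Deriv Γ Δ (.copowlet s t) (.comp C)
  | cimage (Γ : List VType) (Δ : Option CType) (t : Tm) (A : CType) :
      Deriv Γ Δ t (.comp .czero) → Deriv Γ Δ (.cimage A t) (.comp A)
  | cinl (Γ : List VType) (Δ : Option CType) (t : Tm) (A B : CType) :
      Deriv Γ Δ t (.comp A) → Deriv Γ Δ (.cinl t) (.comp (.csum A B))
  | cinr (Γ : List VType) (Δ : Option CType) (t : Tm) (A B : CType) :
      Deriv Γ Δ t (.comp B) → Deriv Γ Δ (.cinr t) (.comp (.csum A B))
  | ccase (Γ : List VType) (Δ : Option CType) (s t u : Tm) (A B C : CType) :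
      Deriv Γ Δ s (.comp (.csum A B)) → Deriv Γ (some A) t (.comp C) →
      Deriv Γ (some B) u (.comp C) → Deriv Γ Δ (.ccase s t u) (.comp C)
  | llam (Γ : List VType) (t : Tm) (A B : CType) :
      Deriv Γ (some A) t (.comp B) → Deriv Γ none (.llam A t) (.lin A B)
  | lapp (Γ : List VType) (Δ : Option CType) (s t : Tm) (A B : CType) :
      Deriv Γ none s (.lin A B) → Deriv Γ Δ t (.comp A) →
      Deriv Γ Δ (.lapp s t) (.comp B)

/-- The equational theory of EEC: the smallest type-respecting congruence
containing the βη-equalities of Figure 2 of the paper. -/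
inductive EEq : List VType → Option CType → Tm → Tm → VType → Prop
  -- equivalence
  | refl {Γ Δ t A} : Deriv Γ Δ t A → EEq Γ Δ t t A
  | symm {Γ Δ t u A} : EEq Γ Δ t u A → EEq Γ Δ u t A
  | trans {Γ Δ t u v A} : EEq Γ Δ t u A → EEq Γ Δ u v A → EEq Γ Δ t v A
  -- congruence rules
  | vpair_cong {Γ t t' u u' A B} : EEq Γ none t t' A → EEq Γ none u u' B →
      EEq Γ none (.vpair t u) (.vpair t' u') (.prod A B)
  | vfst_cong {Γ t t' A B} : EEq Γ none t t' (.prod A B) →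
      EEq Γ none (.vfst t) (.vfst t') A
  | vsnd_cong {Γ t t' A B} : EEq Γ none t t' (.prod A B) →
      EEq Γ none (.vsnd t) (.vsnd t') B
  | vlam_cong {Γ t t' A B} : EEq (A :: Γ) none t t' B →
      EEq Γ none (.vlam A t) (.vlam A t') (.arr A B)
  | vapp_cong {Γ s s' t t' A B} : EEq Γ none s s' (.arr A B) → EEq Γ none t t' A →
      EEq Γ none (.vapp s t) (.vapp s' t') B
  | cpair_cong {Γ Δ t t' u u' A B} : EEq Γ Δ t t' (.comp A) → EEq Γ Δ u u' (.comp B) →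
      EEq Γ Δ (.cpair t u) (.cpair t' u') (.comp (.cand A B))
  | cfst_cong {Γ Δ t t' A B} : EEq Γ Δ t t' (.comp (.cand A B)) →
      EEq Γ Δ (.cfst t) (.cfst t') (.comp A)
  | csnd_cong {Γ Δ t t' A B} : EEq Γ Δ t t' (.comp (.cand A B)) →
      EEq Γ Δ (.csnd t) (.csnd t') (.comp B)
  | clam_cong {Γ Δ t t' A B} : EEq (A :: Γ) Δ t t' (.comp B) →
      EEq Γ Δ (.clam A t) (.clam A t') (.comp (.carr A B))
  | capp_cong {Γ Δ s s' t t' A B} : EEq Γ Δ s s' (.comp (.carr A B)) → EEq Γ none t t' A →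
      EEq Γ Δ (.capp s t) (.capp s' t') (.comp B)
  | ilet_cong {Γ Δ t t' u u' A} : EEq Γ Δ t t' (.comp .iunit) → EEq Γ none u u' (.comp A) →
      EEq Γ Δ (.ilet t u) (.ilet t' u') (.comp A)
  | bang_cong {Γ t t' A} : EEq Γ none t t' A →
      EEq Γ none (.bang t) (.bang t') (.comp (.bang A))
  | banglet_cong {Γ Δ t t' u u' A B} : EEq Γ Δ t t' (.comp (.bang A)) →
      EEq (A :: Γ) none u u' (.comp B) →
      EEq Γ Δ (.banglet t u) (.banglet t' u') (.comp B)
  | copow_cong {Γ Δ t t' u u' A B} : EEq Γ none t t' A → EEq Γ Δ u u' (.comp B) →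
      EEq Γ Δ (.copow t u) (.copow t' u') (.comp (.copow A B))
  | copowlet_cong {Γ Δ s s' t t' A B C} : EEq Γ Δ s s' (.comp (.copow A B)) →
      EEq (A :: Γ) (some B) t t' (.comp C) →
      EEq Γ Δ (.copowlet s t) (.copowlet s' t') (.comp C)
  | cimage_cong {Γ Δ t t' A} : EEq Γ Δ t t' (.comp .czero) →
      EEq Γ Δ (.cimage A t) (.cimage A t') (.comp A)
  | cinl_cong {Γ Δ t t' A B} : EEq Γ Δ t t' (.comp A) →
      EEq Γ Δ (.cinl t) (.cinl t') (.comp (.csum A B))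
  | cinr_cong {Γ Δ t t' A B} : EEq Γ Δ t t' (.comp B) →
      EEq Γ Δ (.cinr t) (.cinr t') (.comp (.csum A B))
  | ccase_cong {Γ Δ s s' t t' u u' A B C} : EEq Γ Δ s s' (.comp (.csum A B)) →
      EEq Γ (some A) t t' (.comp C) → EEq Γ (some B) u u' (.comp C) →
      EEq Γ Δ (.ccase s t u) (.ccase s' t' u') (.comp C)
  | llam_cong {Γ t t' A B} : EEq Γ (some A) t t' (.comp B) →
      EEq Γ none (.llam A t) (.llam A t') (.lin A B)
  | lapp_cong {Γ Δ s s' t t' A B} : EEq Γ none s s' (.lin A B) → EEq Γ Δ t t' (.comp A) →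
      EEq Γ Δ (.lapp s t) (.lapp s' t') (.comp B)
  -- the equalities of Figure 2
  | unit_eta {Γ t} : Deriv Γ none t .unit → EEq Γ none t .unit .unit
  | vfst_beta {Γ t u A B} : Deriv Γ none t A → Deriv Γ none u B →
      EEq Γ none (.vfst (.vpair t u)) t A
  | vsnd_beta {Γ t u A B} : Deriv Γ none t A → Deriv Γ none u B →
      EEq Γ none (.vsnd (.vpair t u)) u B
  | vpair_eta {Γ t A B} : Deriv Γ none t (.prod A B) →
      EEq Γ none (.vpair (.vfst t) (.vsnd t)) t (.prod A B)
  | vlam_beta {Γ t u A B} : Deriv (A :: Γ) none t B → Deriv Γ none u A →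
      EEq Γ none (.vapp (.vlam A t) u) (Tm.subst0 u t) B
  | vlam_eta {Γ t A B} : Deriv Γ none t (.arr A B) →
      EEq Γ none (.vlam A (.vapp (Tm.shift t) (.var 0))) t (.arr A B)
  | cunit_eta {Γ Δ t} : Deriv Γ Δ t (.comp .cunit) → EEq Γ Δ t .cunit (.comp .cunit)
  | cfst_beta {Γ Δ t u A B} : Deriv Γ Δ t (.comp A) → Deriv Γ Δ u (.comp B) →
      EEq Γ Δ (.cfst (.cpair t u)) t (.comp A)
  | csnd_beta {Γ Δ t u A B} : Deriv Γ Δ t (.comp A) → Deriv Γ Δ u (.comp B) →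
      EEq Γ Δ (.csnd (.cpair t u)) u (.comp B)
  | cpair_eta {Γ Δ t A B} : Deriv Γ Δ t (.comp (.cand A B)) →
      EEq Γ Δ (.cpair (.cfst t) (.csnd t)) t (.comp (.cand A B))
  | clam_beta {Γ Δ t u A B} : Deriv (A :: Γ) Δ t (.comp B) → Deriv Γ none u A →
      EEq Γ Δ (.capp (.clam A t) u) (Tm.subst0 u t) (.comp B)
  | clam_eta {Γ Δ t A B} : Deriv Γ Δ t (.comp (.carr A B)) →
      EEq Γ Δ (.clam A (.capp (Tm.shift t) (.var 0))) t (.comp (.carr A B))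
  | ilet_beta {Γ t A} : Deriv Γ none t (.comp A) →
      EEq Γ none (.ilet .top t) t (.comp A)
  | ilet_eta {Γ Δ t u A} : Deriv Γ Δ t (.comp .iunit) → Deriv Γ (some .iunit) u (.comp A) →
      EEq Γ Δ (.ilet t (Tm.ssubst .top u)) (Tm.ssubst t u) (.comp A)
  | bang_beta {Γ t u A B} : Deriv Γ none t A → Deriv (A :: Γ) none u (.comp B) →
      EEq Γ none (.banglet (.bang t) u) (Tm.subst0 t u) (.comp B)
  | bang_eta {Γ Δ t u A B} : Deriv Γ Δ t (.comp (.bang A)) →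
      Deriv Γ (some (.bang A)) u (.comp B) →
      EEq Γ Δ (.banglet t (Tm.ssubst (.bang (.var 0)) (Tm.shift u))) (Tm.ssubst t u) (.comp B)
  | copow_beta {Γ Δ t s u A B C} : Deriv Γ none t A → Deriv Γ Δ s (.comp B) →
      Deriv (A :: Γ) (some B) u (.comp C) →
      EEq Γ Δ (.copowlet (.copow t s) u) (Tm.ssubst s (Tm.subst0 t u)) (.comp C)
  | copow_eta {Γ Δ t u A B C} : Deriv Γ Δ t (.comp (.copow A B)) →
      Deriv Γ (some (.copow A B)) u (.comp C) →
      EEq Γ Δ (.copowlet t (Tm.ssubst (.copow (.var 0) .svar) (Tm.shift u))) (Tm.ssubst t u) (.comp C)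
  | czero_eta {Γ Δ t u A} : Deriv Γ Δ t (.comp .czero) → Deriv Γ (some .czero) u (.comp A) →
      EEq Γ Δ (.cimage A t) (Tm.ssubst t u) (.comp A)
  | csum_beta_inl {Γ Δ t u u' A B C} : Deriv Γ (some A) u (.comp C) →
      Deriv Γ (some B) u' (.comp C) → Deriv Γ Δ t (.comp A) →
      EEq Γ Δ (.ccase (.cinl t) u u') (Tm.ssubst t u) (.comp C)
  | csum_beta_inr {Γ Δ t u u' A B C} : Deriv Γ (some A) u (.comp C) →
      Deriv Γ (some B) u' (.comp C) → Deriv Γ Δ t (.comp B) →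
      EEq Γ Δ (.ccase (.cinr t) u u') (Tm.ssubst t u') (.comp C)
  | csum_eta {Γ Δ t u A B C} : Deriv Γ Δ t (.comp (.csum A B)) →
      Deriv Γ (some (.csum A B)) u (.comp C) →
      EEq Γ Δ (.ccase t (Tm.ssubst (.cinl .svar) u) (Tm.ssubst (.cinr .svar) u)) (Tm.ssubst t u) (.comp C)
  | llam_beta {Γ Δ t u A B} : Deriv Γ (some A) t (.comp B) → Deriv Γ Δ u (.comp A) →
      EEq Γ Δ (.lapp (.llam A t) u) (Tm.ssubst u t) (.comp B)
  | llam_eta {Γ t A B} : Deriv Γ none t (.lin A B) →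
      EEq Γ none (.llam A (.lapp t .svar)) t (.lin A B)

end EEC

namespace EEC

/-! ## The generic linear-use CPS self-translation of EEC (Figures 4–6) -/

mutual
  /-- CPS translation `Aᶜ` of value types, relative to the result type `R̲`. -/
  def cpsV (R : CType) : VType → VType
    | .base a => .base a
    | .unit => .unit
    | .prod A B => .prod (cpsV R A) (cpsV R B)
    | .arr A B => .arr (cpsV R A) (cpsV R B)
    | .comp A => .lin (cpsC R A) R
    | .lin A B => .lin (cpsC R B) (cpsC R A)
  /-- CPS translation `A̲ᶜ` of computation types, relative to the result type
  `R̲` (a computation-type constant equal to `R̲` is translated to `I̲`). -/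
  def cpsC (R : CType) : CType → CType
    | .base a =>
        match R with
        | .base b => if b = a then .iunit else .base a
        | _ => .base a
    | .cunit => .czero
    | .cand A B => .csum (cpsC R A) (cpsC R B)
    | .carr A B => .copow (cpsV R A) (cpsC R B)
    | .iunit => R
    | .bang A => .carr (cpsV R A) R
    | .copow A B => .carr (cpsV R A) (cpsC R B)
    | .czero => .cunit
    | .csum A B => .cand (cpsC R A) (cpsC R B)
end

/-- Pointwise CPS translation `Γᶜ` of a context. -/
def cpsCtx (R : CType) (Γ : List VType) : List VType := Γ.map (cpsV R)

/-- The generic linear-use CPS self-translation on terms (Figures 5 and 6 of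
the paper), defined by recursion on typing derivations.  A value judgement
`Γ ⊢ t : A` is sent to a term `tᶜ` with `Γᶜ ⊢ tᶜ : Aᶜ`, and a stoup
judgement `Γ | z:A̲ ⊢ t : B̲` is sent (contravariantly) to a term `tᶜ` with
`Γᶜ | k_z:B̲ᶜ ⊢ tᶜ : A̲ᶜ`. -/
def cps (R : CType) : {Γ : List VType} → {Δ : Option CType} → {t : Tm} → {A : VType} →
    Deriv Γ Δ t A → Tm
  | _, _, _, _, .var _ n _ _ => .var n
  | _, _, _, _, .svar _ _ => .svar
  | _, _, _, _, .unit _ => .unit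
  | _, _, _, _, .vpair _ _ _ _ _ d1 d2 => .vpair (cps R d1) (cps R d2)
  | _, _, _, _, .vfst _ _ _ _ d => .vfst (cps R d)
  | _, _, _, _, .vsnd _ _ _ _ d => .vsnd (cps R d)
  | _, _, _, _, .vlam _ _ A _ d => .vlam (cpsV R A) (cps R d)
  | _, _, _, _, .vapp _ _ _ _ _ d1 d2 => .vapp (cps R d1) (cps R d2)
  | _, _, _, _, .cunit _ none => .llam .czero (.cimage R .svar)
  | _, _, _, _, .cunit _ (some D) => .cimage (cpsC R D) .svar
  | _, _, _, _, .cpair _ none _ _ A B d1 d2 =>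
      .llam (.csum (cpsC R A) (cpsC R B))
        (.ccase .svar (.lapp (cps R d1) .svar) (.lapp (cps R d2) .svar))
  | _, _, _, _, .cpair _ (some _) _ _ _ _ d1 d2 => .ccase .svar (cps R d1) (cps R d2)
  | _, _, _, _, .cfst _ none _ A _ d => .llam (cpsC R A) (.lapp (cps R d) (.cinl .svar))
  | _, _, _, _, .cfst _ (some _) _ _ _ d => Tm.ssubst (.cinl .svar) (cps R d)
  | _, _, _, _, .csnd _ none _ _ B d => .llam (cpsC R B) (.lapp (cps R d) (.cinr .svar))
  | _, _, _, _, .csnd _ (some _) _ _ _ d => Tm.ssubst (.cinr .svar) (cps R d)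
  | _, _, _, _, .clam _ none _ A B d =>
      .llam (.copow (cpsV R A) (cpsC R B)) (.copowlet .svar (.lapp (cps R d) .svar))
  | _, _, _, _, .clam _ (some _) _ _ _ d => .copowlet .svar (cps R d)
  | _, _, _, _, .capp _ none _ _ _ B d1 d2 =>
      .llam (cpsC R B) (.lapp (cps R d1) (.copow (cps R d2) .svar))
  | _, _, _, _, .capp _ (some _) _ _ _ _ d1 d2 =>
      Tm.ssubst (.copow (cps R d2) .svar) (cps R d1)
  | _, _, _, _, .top _ => .llam R .svar
  | _, _, _, _, .ilet _ none _ _ A d1 d2 =>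
      .llam (cpsC R A) (.lapp (cps R d1) (.lapp (cps R d2) .svar))
  | _, _, _, _, .ilet _ (some _) _ _ _ d1 d2 =>
      Tm.ssubst (.lapp (cps R d2) .svar) (cps R d1)
  | _, _, _, _, .bang _ _ A d => .llam (.carr (cpsV R A) R) (.capp .svar (cps R d))
  | _, _, _, _, .banglet _ none _ _ A B d1 d2 =>
      .llam (cpsC R B) (.lapp (cps R d1) (.clam (cpsV R A) (.lapp (cps R d2) .svar)))
  | _, _, _, _, .banglet _ (some _) _ _ A _ d1 d2 =>
      Tm.ssubst (.clam (cpsV R A) (.lapp (cps R d2) .svar)) (cps R d1)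
  | _, _, _, _, .copow _ none _ _ A B d1 d2 =>
      .llam (.carr (cpsV R A) (cpsC R B)) (.lapp (cps R d2) (.capp .svar (cps R d1)))
  | _, _, _, _, .copow _ (some _) _ _ _ _ d1 d2 =>
      Tm.ssubst (.capp .svar (cps R d1)) (cps R d2)
  | _, _, _, _, .copowlet _ none _ _ A _ C d1 d2 =>
      .llam (cpsC R C) (.lapp (cps R d1) (.clam (cpsV R A) (cps R d2)))
  | _, _, _, _, .copowlet _ (some _) _ _ A _ _ d1 d2 =>
      Tm.ssubst (.clam (cpsV R A) (cps R d2)) (cps R d1)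
  | _, _, _, _, .cimage _ none _ A d => .llam (cpsC R A) (.lapp (cps R d) .cunit)
  | _, _, _, _, .cimage _ (some _) _ _ d => Tm.ssubst .cunit (cps R d)
  | _, _, _, _, .cinl _ none _ A B d =>
      .llam (.cand (cpsC R A) (cpsC R B)) (.lapp (cps R d) (.cfst .svar))
  | _, _, _, _, .cinl _ (some _) _ _ _ d => Tm.ssubst (.cfst .svar) (cps R d)
  | _, _, _, _, .cinr _ none _ A B d =>
      .llam (.cand (cpsC R A) (cpsC R B)) (.lapp (cps R d) (.csnd .svar))
  | _, _, _, _, .cinr _ (some _) _ _ _ d => Tm.ssubst (.csnd .svar) (cps R d)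
  | _, _, _, _, .ccase _ none _ _ _ _ _ C d1 d2 d3 =>
      .llam (cpsC R C) (.lapp (cps R d1) (.cpair (cps R d2) (cps R d3)))
  | _, _, _, _, .ccase _ (some _) _ _ _ _ _ _ d1 d2 d3 =>
      Tm.ssubst (.cpair (cps R d2) (cps R d3)) (cps R d1)
  | _, _, _, _, .llam _ _ _ B d => .llam (cpsC R B) (cps R d)
  | _, _, _, _, .lapp _ none _ _ _ B d1 d2 =>
      .llam (cpsC R B) (.lapp (cps R d2) (.lapp (cps R d1) .svar))
  | _, _, _, _, .lapp _ (some _) _ _ _ _ d1 d2 =>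
      Tm.ssubst (.lapp (cps R d1) .svar) (cps R d2)

end EEC

namespace EEC

/-! ## The type isomorphisms `ι` of Figure 7, with explicit inverses -/

mutual
  /-- The closed term `ι_A : (Aᶜ)ᶜ → A` (Figure 7). -/
  def iotaV (R : CType) : VType → Tm
    | .base a => .vlam (.base a) (.var 0)
    | .unit => .vlam .unit .unit
    | .prod A B => .vlam (cpsV R (cpsV R (.prod A B)))
        (.vpair (.vapp (iotaV R A) (.vfst (.var 0))) (.vapp (iotaV R B) (.vsnd (.var 0))))
    | .arr A B => .vlam (cpsV R (cpsV R (.arr A B)))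
        (.vlam A (.vapp (iotaV R B) (.vapp (.var 1) (.vapp (iotaVinv R A) (.var 0)))))
    | .comp A => .vlam (cpsV R (cpsV R (.comp A)))
        (.lapp (iotaC R A) (.lapp (.var 0) .top))
    | .lin A B => .vlam (cpsV R (cpsV R (.lin A B)))
        (.llam A (.lapp (iotaC R B) (.lapp (.var 0) (.lapp (iotaCinv R A) .svar))))
  /-- The closed term `ι_A⁻¹ : A → (Aᶜ)ᶜ`. -/
  def iotaVinv (R : CType) : VType → Tm
    | .base a => .vlam (.base a) (.var 0)
    | .unit => .vlam .unit .unit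
    | .prod A B => .vlam (.prod A B)
        (.vpair (.vapp (iotaVinv R A) (.vfst (.var 0))) (.vapp (iotaVinv R B) (.vsnd (.var 0))))
    | .arr A B => .vlam (.arr A B)
        (.vlam (cpsV R (cpsV R A)) (.vapp (iotaVinv R B) (.vapp (.var 1) (.vapp (iotaV R A) (.var 0)))))
    | .comp A => .vlam (.comp A)
        (.llam .iunit (.ilet .svar (.lapp (iotaCinv R A) (.var 0))))
    | .lin A B => .vlam (.lin A B)
        (.llam (cpsC R (cpsC R A)) (.lapp (iotaCinv R B) (.lapp (.var 0) (.lapp (iotaC R A) .svar))))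
  /-- The closed term `ι_A̲ : (A̲ᶜ)ᶜ ⊸ A̲` (Figure 7). -/
  def iotaC (R : CType) : CType → Tm
    | .base a => .llam (cpsC R (cpsC R (.base a))) .svar
    | .cunit => .llam (cpsC R (cpsC R .cunit)) .cunit
    | .cand A B => .llam (cpsC R (cpsC R (.cand A B)))
        (.cpair (.lapp (iotaC R A) (.cfst .svar)) (.lapp (iotaC R B) (.csnd .svar)))
    | .carr A B => .llam (cpsC R (cpsC R (.carr A B)))
        (.clam A (.lapp (iotaC R B) (.capp .svar (.vapp (iotaVinv R A) (.var 0)))))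
    | .iunit => .llam (cpsC R (cpsC R .iunit)) .svar
    | .bang A => .llam (cpsC R (cpsC R (.bang A)))
        (.copowlet .svar (.ilet .svar (.bang (.vapp (iotaV R A) (.var 0)))))
    | .copow A B => .llam (cpsC R (cpsC R (.copow A B)))
        (.copowlet .svar (.copow (.vapp (iotaV R A) (.var 0)) (.lapp (iotaC R B) .svar)))
    | .czero => .llam (cpsC R (cpsC R .czero)) .svar
    | .csum A B => .llam (cpsC R (cpsC R (.csum A B)))
        (.ccase .svar (.cinl (.lapp (iotaC R A) .svar)) (.cinr (.lapp (iotaC R B) .svar)))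
  /-- The closed term `ι_A̲⁻¹ : A̲ ⊸ (A̲ᶜ)ᶜ`. -/
  def iotaCinv (R : CType) : CType → Tm
    | .base a => .llam (.base a) .svar
    | .cunit => .llam .cunit .cunit
    | .cand A B => .llam (.cand A B)
        (.cpair (.lapp (iotaCinv R A) (.cfst .svar)) (.lapp (iotaCinv R B) (.csnd .svar)))
    | .carr A B => .llam (.carr A B)
        (.clam (cpsV R (cpsV R A)) (.lapp (iotaCinv R B) (.capp .svar (.vapp (iotaV R A) (.var 0)))))
    | .iunit => .llam .iunit .svar
    | .bang A => .llam (.bang A)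
        (.banglet .svar (.copow (.vapp (iotaVinv R A) (.var 0)) .top))
    | .copow A B => .llam (.copow A B)
        (.copowlet .svar (.copow (.vapp (iotaVinv R A) (.var 0)) (.lapp (iotaCinv R B) .svar)))
    | .czero => .llam .czero .svar
    | .csum A B => .llam (.csum A B)
        (.ccase .svar (.cinl (.lapp (iotaCinv R A) .svar)) (.cinr (.lapp (iotaCinv R B) .svar)))
end

/-- The substitution `[ι⁻¹(Γ)]`, replacing each variable `xᵢ : Cᵢ` of `Γ` by
`ι_{Cᵢ}⁻¹(xᵢ)`. -/
def iotaSubst (R : CType) (Γ : List VType) (t : Tm) : Tm :=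
  Tm.psubst (fun n =>
    match Γ[n]? with
    | some C => .vapp (iotaVinv R C) (.var n)
    | none => .var n) t

/-! ## The simply-typed λ-calculus -/

/-- Simple types. -/
inductive STy : Type
  | base : ℕ → STy
  | unit : STy
  | prod : STy → STy → STy
  | arr : STy → STy → STy

/-- Raw simply-typed λ-terms (de Bruijn indices). -/
inductive LTm : Type
  | var : ℕ → LTm
  | unit : LTm
  | pair : LTm → LTm → LTm
  | fst : LTm → LTm
  | snd : LTm → LTm
  | lam : STy → LTm → LTm
  | app : LTm → LTm → LTm

namespace LTm

/-- Renaming of variables. -/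
def rename (f : ℕ → ℕ) : LTm → LTm
  | .var n => .var (f n)
  | .unit => .unit
  | .pair M N => .pair (rename f M) (rename f N)
  | .fst M => .fst (rename f M)
  | .snd M => .snd (rename f M)
  | .lam σ M => .lam σ (rename (Tm.liftN f) M)
  | .app M N => .app (rename f M) (rename f N)

/-- Weakening. -/
def shift (M : LTm) : LTm := rename Nat.succ M

/-- Parallel capture-avoiding substitution. -/
def psubst (σ : ℕ → LTm) : LTm → LTm
  | .var n => σ n
  | .unit => .unit
  | .pair M N => .pair (psubst σ M) (psubst σ N)
  | .fst M => .fst (psubst σ M)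
  | .snd M => .snd (psubst σ M)
  | .lam τ M => .lam τ (psubst (fun n => match n with | 0 => .var 0 | m + 1 => shift (σ m)) M)
  | .app M N => .app (psubst σ M) (psubst σ N)

/-- Capture-avoiding substitution `M[N/x]` for the innermost variable. -/
def subst0 (N : LTm) (M : LTm) : LTm :=
  psubst (fun n => match n with | 0 => N | m + 1 => .var m) M

end LTm

/-- Typing derivations of the simply-typed λ-calculus (Figure 3). -/
inductive LDeriv : List STy → LTm → STy → Type
  | var (Θ : List STy) (n : ℕ) (σ : STy) : Θ[n]? = some σ → LDeriv Θ (.var n) σ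
  | unit (Θ : List STy) : LDeriv Θ .unit .unit
  | pair (Θ : List STy) (M N : LTm) (σ τ : STy) :
      LDeriv Θ M σ → LDeriv Θ N τ → LDeriv Θ (.pair M N) (.prod σ τ)
  | fst (Θ : List STy) (M : LTm) (σ τ : STy) :
      LDeriv Θ M (.prod σ τ) → LDeriv Θ (.fst M) σ
  | snd (Θ : List STy) (M : LTm) (σ τ : STy) :
      LDeriv Θ M (.prod σ τ) → LDeriv Θ (.snd M) τ
  | lam (Θ : List STy) (M : LTm) (σ τ : STy) :
      LDeriv (σ :: Θ) M τ → LDeriv Θ (.lam σ M) (.arr σ τ)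
  | app (Θ : List STy) (M N : LTm) (σ τ : STy) :
      LDeriv Θ M (.arr σ τ) → LDeriv Θ N σ → LDeriv Θ (.app M N) τ

/-- Values of the (call-by-value) λ-calculus. -/
inductive LVal : LTm → Prop
  | var (n : ℕ) : LVal (.var n)
  | unit : LVal .unit
  | lam (σ : STy) (M : LTm) : LVal (.lam σ M)
  | pair {M N : LTm} : LVal M → LVal N → LVal (.pair M N)

/-- βη-equality of the simply-typed λ-calculus. -/
inductive LBetaEta : List STy → LTm → LTm → STy → Prop
  | refl {Θ M σ} : LDeriv Θ M σ → LBetaEta Θ M M σ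
  | symm {Θ M N σ} : LBetaEta Θ M N σ → LBetaEta Θ N M σ
  | trans {Θ M N P σ} : LBetaEta Θ M N σ → LBetaEta Θ N P σ → LBetaEta Θ M P σ
  | pair_cong {Θ M M' N N' σ τ} : LBetaEta Θ M M' σ → LBetaEta Θ N N' τ →
      LBetaEta Θ (.pair M N) (.pair M' N') (.prod σ τ)
  | fst_cong {Θ M M' σ τ} : LBetaEta Θ M M' (.prod σ τ) → LBetaEta Θ (.fst M) (.fst M') σ
  | snd_cong {Θ M M' σ τ} : LBetaEta Θ M M' (.prod σ τ) → LBetaEta Θ (.snd M) (.snd M') τ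
  | lam_cong {Θ M M' σ τ} : LBetaEta (σ :: Θ) M M' τ →
      LBetaEta Θ (.lam σ M) (.lam σ M') (.arr σ τ)
  | app_cong {Θ M M' N N' σ τ} : LBetaEta Θ M M' (.arr σ τ) → LBetaEta Θ N N' σ →
      LBetaEta Θ (.app M N) (.app M' N') τ
  | beta {Θ M N σ τ} : LDeriv (σ :: Θ) M τ → LDeriv Θ N σ →
      LBetaEta Θ (.app (.lam σ M) N) (LTm.subst0 N M) τ
  | eta {Θ M σ τ} : LDeriv Θ M (.arr σ τ) →
      LBetaEta Θ (.lam σ (.app (LTm.shift M) (.var 0))) M (.arr σ τ)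
  | fst_beta {Θ M N σ τ} : LDeriv Θ M σ → LDeriv Θ N τ →
      LBetaEta Θ (.fst (.pair M N)) M σ
  | snd_beta {Θ M N σ τ} : LDeriv Θ M σ → LDeriv Θ N τ →
      LBetaEta Θ (.snd (.pair M N)) N τ
  | pair_eta {Θ M σ τ} : LDeriv Θ M (.prod σ τ) →
      LBetaEta Θ (.pair (.fst M) (.snd M)) M (.prod σ τ)
  | unit_eta {Θ M} : LDeriv Θ M .unit → LBetaEta Θ M .unit .unit

/-- Equality in Moggi's computational λ-calculus `λc` (call-by-value
βη-equalities restricted to values, together with the `let`-laws, expressed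
via the standard encoding `let x = M in N := (λx.N) M`). -/
inductive LamC : List STy → LTm → LTm → STy → Prop
  | refl {Θ M σ} : LDeriv Θ M σ → LamC Θ M M σ
  | symm {Θ M N σ} : LamC Θ M N σ → LamC Θ N M σ
  | trans {Θ M N P σ} : LamC Θ M N σ → LamC Θ N P σ → LamC Θ M P σ
  | pair_cong {Θ M M' N N' σ τ} : LamC Θ M M' σ → LamC Θ N N' τ →
      LamC Θ (.pair M N) (.pair M' N') (.prod σ τ)
  | fst_cong {Θ M M' σ τ} : LamC Θ M M' (.prod σ τ) → LamC Θ (.fst M) (.fst M') σ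
  | snd_cong {Θ M M' σ τ} : LamC Θ M M' (.prod σ τ) → LamC Θ (.snd M) (.snd M') τ
  | lam_cong {Θ M M' σ τ} : LamC (σ :: Θ) M M' τ →
      LamC Θ (.lam σ M) (.lam σ M') (.arr σ τ)
  | app_cong {Θ M M' N N' σ τ} : LamC Θ M M' (.arr σ τ) → LamC Θ N N' σ →
      LamC Θ (.app M N) (.app M' N') τ
  | beta_v {Θ M V σ τ} : LDeriv (σ :: Θ) M τ → LDeriv Θ V σ → LVal V →
      LamC Θ (.app (.lam σ M) V) (LTm.subst0 V M) τ
  | eta_v {Θ V σ τ} : LVal V → LDeriv Θ V (.arr σ τ) →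
      LamC Θ (.lam σ (.app (LTm.shift V) (.var 0))) V (.arr σ τ)
  | fst_beta_v {Θ V W σ τ} : LVal V → LVal W → LDeriv Θ V σ → LDeriv Θ W τ →
      LamC Θ (.fst (.pair V W)) V σ
  | snd_beta_v {Θ V W σ τ} : LVal V → LVal W → LDeriv Θ V σ → LDeriv Θ W τ →
      LamC Θ (.snd (.pair V W)) W τ
  | pair_eta_v {Θ V σ τ} : LVal V → LDeriv Θ V (.prod σ τ) →
      LamC Θ (.pair (.fst V) (.snd V)) V (.prod σ τ)
  | unit_eta_v {Θ V} : LVal V → LDeriv Θ V .unit → LamC Θ V .unit .unit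
  | let_eta {Θ M σ} : LDeriv Θ M σ → LamC Θ (.app (.lam σ (.var 0)) M) M σ
  | let_assoc {Θ M N L σ ρ τ} : LDeriv (σ :: Θ) M τ → LDeriv (ρ :: Θ) N σ →
      LDeriv Θ L ρ →
      LamC Θ (.app (.lam σ M) (.app (.lam ρ N) L))
        (.app (.lam ρ (.app (.lam σ (LTm.rename (Tm.liftN Nat.succ) M)) N)) L) τ
  | app_left {Θ M N σ τ} : LDeriv Θ M (.arr σ τ) → LDeriv Θ N σ →
      LamC Θ (.app M N) (.app (.lam (.arr σ τ) (.app (.var 0) (LTm.shift N))) M) τ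
  | app_right {Θ V N σ τ} : LVal V → LDeriv Θ V (.arr σ τ) → LDeriv Θ N σ →
      LamC Θ (.app V N) (.app (.lam σ (.app (LTm.shift V) (.var 0))) N) τ
  | pair_left {Θ M N σ τ} : LDeriv Θ M σ → LDeriv Θ N τ →
      LamC Θ (.pair M N) (.app (.lam σ (.pair (.var 0) (LTm.shift N))) M) (.prod σ τ)
  | pair_right {Θ V N σ τ} : LVal V → LDeriv Θ V σ → LDeriv Θ N τ →
      LamC Θ (.pair V N) (.app (.lam τ (.pair (LTm.shift V) (.var 0))) N) (.prod σ τ)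
  | fst_cc {Θ M σ τ} : LDeriv Θ M (.prod σ τ) →
      LamC Θ (.fst M) (.app (.lam (.prod σ τ) (.fst (.var 0))) M) σ
  | snd_cc {Θ M σ τ} : LDeriv Θ M (.prod σ τ) →
      LamC Θ (.snd M) (.app (.lam (.prod σ τ) (.snd (.var 0))) M) τ

end EEC

namespace EEC

/-! ## The standard cbv and cbn translations of typed λ-calculus into EEC -/

/-- The computation-type constant `α̲` associated with a simply-typed
λ-calculus type constant `α` (the association is injective but not
surjective, so that some computation-type constants of EEC are different
from `α̲` for every λ-calculus type constant `α`). -/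
def assocC (a : ℕ) : CType := .base (a + 1)

/-- The call-by-value translation `σᵛ` on types. -/
def cbvT : STy → VType
  | .base a => .base a
  | .unit => .unit
  | .prod σ τ => .prod (cbvT σ) (cbvT τ)
  | .arr σ τ => .arr (cbvT σ) (.comp (.bang (cbvT τ)))

/-- The call-by-value translation `Θᵛ` on contexts. -/
def cbvCtx (Θ : List STy) : List VType := Θ.map cbvT

/-- The call-by-value translation on terms: `Θ ⊢ M : τ` is sent to
`Θᵛ ⊢ Mᵛ : !(τᵛ)`. -/
def cbvTm : LTm → Tm
  | .var n => .bang (.var n)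
  | .unit => .bang .unit
  | .pair M N => .banglet (cbvTm M) (.banglet (Tm.shift (cbvTm N)) (.bang (.vpair (.var 1) (.var 0))))
  | .fst M => .banglet (cbvTm M) (.bang (.vfst (.var 0)))
  | .snd M => .banglet (cbvTm M) (.bang (.vsnd (.var 0)))
  | .lam σ M => .bang (.vlam (cbvT σ) (cbvTm M))
  | .app M N => .banglet (cbvTm M) (.banglet (Tm.shift (cbvTm N)) (.vapp (.var 1) (.var 0)))

/-- The call-by-name translation `σⁿ` on types. -/
def cbnT : STy → CType
  | .base a => assocC a
  | .unit => .cunit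
  | .prod σ τ => .cand (cbnT σ) (cbnT τ)
  | .arr σ τ => .carr (.comp (cbnT σ)) (cbnT τ)

/-- The call-by-name translation `Θⁿ` on contexts. -/
def cbnCtx (Θ : List STy) : List VType := Θ.map (fun σ => .comp (cbnT σ))

/-- The call-by-name translation on terms: `Θ ⊢ M : τ` is sent to
`Θⁿ ⊢ Mⁿ : τⁿ`, mimicking each construct by the corresponding
computation-type construct of EEC. -/
def cbnTm : LTm → Tm
  | .var n => .var n
  | .unit => .cunit
  | .pair M N => .cpair (cbnTm M) (cbnTm N)
  | .fst M => .cfst (cbnTm M)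
  | .snd M => .csnd (cbnTm M)
  | .lam σ M => .clam (.comp (cbnT σ)) (cbnTm M)
  | .app M N => .capp (cbnTm M) (cbnTm N)

/-! ## Hasegawa's linear-use CPS translations (Section 4) -/

/-- The call-by-value linear-use CPS translation `σᵛᶜ` on types. -/
def cbvcpsT (R : CType) : STy → VType
  | .base a => .base a
  | .unit => .unit
  | .prod σ τ => .prod (cbvcpsT R σ) (cbvcpsT R τ)
  | .arr σ τ => .arr (cbvcpsT R σ) (.lin (.carr (cbvcpsT R τ) R) R)

/-- `Θᵛᶜ`. -/
def cbvcpsCtx (R : CType) (Θ : List STy) : List VType := Θ.map (cbvcpsT R)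

/-- The call-by-value linear-use CPS translation on terms: `Θ ⊢ M : τ` is
sent to `Θᵛᶜ ⊢ Mᵛᶜ : (τᵛᶜ ⇒ R̲) ⊸ R̲`. -/
def cbvcps (R : CType) : {Θ : List STy} → {M : LTm} → {σ : STy} → LDeriv Θ M σ → Tm
  | _, _, _, .var _ n σ _ => .llam (.carr (cbvcpsT R σ) R) (.capp .svar (.var n))
  | _, _, _, .unit _ => .llam (.carr .unit R) (.capp .svar .unit)
  | _, _, _, .pair _ _ _ σ τ dM dN =>
      .llam (.carr (.prod (cbvcpsT R σ) (cbvcpsT R τ)) R)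
        (.lapp (cbvcps R dM)
          (.clam (cbvcpsT R σ)
            (.lapp (Tm.shift (cbvcps R dN))
              (.clam (cbvcpsT R τ) (.capp .svar (.vpair (.var 1) (.var 0)))))))
  | _, _, _, .fst _ _ σ τ dM =>
      .llam (.carr (cbvcpsT R σ) R)
        (.lapp (cbvcps R dM)
          (.clam (.prod (cbvcpsT R σ) (cbvcpsT R τ)) (.capp .svar (.vfst (.var 0)))))
  | _, _, _, .snd _ _ σ τ dM =>
      .llam (.carr (cbvcpsT R τ) R)
        (.lapp (cbvcps R dM)
          (.clam (.prod (cbvcpsT R σ) (cbvcpsT R τ)) (.capp .svar (.vsnd (.var 0)))))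
  | _, _, _, .lam _ _ σ τ dM =>
      .llam (.carr (.arr (cbvcpsT R σ) (.lin (.carr (cbvcpsT R τ) R) R)) R)
        (.capp .svar (.vlam (cbvcpsT R σ) (cbvcps R dM)))
  | _, _, _, .app _ _ _ σ τ dM dN =>
      .llam (.carr (cbvcpsT R τ) R)
        (.lapp (cbvcps R dM)
          (.clam (.arr (cbvcpsT R σ) (.lin (.carr (cbvcpsT R τ) R) R))
            (.lapp (Tm.shift (cbvcps R dN))
              (.clam (cbvcpsT R σ) (.lapp (.vapp (.var 1) (.var 0)) .svar)))))

/-- The call-by-name linear-use CPS translation `σⁿᶜ` on types. -/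
def cbncpsT (R : CType) : STy → CType
  | .base a => assocC a
  | .unit => .czero
  | .prod σ τ => .csum (cbncpsT R σ) (cbncpsT R τ)
  | .arr σ τ => .copow (.lin (cbncpsT R σ) R) (cbncpsT R τ)

/-- `Θⁿᶜ ⊸ R̲`, assigning each variable `xᵢ : σᵢ` the type `σᵢⁿᶜ ⊸ R̲`. -/
def cbncpsCtx (R : CType) (Θ : List STy) : List VType :=
  Θ.map (fun σ => .lin (cbncpsT R σ) R)

/-- The call-by-name linear-use CPS translation on terms: `Θ ⊢ M : τ` is
sent to `Θⁿᶜ ⊸ R̲ ⊢ Mⁿᶜ : τⁿᶜ ⊸ R̲`. -/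
def cbncps (R : CType) : {Θ : List STy} → {M : LTm} → {σ : STy} → LDeriv Θ M σ → Tm
  | _, _, _, .var _ n _ _ => .var n
  | _, _, _, .unit _ => .llam .czero (.cimage R .svar)
  | _, _, _, .pair _ _ _ σ τ dM dN =>
      .llam (.csum (cbncpsT R σ) (cbncpsT R τ))
        (.ccase .svar (.lapp (cbncps R dM) .svar) (.lapp (cbncps R dN) .svar))
  | _, _, _, .fst _ _ σ _τ dM => .llam (cbncpsT R σ) (.lapp (cbncps R dM) (.cinl .svar))
  | _, _, _, .snd _ _ _ τ dM => .llam (cbncpsT R τ) (.lapp (cbncps R dM) (.cinr .svar))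
  | _, _, _, .lam _ _ σ τ dM =>
      .llam (.copow (.lin (cbncpsT R σ) R) (cbncpsT R τ))
        (.copowlet .svar (.lapp (cbncps R dM) .svar))
  | _, _, _, .app _ _ _ σ τ dM dN =>
      .llam (cbncpsT R τ) (.lapp (cbncps R dM) (.copow (cbncps R dN) .svar))

end EEC

namespace EEC

/-! ## Raw substitution calculus -/

namespace Tm

/-- The stoup variable does not occur free. -/
def SFree : Tm → Prop
  | .var _ => True
  | .svar => False
  | .unit => True
  | .vpair t u => SFree t ∧ SFree u
  | .vfst t => SFree t
  | .vsnd t => SFree t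
  | .vlam _ t => SFree t
  | .vapp s t => SFree s ∧ SFree t
  | .cunit => True
  | .cpair t u => SFree t ∧ SFree u
  | .cfst t => SFree t
  | .csnd t => SFree t
  | .clam _ t => SFree t
  | .capp s t => SFree s ∧ SFree t
  | .top => True
  | .ilet t u => SFree t ∧ SFree u
  | .bang t => SFree t
  | .banglet t u => SFree t ∧ SFree u
  | .copow t u => SFree t ∧ SFree u
  | .copowlet s _ => SFree s
  | .cimage _ t => SFree t
  | .cinl t => SFree t
  | .cinr t => SFree t
  | .ccase s _ _ => SFree s
  | .llam _ _ => True
  | .lapp s t => SFree s ∧ SFree t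

/-- The substitution replacing the innermost variable only. -/
def single (u : Tm) : ℕ → Tm
  | 0 => u
  | n + 1 => .var n

theorem subst0_eq (u t : Tm) : subst0 u t = psubst (single u) t := by
  unfold subst0
  congr 1

theorem liftN_comp (f g : ℕ → ℕ) : liftN f ∘ liftN g = liftN (f ∘ g) := by
  funext n; cases n <;> rfl

theorem rename_rename (t : Tm) : ∀ f g : ℕ → ℕ,
    rename f (rename g t) = rename (f ∘ g) t := by
  induction t <;> intro f g <;> simp_all [rename, liftN_comp]

theorem liftS_comp_liftN (σ : ℕ → Tm) (f : ℕ → ℕ) : liftS σ ∘ liftN f = liftS (σ ∘ f) := by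
  funext n; cases n <;> rfl

theorem psubst_rename (t : Tm) : ∀ (σ : ℕ → Tm) (f : ℕ → ℕ),
    psubst σ (rename f t) = psubst (σ ∘ f) t := by
  induction t <;> intro σ f <;> simp_all [rename, psubst, liftS_comp_liftN]

theorem rename_shift (f : ℕ → ℕ) (t : Tm) : rename (liftN f) (shift t) = shift (rename f t) := by
  simp only [shift, rename_rename]; rfl

theorem rename_comp_liftS (f : ℕ → ℕ) (σ : ℕ → Tm) :
    rename (liftN f) ∘ liftS σ = liftS (rename f ∘ σ) := by
  funext n
  cases n with
  | zero => rfl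
  | succ n => exact rename_shift f (σ n)

theorem rename_psubst (t : Tm) : ∀ (f : ℕ → ℕ) (σ : ℕ → Tm),
    rename f (psubst σ t) = psubst (rename f ∘ σ) t := by
  induction t <;> intro f σ <;> simp_all [rename, psubst, rename_comp_liftS]

theorem psubst_shift (σ : ℕ → Tm) (t : Tm) : psubst (liftS σ) (shift t) = shift (psubst σ t) := by
  simp only [shift, psubst_rename, rename_psubst]; rfl

theorem psubst_comp_liftS (τ σ : ℕ → Tm) :
    psubst (liftS τ) ∘ liftS σ = liftS (psubst τ ∘ σ) := by
  funext n
  cases n with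
  | zero => rfl
  | succ n => exact psubst_shift τ (σ n)

theorem psubst_psubst (t : Tm) : ∀ τ σ : ℕ → Tm,
    psubst τ (psubst σ t) = psubst (psubst τ ∘ σ) t := by
  induction t <;> intro τ σ <;> simp_all [psubst, psubst_comp_liftS]

theorem liftS_var : liftS Tm.var = Tm.var := by
  funext n; cases n <;> rfl

theorem psubst_var (t : Tm) : psubst .var t = t := by
  induction t <;> simp_all [psubst, liftS_var]

theorem rename_eq_psubst (f : ℕ → ℕ) (t : Tm) : rename f t = psubst (fun n => .var (f n)) t := by
  conv_lhs => rw [← psubst_var (rename f t)]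
  rw [psubst_rename]; rfl

theorem single_shift (u t : Tm) : psubst (single u) (shift t) = t := by
  rw [shift, psubst_rename]; exact psubst_var t

theorem rename_ssubst (t : Tm) : ∀ (f : ℕ → ℕ) (u : Tm),
    rename f (ssubst u t) = ssubst (rename f u) (rename f t) := by
  induction t <;> intro f u <;> simp_all [rename, ssubst, rename_shift]

theorem shift_ssubst (u t : Tm) : shift (ssubst u t) = ssubst (shift u) (shift t) :=
  rename_ssubst t _ u

theorem SFree.rename {t : Tm} : ∀ {f : ℕ → ℕ}, SFree t → SFree (rename f t) := by
  induction t <;> intro f <;> simp_all [Tm.rename, SFree]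

theorem SFree.liftS {σ : ℕ → Tm} (h : ∀ n, SFree (σ n)) : ∀ n, SFree (liftS σ n)
  | 0 => trivial
  | n + 1 => (h n).rename

theorem SFree.psubst {t : Tm} : ∀ {σ : ℕ → Tm}, SFree t → (∀ n, SFree (σ n)) →
    SFree (psubst σ t) := by
  induction t <;> intro σ <;> simp_all +contextual [Tm.psubst, SFree, SFree.liftS]

theorem SFree.ssubst {t : Tm} : ∀ {u : Tm}, SFree t → ssubst u t = t := by
  induction t <;> intro u <;> simp_all +contextual [Tm.ssubst, SFree]

theorem psubst_ssubst (t : Tm) : ∀ (σ : ℕ → Tm) (u : Tm), (∀ n, SFree (σ n)) →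
    psubst σ (ssubst u t) = ssubst (psubst σ u) (psubst σ t) := by
  induction t <;> intro σ u h <;>
    simp_all +contextual [psubst, ssubst, psubst_shift, SFree.ssubst, SFree.liftS]

theorem ssubst_ssubst (t : Tm) : ∀ u v : Tm,
    ssubst u (ssubst v t) = ssubst (ssubst u v) t := by
  induction t <;> intro u v <;> simp_all [ssubst, shift_ssubst]

theorem ssubst_svar (t : Tm) : ssubst .svar t = t := by
  induction t <;> simp_all [ssubst, shift, rename]

end Tm
end EEC

namespace EEC

/-! ## Typing and equality under substitution -/

/-- Inhabitation of the typing judgement. -/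
abbrev Ty (Γ : List VType) (Δ : Option CType) (t : Tm) (A : VType) : Prop :=
  Nonempty (Deriv Γ Δ t A)

namespace Ty
theorem svar {Γ : List VType} {A : CType} :
    Ty Γ (some A) .svar (.comp A) := ⟨.svar _ _⟩
theorem unit {Γ : List VType} :
    Ty Γ none .unit .unit := ⟨.unit _⟩
theorem vpair {Γ : List VType} {t u : Tm} {A B : VType} :
    Ty Γ none t A → Ty Γ none u B →
    Ty Γ none (.vpair t u) (.prod A B) := fun h0 h1 => ⟨.vpair _ _ _ _ _ h0.some h1.some⟩
theorem vfst {Γ : List VType} {t : Tm} {A B : VType} :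
    Ty Γ none t (.prod A B) →
    Ty Γ none (.vfst t) A := fun h0 => ⟨.vfst _ _ _ _ h0.some⟩
theorem vsnd {Γ : List VType} {t : Tm} {A B : VType} :
    Ty Γ none t (.prod A B) →
    Ty Γ none (.vsnd t) B := fun h0 => ⟨.vsnd _ _ _ _ h0.some⟩
theorem vlam {Γ : List VType} {t : Tm} {A B : VType} :
    Ty (A :: Γ) none t B →
    Ty Γ none (.vlam A t) (.arr A B) := fun h0 => ⟨.vlam _ _ _ _ h0.some⟩
theorem vapp {Γ : List VType} {s t : Tm} {A B : VType} :
    Ty Γ none s (.arr A B) → Ty Γ none t A →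
    Ty Γ none (.vapp s t) B := fun h0 h1 => ⟨.vapp _ _ _ _ _ h0.some h1.some⟩
theorem cunit {Γ : List VType} {Δ : Option CType} :
    Ty Γ Δ .cunit (.comp .cunit) := ⟨.cunit _ _⟩
theorem cpair {Γ : List VType} {Δ : Option CType} {t u : Tm} {A B : CType} :
    Ty Γ Δ t (.comp A) → Ty Γ Δ u (.comp B) →
    Ty Γ Δ (.cpair t u) (.comp (.cand A B)) := fun h0 h1 => ⟨.cpair _ _ _ _ _ _ h0.some h1.some⟩
theorem cfst {Γ : List VType} {Δ : Option CType} {t : Tm} {A B : CType} :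
    Ty Γ Δ t (.comp (.cand A B)) →
    Ty Γ Δ (.cfst t) (.comp A) := fun h0 => ⟨.cfst _ _ _ _ _ h0.some⟩
theorem csnd {Γ : List VType} {Δ : Option CType} {t : Tm} {A B : CType} :
    Ty Γ Δ t (.comp (.cand A B)) →
    Ty Γ Δ (.csnd t) (.comp B) := fun h0 => ⟨.csnd _ _ _ _ _ h0.some⟩
theorem clam {Γ : List VType} {Δ : Option CType} {t : Tm} {A : VType} {B : CType} :
    Ty (A :: Γ) Δ t (.comp B) →
    Ty Γ Δ (.clam A t) (.comp (.carr A B)) := fun h0 => ⟨.clam _ _ _ _ _ h0.some⟩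
theorem capp {Γ : List VType} {Δ : Option CType} {s t : Tm} {A : VType} {B : CType} :
    Ty Γ Δ s (.comp (.carr A B)) → Ty Γ none t A →
    Ty Γ Δ (.capp s t) (.comp B) := fun h0 h1 => ⟨.capp _ _ _ _ _ _ h0.some h1.some⟩
theorem top {Γ : List VType} :
    Ty Γ none .top (.comp .iunit) := ⟨.top _⟩
theorem ilet {Γ : List VType} {Δ : Option CType} {t u : Tm} {A : CType} :
    Ty Γ Δ t (.comp .iunit) → Ty Γ none u (.comp A) →
    Ty Γ Δ (.ilet t u) (.comp A) := fun h0 h1 => ⟨.ilet _ _ _ _ _ h0.some h1.some⟩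
theorem bang {Γ : List VType} {t : Tm} {A : VType} :
    Ty Γ none t A →
    Ty Γ none (.bang t) (.comp (.bang A)) := fun h0 => ⟨.bang _ _ _ h0.some⟩
theorem banglet {Γ : List VType} {Δ : Option CType} {t u : Tm} {A : VType} {B : CType} :
    Ty Γ Δ t (.comp (.bang A)) → Ty (A :: Γ) none u (.comp B) →
    Ty Γ Δ (.banglet t u) (.comp B) := fun h0 h1 => ⟨.banglet _ _ _ _ _ _ h0.some h1.some⟩
theorem copow {Γ : List VType} {Δ : Option CType} {t u : Tm} {A : VType} {B : CType} :
    Ty Γ none t A → Ty Γ Δ u (.comp B) →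
    Ty Γ Δ (.copow t u) (.comp (.copow A B)) := fun h0 h1 => ⟨.copow _ _ _ _ _ _ h0.some h1.some⟩
theorem copowlet {Γ : List VType} {Δ : Option CType} {s t : Tm} {A : VType} {B C : CType} :
    Ty Γ Δ s (.comp (.copow A B)) → Ty (A :: Γ) (some B) t (.comp C) →
    Ty Γ Δ (.copowlet s t) (.comp C) := fun h0 h1 => ⟨.copowlet _ _ _ _ _ _ _ h0.some h1.some⟩
theorem cimage {Γ : List VType} {Δ : Option CType} {t : Tm} {A : CType} :
    Ty Γ Δ t (.comp .czero) →
    Ty Γ Δ (.cimage A t) (.comp A) := fun h0 => ⟨.cimage _ _ _ _ h0.some⟩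
theorem cinl {Γ : List VType} {Δ : Option CType} {t : Tm} {A B : CType} :
    Ty Γ Δ t (.comp A) →
    Ty Γ Δ (.cinl t) (.comp (.csum A B)) := fun h0 => ⟨.cinl _ _ _ _ _ h0.some⟩
theorem cinr {Γ : List VType} {Δ : Option CType} {t : Tm} {A B : CType} :
    Ty Γ Δ t (.comp B) →
    Ty Γ Δ (.cinr t) (.comp (.csum A B)) := fun h0 => ⟨.cinr _ _ _ _ _ h0.some⟩
theorem ccase {Γ : List VType} {Δ : Option CType} {s t u : Tm} {A B C : CType} :
    Ty Γ Δ s (.comp (.csum A B)) → Ty Γ (some A) t (.comp C) → Ty Γ (some B) u (.comp C) →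
    Ty Γ Δ (.ccase s t u) (.comp C) := fun h0 h1 h2 => ⟨.ccase _ _ _ _ _ _ _ _ h0.some h1.some h2.some⟩
theorem llam {Γ : List VType} {t : Tm} {A B : CType} :
    Ty Γ (some A) t (.comp B) →
    Ty Γ none (.llam A t) (.lin A B) := fun h0 => ⟨.llam _ _ _ _ h0.some⟩
theorem lapp {Γ : List VType} {Δ : Option CType} {s t : Tm} {A B : CType} :
    Ty Γ none s (.lin A B) → Ty Γ Δ t (.comp A) →
    Ty Γ Δ (.lapp s t) (.comp B) := fun h0 h1 => ⟨.lapp _ _ _ _ _ _ h0.some h1.some⟩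

end Ty

theorem Deriv.sfree {Γ Δ t A} (d : Deriv Γ Δ t A) : Δ = none → Tm.SFree t := by
  induction d <;> intro h <;> simp_all [Tm.SFree]

theorem Ty.rename {Γ Δ t A} : ∀ {Γ' : List VType} {f : ℕ → ℕ}, Ty Γ Δ t A →
    (∀ n B, Γ[n]? = some B → Γ'[f n]? = some B) → Ty Γ' Δ (t.rename f) A := by
  have lift : ∀ {Γ Γ' : List VType} {f : ℕ → ℕ} (A : VType),
      (∀ n B, Γ[n]? = some B → Γ'[f n]? = some B) →
      ∀ n B, (A :: Γ)[n]? = some B → (A :: Γ')[Tm.liftN f n]? = some B := by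
    intro Γ Γ' f A h n B hn
    cases n with
    | zero => exact hn
    | succ n => exact h n B hn
  rintro Γ' f ⟨d⟩ hf
  induction d generalizing Γ' f with
  | var _ n A h => exact ⟨.var _ _ _ (hf _ _ h)⟩
  | svar => exact Ty.svar
  | unit _ => exact Ty.unit
  | vpair _ _ _ _ _ _ _ ih0 ih1 => exact Ty.vpair (ih0 hf) (ih1 hf)
  | vfst _ _ _ _ _ ih0 => exact Ty.vfst (ih0 hf)
  | vsnd _ _ _ _ _ ih0 => exact Ty.vsnd (ih0 hf)
  | vlam _ _ _ _ _ ih0 => exact Ty.vlam (ih0 (lift _ hf))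
  | vapp _ _ _ _ _ _ _ ih0 ih1 => exact Ty.vapp (ih0 hf) (ih1 hf)
  | cunit _ _ => exact Ty.cunit
  | cpair _ _ _ _ _ _ _ _ ih0 ih1 => exact Ty.cpair (ih0 hf) (ih1 hf)
  | cfst _ _ _ _ _ _ ih0 => exact Ty.cfst (ih0 hf)
  | csnd _ _ _ _ _ _ ih0 => exact Ty.csnd (ih0 hf)
  | clam _ _ _ _ _ _ ih0 => exact Ty.clam (ih0 (lift _ hf))
  | capp _ _ _ _ _ _ _ _ ih0 ih1 => exact Ty.capp (ih0 hf) (ih1 hf)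
  | top _ => exact Ty.top
  | ilet _ _ _ _ _ _ _ ih0 ih1 => exact Ty.ilet (ih0 hf) (ih1 hf)
  | bang _ _ _ _ ih0 => exact Ty.bang (ih0 hf)
  | banglet _ _ _ _ _ _ _ _ ih0 ih1 => exact Ty.banglet (ih0 hf) (ih1 (lift _ hf))
  | copow _ _ _ _ _ _ _ _ ih0 ih1 => exact Ty.copow (ih0 hf) (ih1 hf)
  | copowlet _ _ _ _ _ _ _ _ _ ih0 ih1 => exact Ty.copowlet (ih0 hf) (ih1 (lift _ hf))
  | cimage _ _ _ _ _ ih0 => exact Ty.cimage (ih0 hf)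
  | cinl _ _ _ _ _ _ ih0 => exact Ty.cinl (ih0 hf)
  | cinr _ _ _ _ _ _ ih0 => exact Ty.cinr (ih0 hf)
  | ccase _ _ _ _ _ _ _ _ _ _ _ ih0 ih1 ih2 => exact Ty.ccase (ih0 hf) (ih1 hf) (ih2 hf)
  | llam _ _ _ _ _ ih0 => exact Ty.llam (ih0 hf)
  | lapp _ _ _ _ _ _ _ _ ih0 ih1 => exact Ty.lapp (ih0 hf) (ih1 hf)

theorem Ty.shift {Γ Δ t A} (d : Ty Γ Δ t A) (B : VType) : Ty (B :: Γ) Δ t.shift A :=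
  d.rename fun _ _ h => h

/-- `σ` is a well-typed parallel substitution from `Γ` to `Γ'`. -/
structure TSub (Γ Γ' : List VType) (σ : ℕ → Tm) : Prop where
  ty : ∀ n A, Γ[n]? = some A → Ty Γ' none (σ n) A
  sfree : ∀ n, Tm.SFree (σ n)

theorem TSub.lift {Γ Γ' σ} (h : TSub Γ Γ' σ) (A : VType) :
    TSub (A :: Γ) (A :: Γ') (Tm.liftS σ) where
  ty n B hn := by
    cases n with
    | zero => exact ⟨.var _ _ _ hn⟩
    | succ n => exact (h.ty n B hn).shift A
  sfree := Tm.SFree.liftS h.sfree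

theorem TSub.single {Γ u A} (d : Ty Γ none u A) : TSub (A :: Γ) Γ (Tm.single u) where
  ty n B hn := by
    cases n with
    | zero => cases hn; exact d
    | succ n => exact ⟨.var _ _ _ hn⟩
  sfree n := by
    cases n with
    | zero => exact d.some.sfree rfl
    | succ n => trivial

theorem TSub.wk (Γ : List VType) (A : VType) : TSub Γ (A :: Γ) (fun n => .var (n + 1)) where
  ty _ _ hn := ⟨.var _ _ _ hn⟩
  sfree _ := trivial

theorem Ty.psubst {Γ Δ t A} : ∀ {Γ' : List VType} {σ : ℕ → Tm}, Ty Γ Δ t A →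
    TSub Γ Γ' σ → Ty Γ' Δ (t.psubst σ) A := by
  rintro Γ' σ ⟨d⟩ hσ
  induction d generalizing Γ' σ with
  | var _ n A h => exact hσ.ty _ _ h
  | svar => exact Ty.svar
  | unit _ => exact Ty.unit
  | vpair _ _ _ _ _ _ _ ih0 ih1 => exact Ty.vpair (ih0 hσ) (ih1 hσ)
  | vfst _ _ _ _ _ ih0 => exact Ty.vfst (ih0 hσ)
  | vsnd _ _ _ _ _ ih0 => exact Ty.vsnd (ih0 hσ)
  | vlam _ _ _ _ _ ih0 => exact Ty.vlam (ih0 (hσ.lift _))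
  | vapp _ _ _ _ _ _ _ ih0 ih1 => exact Ty.vapp (ih0 hσ) (ih1 hσ)
  | cunit _ _ => exact Ty.cunit
  | cpair _ _ _ _ _ _ _ _ ih0 ih1 => exact Ty.cpair (ih0 hσ) (ih1 hσ)
  | cfst _ _ _ _ _ _ ih0 => exact Ty.cfst (ih0 hσ)
  | csnd _ _ _ _ _ _ ih0 => exact Ty.csnd (ih0 hσ)
  | clam _ _ _ _ _ _ ih0 => exact Ty.clam (ih0 (hσ.lift _))
  | capp _ _ _ _ _ _ _ _ ih0 ih1 => exact Ty.capp (ih0 hσ) (ih1 hσ)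
  | top _ => exact Ty.top
  | ilet _ _ _ _ _ _ _ ih0 ih1 => exact Ty.ilet (ih0 hσ) (ih1 hσ)
  | bang _ _ _ _ ih0 => exact Ty.bang (ih0 hσ)
  | banglet _ _ _ _ _ _ _ _ ih0 ih1 => exact Ty.banglet (ih0 hσ) (ih1 (hσ.lift _))
  | copow _ _ _ _ _ _ _ _ ih0 ih1 => exact Ty.copow (ih0 hσ) (ih1 hσ)
  | copowlet _ _ _ _ _ _ _ _ _ ih0 ih1 => exact Ty.copowlet (ih0 hσ) (ih1 (hσ.lift _))
  | cimage _ _ _ _ _ ih0 => exact Ty.cimage (ih0 hσ)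
  | cinl _ _ _ _ _ _ ih0 => exact Ty.cinl (ih0 hσ)
  | cinr _ _ _ _ _ _ ih0 => exact Ty.cinr (ih0 hσ)
  | ccase _ _ _ _ _ _ _ _ _ _ _ ih0 ih1 ih2 => exact Ty.ccase (ih0 hσ) (ih1 hσ) (ih2 hσ)
  | llam _ _ _ _ _ ih0 => exact Ty.llam (ih0 hσ)
  | lapp _ _ _ _ _ _ _ _ ih0 ih1 => exact Ty.lapp (ih0 hσ) (ih1 hσ)

theorem Ty.subst0 {Γ Δ t u A B} (d : Ty (A :: Γ) Δ t B) (e : Ty Γ none u A) :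
    Ty Γ Δ (Tm.subst0 u t) B := by
  rw [Tm.subst0_eq]; exact d.psubst (.single e)

theorem Ty.ssubst {Γ Δ t u B C} : Ty Γ (some B) t C → Ty Γ Δ u (.comp B) →
    Ty Γ Δ (Tm.ssubst u t) C := by
  rintro ⟨d⟩ hu
  generalize h : some B = Δ' at d
  induction d generalizing u with
  | var => cases h
  | svar => cases h; exact hu
  | unit _ => cases h
  | vpair _ _ _ _ _ _ _ _ _ => cases h
  | vfst _ _ _ _ _ _ => cases h
  | vsnd _ _ _ _ _ _ => cases h
  | vlam _ _ _ _ _ _ => cases h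
  | vapp _ _ _ _ _ _ _ _ _ => cases h
  | cunit _ _ => exact Ty.cunit 
  | cpair _ _ _ _ _ _ d0 d1 ih0 ih1 => exact Ty.cpair (ih0 hu h) (ih1 hu h)
  | cfst _ _ _ _ _ d0 ih0 => exact Ty.cfst (ih0 hu h)
  | csnd _ _ _ _ _ d0 ih0 => exact Ty.csnd (ih0 hu h)
  | clam _ _ _ _ _ d0 ih0 => exact Ty.clam (ih0 (hu.shift _) h)
  | capp _ _ _ _ _ _ d0 d1 ih0 ih1 => rw [Tm.ssubst, Tm.SFree.ssubst (d1.sfree rfl)]; exact Ty.capp (ih0 hu h) ⟨d1⟩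
  | top _ => cases h
  | ilet _ _ _ _ _ d0 d1 ih0 ih1 => rw [Tm.ssubst, Tm.SFree.ssubst (d1.sfree rfl)]; exact Ty.ilet (ih0 hu h) ⟨d1⟩
  | bang _ _ _ _ _ => cases h
  | banglet _ _ _ _ _ _ d0 d1 ih0 ih1 => rw [Tm.ssubst, Tm.SFree.ssubst (d1.sfree rfl)]; exact Ty.banglet (ih0 hu h) ⟨d1⟩
  | copow _ _ _ _ _ _ d0 d1 ih0 ih1 => rw [Tm.ssubst, Tm.SFree.ssubst (d0.sfree rfl)]; exact Ty.copow ⟨d0⟩ (ih1 hu h)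
  | copowlet _ _ _ _ _ _ _ d0 d1 ih0 ih1 => exact Ty.copowlet (ih0 hu h) ⟨d1⟩
  | cimage _ _ _ _ d0 ih0 => exact Ty.cimage (ih0 hu h)
  | cinl _ _ _ _ _ d0 ih0 => exact Ty.cinl (ih0 hu h)
  | cinr _ _ _ _ _ d0 ih0 => exact Ty.cinr (ih0 hu h)
  | ccase _ _ _ _ _ _ _ _ d0 d1 d2 ih0 ih1 ih2 => exact Ty.ccase (ih0 hu h) ⟨d1⟩ ⟨d2⟩
  | llam _ _ _ _ _ _ => cases h
  | lapp _ _ _ _ _ _ d0 d1 ih0 ih1 => rw [Tm.ssubst, Tm.SFree.ssubst (d0.sfree rfl)]; exact Ty.lapp ⟨d0⟩ (ih1 hu h)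


theorem EEq.typed {Γ Δ t u A} (h : EEq Γ Δ t u A) : Ty Γ Δ t A ∧ Ty Γ Δ u A := by
  induction h with
  | refl d => exact ⟨⟨d⟩, ⟨d⟩⟩
  | symm _ ih => exact ⟨ih.2, ih.1⟩
  | trans _ _ ih ih' => exact ⟨ih.1, ih'.2⟩
  | vpair_cong _ _ ih0 ih1 => exact ⟨Ty.vpair ih0.1 ih1.1, Ty.vpair ih0.2 ih1.2⟩
  | vfst_cong _ ih0 => exact ⟨Ty.vfst ih0.1, Ty.vfst ih0.2⟩
  | vsnd_cong _ ih0 => exact ⟨Ty.vsnd ih0.1, Ty.vsnd ih0.2⟩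
  | vlam_cong _ ih0 => exact ⟨Ty.vlam ih0.1, Ty.vlam ih0.2⟩
  | vapp_cong _ _ ih0 ih1 => exact ⟨Ty.vapp ih0.1 ih1.1, Ty.vapp ih0.2 ih1.2⟩
  | cpair_cong _ _ ih0 ih1 => exact ⟨Ty.cpair ih0.1 ih1.1, Ty.cpair ih0.2 ih1.2⟩
  | cfst_cong _ ih0 => exact ⟨Ty.cfst ih0.1, Ty.cfst ih0.2⟩
  | csnd_cong _ ih0 => exact ⟨Ty.csnd ih0.1, Ty.csnd ih0.2⟩
  | clam_cong _ ih0 => exact ⟨Ty.clam ih0.1, Ty.clam ih0.2⟩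
  | capp_cong _ _ ih0 ih1 => exact ⟨Ty.capp ih0.1 ih1.1, Ty.capp ih0.2 ih1.2⟩
  | ilet_cong _ _ ih0 ih1 => exact ⟨Ty.ilet ih0.1 ih1.1, Ty.ilet ih0.2 ih1.2⟩
  | bang_cong _ ih0 => exact ⟨Ty.bang ih0.1, Ty.bang ih0.2⟩
  | banglet_cong _ _ ih0 ih1 => exact ⟨Ty.banglet ih0.1 ih1.1, Ty.banglet ih0.2 ih1.2⟩
  | copow_cong _ _ ih0 ih1 => exact ⟨Ty.copow ih0.1 ih1.1, Ty.copow ih0.2 ih1.2⟩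
  | copowlet_cong _ _ ih0 ih1 => exact ⟨Ty.copowlet ih0.1 ih1.1, Ty.copowlet ih0.2 ih1.2⟩
  | cimage_cong _ ih0 => exact ⟨Ty.cimage ih0.1, Ty.cimage ih0.2⟩
  | cinl_cong _ ih0 => exact ⟨Ty.cinl ih0.1, Ty.cinl ih0.2⟩
  | cinr_cong _ ih0 => exact ⟨Ty.cinr ih0.1, Ty.cinr ih0.2⟩
  | ccase_cong _ _ _ ih0 ih1 ih2 => exact ⟨Ty.ccase ih0.1 ih1.1 ih2.1, Ty.ccase ih0.2 ih1.2 ih2.2⟩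
  | llam_cong _ ih0 => exact ⟨Ty.llam ih0.1, Ty.llam ih0.2⟩
  | lapp_cong _ _ ih0 ih1 => exact ⟨Ty.lapp ih0.1 ih1.1, Ty.lapp ih0.2 ih1.2⟩
  | unit_eta d => exact ⟨⟨d⟩, Ty.unit⟩
  | vfst_beta d e => exact ⟨Ty.vfst (Ty.vpair ⟨d⟩ ⟨e⟩), ⟨d⟩⟩
  | vsnd_beta d e => exact ⟨Ty.vsnd (Ty.vpair ⟨d⟩ ⟨e⟩), ⟨e⟩⟩
  | vpair_eta d => exact ⟨Ty.vpair (Ty.vfst ⟨d⟩) (Ty.vsnd ⟨d⟩), ⟨d⟩⟩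
  | vlam_beta d e => exact ⟨Ty.vapp (Ty.vlam ⟨d⟩) ⟨e⟩, Ty.subst0 ⟨d⟩ ⟨e⟩⟩
  | vlam_eta d => exact ⟨Ty.vlam (Ty.vapp (Ty.shift ⟨d⟩ _) ⟨.var _ _ _ rfl⟩), ⟨d⟩⟩
  | cunit_eta d => exact ⟨⟨d⟩, Ty.cunit⟩
  | cfst_beta d e => exact ⟨Ty.cfst (Ty.cpair ⟨d⟩ ⟨e⟩), ⟨d⟩⟩
  | csnd_beta d e => exact ⟨Ty.csnd (Ty.cpair ⟨d⟩ ⟨e⟩), ⟨e⟩⟩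
  | cpair_eta d => exact ⟨Ty.cpair (Ty.cfst ⟨d⟩) (Ty.csnd ⟨d⟩), ⟨d⟩⟩
  | clam_beta d e => exact ⟨Ty.capp (Ty.clam ⟨d⟩) ⟨e⟩, Ty.subst0 ⟨d⟩ ⟨e⟩⟩
  | clam_eta d => exact ⟨Ty.clam (Ty.capp (Ty.shift ⟨d⟩ _) ⟨.var _ _ _ rfl⟩), ⟨d⟩⟩
  | ilet_beta d => exact ⟨Ty.ilet Ty.top ⟨d⟩, ⟨d⟩⟩
  | ilet_eta d e => exact ⟨Ty.ilet ⟨d⟩ (Ty.ssubst ⟨e⟩ Ty.top), Ty.ssubst ⟨e⟩ ⟨d⟩⟩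
  | bang_beta d e => exact ⟨Ty.banglet (Ty.bang ⟨d⟩) ⟨e⟩, Ty.subst0 ⟨e⟩ ⟨d⟩⟩
  | bang_eta d e =>
    exact ⟨Ty.banglet ⟨d⟩ (Ty.ssubst (Ty.shift ⟨e⟩ _) (Ty.bang ⟨.var _ _ _ rfl⟩)),
      Ty.ssubst ⟨e⟩ ⟨d⟩⟩
  | copow_beta d e f =>
    exact ⟨Ty.copowlet (Ty.copow ⟨d⟩ ⟨e⟩) ⟨f⟩, Ty.ssubst (Ty.subst0 ⟨f⟩ ⟨d⟩) ⟨e⟩⟩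
  | copow_eta d e =>
    exact ⟨Ty.copowlet ⟨d⟩ (Ty.ssubst (Ty.shift ⟨e⟩ _) (Ty.copow ⟨.var _ _ _ rfl⟩ Ty.svar)),
      Ty.ssubst ⟨e⟩ ⟨d⟩⟩
  | czero_eta d e => exact ⟨Ty.cimage ⟨d⟩, Ty.ssubst ⟨e⟩ ⟨d⟩⟩
  | csum_beta_inl d e f => exact ⟨Ty.ccase (Ty.cinl ⟨f⟩) ⟨d⟩ ⟨e⟩, Ty.ssubst ⟨d⟩ ⟨f⟩⟩
  | csum_beta_inr d e f => exact ⟨Ty.ccase (Ty.cinr ⟨f⟩) ⟨d⟩ ⟨e⟩, Ty.ssubst ⟨e⟩ ⟨f⟩⟩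
  | csum_eta d e =>
    exact ⟨Ty.ccase ⟨d⟩ (Ty.ssubst ⟨e⟩ (Ty.cinl Ty.svar)) (Ty.ssubst ⟨e⟩ (Ty.cinr Ty.svar)),
      Ty.ssubst ⟨e⟩ ⟨d⟩⟩
  | llam_beta d e => exact ⟨Ty.lapp (Ty.llam ⟨d⟩) ⟨e⟩, Ty.ssubst ⟨d⟩ ⟨e⟩⟩
  | llam_eta d => exact ⟨Ty.llam (Ty.lapp ⟨d⟩ Ty.svar), ⟨d⟩⟩

theorem Tm.psubst_subst0 (σ : ℕ → Tm) (u t : Tm) :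
    psubst σ (subst0 u t) = subst0 (psubst σ u) (psubst (liftS σ) t) := by
  rw [subst0_eq, subst0_eq, psubst_psubst, psubst_psubst]
  congr 1; funext n
  cases n with
  | zero => rfl
  | succ n => exact (single_shift _ _).symm

noncomputable def Deriv.psub {Γ Γ' Δ t A σ} (d : Deriv Γ Δ t A) (h : TSub Γ Γ' σ) :
    Deriv Γ' Δ (t.psubst σ) A :=
  (Ty.psubst ⟨d⟩ h).some

noncomputable def Deriv.ssub {Γ Δ t u B C} (d : Deriv Γ (some B) t C)
    (e : Ty Γ Δ u (.comp B)) : Deriv Γ Δ (Tm.ssubst u t) C :=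
  (Ty.ssubst ⟨d⟩ e).some

theorem EEq.cast {Γ Δ t u t' u' A} (h : EEq Γ Δ t u A) (ht : t' = t) (hu : u' = u) :
    EEq Γ Δ t' u' A := by
  subst ht hu; exact h

theorem EEq.psubst {Γ Δ t u A} (h : EEq Γ Δ t u A) : ∀ {Γ' : List VType} {σ : ℕ → Tm},
    TSub Γ Γ' σ → EEq Γ' Δ (t.psubst σ) (u.psubst σ) A := by
  induction h <;> intro Γ' σ hσ
  case refl d => exact .refl (d.psub hσ)
  case symm ih => exact (ih hσ).symm
  case trans ih ih' => exact (ih hσ).trans (ih' hσ)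
  case vpair_cong ih0 ih1 => exact .vpair_cong (ih0 hσ) (ih1 hσ)
  case vfst_cong ih0 => exact .vfst_cong (ih0 hσ)
  case vsnd_cong ih0 => exact .vsnd_cong (ih0 hσ)
  case vlam_cong ih0 => exact .vlam_cong (ih0 (hσ.lift _))
  case vapp_cong ih0 ih1 => exact .vapp_cong (ih0 hσ) (ih1 hσ)
  case cpair_cong ih0 ih1 => exact .cpair_cong (ih0 hσ) (ih1 hσ)
  case cfst_cong ih0 => exact .cfst_cong (ih0 hσ)
  case csnd_cong ih0 => exact .csnd_cong (ih0 hσ)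
  case clam_cong ih0 => exact .clam_cong (ih0 (hσ.lift _))
  case capp_cong ih0 ih1 => exact .capp_cong (ih0 hσ) (ih1 hσ)
  case ilet_cong ih0 ih1 => exact .ilet_cong (ih0 hσ) (ih1 hσ)
  case bang_cong ih0 => exact .bang_cong (ih0 hσ)
  case banglet_cong ih0 ih1 => exact .banglet_cong (ih0 hσ) (ih1 (hσ.lift _))
  case copow_cong ih0 ih1 => exact .copow_cong (ih0 hσ) (ih1 hσ)
  case copowlet_cong ih0 ih1 => exact .copowlet_cong (ih0 hσ) (ih1 (hσ.lift _))
  case cimage_cong ih0 => exact .cimage_cong (ih0 hσ)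
  case cinl_cong ih0 => exact .cinl_cong (ih0 hσ)
  case cinr_cong ih0 => exact .cinr_cong (ih0 hσ)
  case ccase_cong ih0 ih1 ih2 => exact .ccase_cong (ih0 hσ) (ih1 hσ) (ih2 hσ)
  case llam_cong ih0 => exact .llam_cong (ih0 hσ)
  case lapp_cong ih0 ih1 => exact .lapp_cong (ih0 hσ) (ih1 hσ)
  case unit_eta d => exact .unit_eta (d.psub hσ)
  case vfst_beta d e => exact .vfst_beta (d.psub hσ) (e.psub hσ)
  case vsnd_beta d e => exact .vsnd_beta (d.psub hσ) (e.psub hσ)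
  case vpair_eta d => exact .vpair_eta (d.psub hσ)
  case vlam_beta d e =>
    exact (EEq.vlam_beta (d.psub (hσ.lift _)) (e.psub hσ)).cast rfl (Tm.psubst_subst0 _ _ _)
  case vlam_eta d =>
    exact (EEq.vlam_eta (d.psub hσ)).cast (by simp [Tm.psubst, Tm.psubst_shift, Tm.liftS]) rfl
  case cunit_eta d => exact .cunit_eta (d.psub hσ)
  case cfst_beta d e => exact .cfst_beta (d.psub hσ) (e.psub hσ)
  case csnd_beta d e => exact .csnd_beta (d.psub hσ) (e.psub hσ)
  case cpair_eta d => exact .cpair_eta (d.psub hσ)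
  case clam_beta d e =>
    exact (EEq.clam_beta (d.psub (hσ.lift _)) (e.psub hσ)).cast rfl (Tm.psubst_subst0 _ _ _)
  case clam_eta d =>
    exact (EEq.clam_eta (d.psub hσ)).cast (by simp [Tm.psubst, Tm.psubst_shift, Tm.liftS]) rfl
  case ilet_beta d => exact .ilet_beta (d.psub hσ)
  case ilet_eta d e =>
    exact (EEq.ilet_eta (d.psub hσ) (e.psub hσ)).cast
      (by simp [Tm.psubst, Tm.psubst_ssubst _ _ _ hσ.sfree]) (Tm.psubst_ssubst _ _ _ hσ.sfree)
  case bang_beta d e =>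
    exact (EEq.bang_beta (d.psub hσ) (e.psub (hσ.lift _))).cast rfl (Tm.psubst_subst0 _ _ _)
  case bang_eta d e =>
    exact (EEq.bang_eta (d.psub hσ) (e.psub hσ)).cast
      (by simp [Tm.psubst, Tm.psubst_ssubst _ _ _ (hσ.lift VType.unit).sfree, Tm.psubst_shift,
        Tm.liftS]) (Tm.psubst_ssubst _ _ _ hσ.sfree)
  case copow_beta d e f =>
    exact (EEq.copow_beta (d.psub hσ) (e.psub hσ) (f.psub (hσ.lift _))).cast rfl
      (by rw [Tm.psubst_ssubst _ _ _ hσ.sfree, Tm.psubst_subst0])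
  case copow_eta d e =>
    exact (EEq.copow_eta (d.psub hσ) (e.psub hσ)).cast
      (by simp [Tm.psubst, Tm.psubst_ssubst _ _ _ (hσ.lift VType.unit).sfree, Tm.psubst_shift,
        Tm.liftS]) (Tm.psubst_ssubst _ _ _ hσ.sfree)
  case czero_eta d e =>
    exact (EEq.czero_eta (d.psub hσ) (e.psub hσ)).cast rfl (Tm.psubst_ssubst _ _ _ hσ.sfree)
  case csum_beta_inl d e f =>
    exact (EEq.csum_beta_inl (d.psub hσ) (e.psub hσ) (f.psub hσ)).cast rfl
      (Tm.psubst_ssubst _ _ _ hσ.sfree)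
  case csum_beta_inr d e f =>
    exact (EEq.csum_beta_inr (d.psub hσ) (e.psub hσ) (f.psub hσ)).cast rfl
      (Tm.psubst_ssubst _ _ _ hσ.sfree)
  case csum_eta d e =>
    exact (EEq.csum_eta (d.psub hσ) (e.psub hσ)).cast
      (by simp [Tm.psubst, Tm.psubst_ssubst _ _ _ hσ.sfree]) (Tm.psubst_ssubst _ _ _ hσ.sfree)
  case llam_beta d e =>
    exact (EEq.llam_beta (d.psub hσ) (e.psub hσ)).cast rfl (Tm.psubst_ssubst _ _ _ hσ.sfree)
  case llam_eta d => exact .llam_eta (d.psub hσ)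

theorem Ty.ssubst_eq {Γ t A} (u : Tm) (h : Ty Γ none t A) : Tm.ssubst u t = t :=
  Tm.SFree.ssubst (h.some.sfree rfl)

theorem Tm.subst0_ssubst (v u t : Tm) (hv : SFree v) :
    subst0 v (ssubst u t) = ssubst (subst0 v u) (subst0 v t) := by
  rw [subst0_eq, subst0_eq, subst0_eq, psubst_ssubst _ _ _ (fun n => by
    cases n with
    | zero => exact hv
    | succ n => trivial)]

theorem Tm.ssubst_subst0 (v u t : Tm) (hv : SFree v) :
    ssubst u (subst0 v t) = subst0 v (ssubst (shift u) t) := by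
  rw [subst0_ssubst _ _ _ hv, subst0_eq v (shift u), single_shift]

theorem EEq.ssubst {Γ Δ t t' u B C} (h : EEq Γ (some B) t t' C) (hu : Ty Γ Δ u (.comp B)) :
    EEq Γ Δ (Tm.ssubst u t) (Tm.ssubst u t') C := by
  generalize hΔ : some B = Δ' at h
  induction h generalizing u with
  | refl d =>
    subst hΔ
    exact .refl (d.ssub hu)
  | symm _ ih =>
    subst hΔ
    exact (ih hu rfl).symm
  | trans _ _ ih ih' =>
    subst hΔ
    exact (ih hu rfl).trans (ih' hu rfl)
  | vpair_cong => cases hΔ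
  | vfst_cong => cases hΔ
  | vsnd_cong => cases hΔ
  | vlam_cong => cases hΔ
  | vapp_cong => cases hΔ
  | cpair_cong h0 h1 ih0 ih1 => subst hΔ; exact .cpair_cong (ih0 hu rfl) (ih1 hu rfl)
  | cfst_cong h0 ih0 => subst hΔ; exact .cfst_cong (ih0 hu rfl)
  | csnd_cong h0 ih0 => subst hΔ; exact .csnd_cong (ih0 hu rfl)
  | clam_cong h0 ih0 => subst hΔ; exact .clam_cong (ih0 (hu.shift _) rfl)
  | capp_cong h0 h1 ih0 ih1 => subst hΔ; rw [Tm.ssubst, Tm.ssubst, h1.typed.1.ssubst_eq, h1.typed.2.ssubst_eq]; exact .capp_cong (ih0 hu rfl) h1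
  | ilet_cong h0 h1 ih0 ih1 => subst hΔ; rw [Tm.ssubst, Tm.ssubst, h1.typed.1.ssubst_eq, h1.typed.2.ssubst_eq]; exact .ilet_cong (ih0 hu rfl) h1
  | bang_cong => cases hΔ
  | banglet_cong h0 h1 ih0 ih1 => subst hΔ; rw [Tm.ssubst, Tm.ssubst, h1.typed.1.ssubst_eq, h1.typed.2.ssubst_eq]; exact .banglet_cong (ih0 hu rfl) h1
  | copow_cong h0 h1 ih0 ih1 => subst hΔ; rw [Tm.ssubst, Tm.ssubst, h0.typed.1.ssubst_eq, h0.typed.2.ssubst_eq]; exact .copow_cong h0 (ih1 hu rfl)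
  | copowlet_cong h0 h1 ih0 ih1 => subst hΔ; exact .copowlet_cong (ih0 hu rfl) h1
  | cimage_cong h0 ih0 => subst hΔ; exact .cimage_cong (ih0 hu rfl)
  | cinl_cong h0 ih0 => subst hΔ; exact .cinl_cong (ih0 hu rfl)
  | cinr_cong h0 ih0 => subst hΔ; exact .cinr_cong (ih0 hu rfl)
  | ccase_cong h0 h1 h2 ih0 ih1 ih2 => subst hΔ; exact .ccase_cong (ih0 hu rfl) h1 h2
  | llam_cong => cases hΔ
  | lapp_cong h0 h1 ih0 ih1 => subst hΔ; rw [Tm.ssubst, Tm.ssubst, h0.typed.1.ssubst_eq, h0.typed.2.ssubst_eq]; exact .lapp_cong h0 (ih1 hu rfl)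
  | cunit_eta d =>
    subst hΔ
    exact .cunit_eta (d.ssub hu)
  | cfst_beta d e =>
    subst hΔ
    exact .cfst_beta (d.ssub hu) (e.ssub hu)
  | csnd_beta d e =>
    subst hΔ
    exact .csnd_beta (d.ssub hu) (e.ssub hu)
  | cpair_eta d =>
    subst hΔ
    exact .cpair_eta (d.ssub hu)
  | clam_beta d e =>
    subst hΔ
    exact (EEq.clam_beta (d.ssub (hu.shift _)) e).cast
      (by rw [Tm.ssubst, Tm.ssubst, Ty.ssubst_eq _ ⟨e⟩]) (Tm.ssubst_subst0 _ _ _ (e.sfree rfl))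
  | clam_eta d =>
    subst hΔ
    exact (EEq.clam_eta (d.ssub hu)).cast (by simp [Tm.ssubst, Tm.shift_ssubst]) rfl
  | ilet_eta d e =>
    subst hΔ
    exact (EEq.ilet_eta (d.ssub hu) e).cast
      (by rw [Tm.ssubst, Ty.ssubst_eq _ (Ty.ssubst ⟨e⟩ Ty.top)]) (Tm.ssubst_ssubst _ _ _)
  | bang_eta d e =>
    subst hΔ
    exact (EEq.bang_eta (d.ssub hu) e).cast
      (by rw [Tm.ssubst, Ty.ssubst_eq _ (Ty.ssubst (Ty.shift ⟨e⟩ _) (Ty.bang ⟨.var _ _ _ rfl⟩))])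
      (Tm.ssubst_ssubst _ _ _)
  | copow_beta d e f =>
    subst hΔ
    exact (EEq.copow_beta d (e.ssub hu) f).cast
      (by rw [Tm.ssubst, Tm.ssubst, Ty.ssubst_eq _ ⟨d⟩]) (Tm.ssubst_ssubst _ _ _)
  | copow_eta d e =>
    subst hΔ
    exact (EEq.copow_eta (d.ssub hu) e).cast rfl (Tm.ssubst_ssubst _ _ _)
  | czero_eta d e =>
    subst hΔ
    exact (EEq.czero_eta (d.ssub hu) e).cast rfl (Tm.ssubst_ssubst _ _ _)
  | csum_beta_inl d e f =>
    subst hΔ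
    exact (EEq.csum_beta_inl d e (f.ssub hu)).cast rfl (Tm.ssubst_ssubst _ _ _)
  | csum_beta_inr d e f =>
    subst hΔ
    exact (EEq.csum_beta_inr d e (f.ssub hu)).cast rfl (Tm.ssubst_ssubst _ _ _)
  | csum_eta d e =>
    subst hΔ
    exact (EEq.csum_eta (d.ssub hu) e).cast rfl (Tm.ssubst_ssubst _ _ _)
  | llam_beta d e =>
    subst hΔ
    exact (EEq.llam_beta d (e.ssub hu)).cast rfl (Tm.ssubst_ssubst _ _ _)
  | unit_eta => cases hΔ
  | vfst_beta => cases hΔ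
  | vsnd_beta => cases hΔ
  | vpair_eta => cases hΔ
  | vlam_beta => cases hΔ
  | vlam_eta => cases hΔ
  | ilet_beta => cases hΔ
  | bang_beta => cases hΔ
  | llam_eta => cases hΔ

theorem EEq.psubst_right {Γ Δ t A} : ∀ {Γ' : List VType} {σ τ : ℕ → Tm}, Ty Γ Δ t A →
    TSub Γ Γ' σ → TSub Γ Γ' τ → (∀ n B, Γ[n]? = some B → EEq Γ' none (σ n) (τ n) B) →
    EEq Γ' Δ (t.psubst σ) (t.psubst τ) A := by
  have lift : ∀ {Γ Γ' : List VType} {σ τ : ℕ → Tm} (A : VType),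
      (∀ n B, Γ[n]? = some B → EEq Γ' none (σ n) (τ n) B) →
      ∀ n B, (A :: Γ)[n]? = some B → EEq (A :: Γ') none (Tm.liftS σ n) (Tm.liftS τ n) B := by
    intro Γ Γ' σ τ A h n B hn
    cases n with
    | zero => exact .refl (.var _ _ _ hn)
    | succ n =>
      have := (h n B hn).psubst (TSub.wk Γ' A)
      rwa [← Tm.rename_eq_psubst, ← Tm.rename_eq_psubst] at this
  rintro Γ' σ τ ⟨d⟩ hσ hτ h
  induction d generalizing Γ' σ τ with
  | var _ n A hn => exact h _ _ hn
  | svar => exact .refl Ty.svar.some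
  | unit => exact .refl Ty.unit.some
  | vpair _ _ _ _ _ _ _ ih0 ih1 => exact .vpair_cong (ih0 hσ hτ h) (ih1 hσ hτ h)
  | vfst _ _ _ _ _ ih0 => exact .vfst_cong (ih0 hσ hτ h)
  | vsnd _ _ _ _ _ ih0 => exact .vsnd_cong (ih0 hσ hτ h)
  | vlam _ _ _ _ _ ih0 => exact .vlam_cong (ih0 (hσ.lift _) (hτ.lift _) (lift _ h))
  | vapp _ _ _ _ _ _ _ ih0 ih1 => exact .vapp_cong (ih0 hσ hτ h) (ih1 hσ hτ h)
  | cunit => exact .refl Ty.cunit.some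
  | cpair _ _ _ _ _ _ _ _ ih0 ih1 => exact .cpair_cong (ih0 hσ hτ h) (ih1 hσ hτ h)
  | cfst _ _ _ _ _ _ ih0 => exact .cfst_cong (ih0 hσ hτ h)
  | csnd _ _ _ _ _ _ ih0 => exact .csnd_cong (ih0 hσ hτ h)
  | clam _ _ _ _ _ _ ih0 => exact .clam_cong (ih0 (hσ.lift _) (hτ.lift _) (lift _ h))
  | capp _ _ _ _ _ _ _ _ ih0 ih1 => exact .capp_cong (ih0 hσ hτ h) (ih1 hσ hτ h)
  | top => exact .refl Ty.top.some
  | ilet _ _ _ _ _ _ _ ih0 ih1 => exact .ilet_cong (ih0 hσ hτ h) (ih1 hσ hτ h)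
  | bang _ _ _ _ ih0 => exact .bang_cong (ih0 hσ hτ h)
  | banglet _ _ _ _ _ _ _ _ ih0 ih1 => exact .banglet_cong (ih0 hσ hτ h) (ih1 (hσ.lift _) (hτ.lift _) (lift _ h))
  | copow _ _ _ _ _ _ _ _ ih0 ih1 => exact .copow_cong (ih0 hσ hτ h) (ih1 hσ hτ h)
  | copowlet _ _ _ _ _ _ _ _ _ ih0 ih1 => exact .copowlet_cong (ih0 hσ hτ h) (ih1 (hσ.lift _) (hτ.lift _) (lift _ h))
  | cimage _ _ _ _ _ ih0 => exact .cimage_cong (ih0 hσ hτ h)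
  | cinl _ _ _ _ _ _ ih0 => exact .cinl_cong (ih0 hσ hτ h)
  | cinr _ _ _ _ _ _ ih0 => exact .cinr_cong (ih0 hσ hτ h)
  | ccase _ _ _ _ _ _ _ _ _ _ _ ih0 ih1 ih2 => exact .ccase_cong (ih0 hσ hτ h) (ih1 hσ hτ h) (ih2 hσ hτ h)
  | llam _ _ _ _ _ ih0 => exact .llam_cong (ih0 hσ hτ h)
  | lapp _ _ _ _ _ _ _ _ ih0 ih1 => exact .lapp_cong (ih0 hσ hτ h) (ih1 hσ hτ h)

theorem EEq.ssubst_right {Γ Δ t u u' B C} (h : EEq Γ Δ u u' (.comp B))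
    (d : Ty Γ (some B) t (.comp C)) : EEq Γ Δ (Tm.ssubst u t) (Tm.ssubst u' t) (.comp C) := by
  obtain ⟨d⟩ := d
  exact ((EEq.llam_beta d h.typed.1.some).symm.trans (.lapp_cong (.refl (.llam _ _ _ _ d)) h)).trans
    (.llam_beta d h.typed.2.some)

end EEC

namespace EEC

/-! ## Terms modulo provable equality -/

/-- Typable terms. -/
abbrev Tms (Γ : List VType) (Δ : Option CType) (A : VType) : Type := {t : Tm // Ty Γ Δ t A}

instance Tms.setoid (Γ : List VType) (Δ : Option CType) (A : VType) : Setoid (Tms Γ Δ A) where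
  r t u := EEq Γ Δ t.1 u.1 A
  iseqv := ⟨fun t => .refl t.2.some, .symm, .trans⟩

/-- Typable terms modulo provable equality. -/
def Q (Γ : List VType) (Δ : Option CType) (A : VType) : Type := Quotient (Tms.setoid Γ Δ A)

namespace Q

def mk {Γ : List VType} {Δ : Option CType} {A : VType} (t : Tm) (h : Ty Γ Δ t A) : Q Γ Δ A :=
  Quotient.mk (Tms.setoid Γ Δ A) ⟨t, h⟩

theorem exists_rep {Γ Δ A} (q : Q Γ Δ A) : ∃ t h, mk t h = q := by
  obtain ⟨⟨t, h⟩, e⟩ := Quotient.exists_rep q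
  exact ⟨t, h, e⟩

theorem mk_eq {Γ Δ A t u} {h : Ty Γ Δ t A} {h' : Ty Γ Δ u A} :
    mk t h = mk u h' ↔ EEq Γ Δ t u A :=
  ⟨fun e => Quotient.exact e, fun e => Quotient.sound e⟩

theorem mk_congr {Γ Δ A t u} {h : Ty Γ Δ t A} {h' : Ty Γ Δ u A} (e : t = u) :
    mk t h = mk u h' := by
  subst e; rfl

def var {Γ : List VType} (n : ℕ) {A : VType} (h : Γ[n]? = some A) : Q Γ none A :=
  mk (.var n) ⟨.var _ _ _ h⟩

def svar {Γ : List VType} {A : CType} : Q Γ (some A) (.comp A) := mk .svar Ty.svar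

def unit {Γ : List VType} :
    Q Γ none .unit :=
  mk .unit Ty.unit

def vpair {Γ : List VType} {A B : VType} (t : Q Γ none A) (u : Q Γ none B) :
    Q Γ none (.prod A B) :=
  Quotient.map₂ (fun t u => ⟨.vpair t.1 u.1, Ty.vpair t.2 u.2⟩)
    (fun _ _ h _ _ h' => .vpair_cong h h') t u

def vfst {Γ : List VType} {A B : VType} (t : Q Γ none (.prod A B)) :
    Q Γ none A :=
  Quotient.map (fun t => ⟨.vfst t.1, Ty.vfst t.2⟩) (fun _ _ h => .vfst_cong h) t

def vsnd {Γ : List VType} {A B : VType} (t : Q Γ none (.prod A B)) :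
    Q Γ none B :=
  Quotient.map (fun t => ⟨.vsnd t.1, Ty.vsnd t.2⟩) (fun _ _ h => .vsnd_cong h) t

def vlam {Γ : List VType} {A B : VType} (t : Q (A :: Γ) none B) :
    Q Γ none (.arr A B) :=
  Quotient.map (fun t => ⟨.vlam A t.1, Ty.vlam t.2⟩) (fun _ _ h => .vlam_cong h) t

def vapp {Γ : List VType} {A B : VType} (s : Q Γ none (.arr A B)) (t : Q Γ none A) :
    Q Γ none B :=
  Quotient.map₂ (fun t u => ⟨.vapp t.1 u.1, Ty.vapp t.2 u.2⟩)
    (fun _ _ h _ _ h' => .vapp_cong h h') s t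

def cunit {Γ : List VType} {Δ : Option CType} :
    Q Γ Δ (.comp .cunit) :=
  mk .cunit Ty.cunit

def cpair {Γ : List VType} {Δ : Option CType} {A B : CType} (t : Q Γ Δ (.comp A)) (u : Q Γ Δ (.comp B)) :
    Q Γ Δ (.comp (.cand A B)) :=
  Quotient.map₂ (fun t u => ⟨.cpair t.1 u.1, Ty.cpair t.2 u.2⟩)
    (fun _ _ h _ _ h' => .cpair_cong h h') t u

def cfst {Γ : List VType} {Δ : Option CType} {A B : CType} (t : Q Γ Δ (.comp (.cand A B))) :
    Q Γ Δ (.comp A) :=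
  Quotient.map (fun t => ⟨.cfst t.1, Ty.cfst t.2⟩) (fun _ _ h => .cfst_cong h) t

def csnd {Γ : List VType} {Δ : Option CType} {A B : CType} (t : Q Γ Δ (.comp (.cand A B))) :
    Q Γ Δ (.comp B) :=
  Quotient.map (fun t => ⟨.csnd t.1, Ty.csnd t.2⟩) (fun _ _ h => .csnd_cong h) t

def clam {Γ : List VType} {Δ : Option CType} {A : VType} {B : CType} (t : Q (A :: Γ) Δ (.comp B)) :
    Q Γ Δ (.comp (.carr A B)) :=
  Quotient.map (fun t => ⟨.clam A t.1, Ty.clam t.2⟩) (fun _ _ h => .clam_cong h) t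

def capp {Γ : List VType} {Δ : Option CType} {A : VType} {B : CType} (s : Q Γ Δ (.comp (.carr A B))) (t : Q Γ none A) :
    Q Γ Δ (.comp B) :=
  Quotient.map₂ (fun t u => ⟨.capp t.1 u.1, Ty.capp t.2 u.2⟩)
    (fun _ _ h _ _ h' => .capp_cong h h') s t

def top {Γ : List VType} :
    Q Γ none (.comp .iunit) :=
  mk .top Ty.top

def ilet {Γ : List VType} {Δ : Option CType} {A : CType} (t : Q Γ Δ (.comp .iunit)) (u : Q Γ none (.comp A)) :
    Q Γ Δ (.comp A) :=
  Quotient.map₂ (fun t u => ⟨.ilet t.1 u.1, Ty.ilet t.2 u.2⟩)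
    (fun _ _ h _ _ h' => .ilet_cong h h') t u

def bang {Γ : List VType} {A : VType} (t : Q Γ none A) :
    Q Γ none (.comp (.bang A)) :=
  Quotient.map (fun t => ⟨.bang t.1, Ty.bang t.2⟩) (fun _ _ h => .bang_cong h) t

def banglet {Γ : List VType} {Δ : Option CType} {A : VType} {B : CType} (t : Q Γ Δ (.comp (.bang A))) (u : Q (A :: Γ) none (.comp B)) :
    Q Γ Δ (.comp B) :=
  Quotient.map₂ (fun t u => ⟨.banglet t.1 u.1, Ty.banglet t.2 u.2⟩)
    (fun _ _ h _ _ h' => .banglet_cong h h') t u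

def copow {Γ : List VType} {Δ : Option CType} {A : VType} {B : CType} (t : Q Γ none A) (u : Q Γ Δ (.comp B)) :
    Q Γ Δ (.comp (.copow A B)) :=
  Quotient.map₂ (fun t u => ⟨.copow t.1 u.1, Ty.copow t.2 u.2⟩)
    (fun _ _ h _ _ h' => .copow_cong h h') t u

def copowlet {Γ : List VType} {Δ : Option CType} {A : VType} {B C : CType} (s : Q Γ Δ (.comp (.copow A B))) (t : Q (A :: Γ) (some B) (.comp C)) :
    Q Γ Δ (.comp C) :=
  Quotient.map₂ (fun t u => ⟨.copowlet t.1 u.1, Ty.copowlet t.2 u.2⟩)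
    (fun _ _ h _ _ h' => .copowlet_cong h h') s t

def cimage {Γ : List VType} {Δ : Option CType} (A : CType) (t : Q Γ Δ (.comp .czero)) :
    Q Γ Δ (.comp A) :=
  Quotient.map (fun t => ⟨.cimage A t.1, Ty.cimage t.2⟩) (fun _ _ h => .cimage_cong h) t

def cinl {Γ : List VType} {Δ : Option CType} {A B : CType} (t : Q Γ Δ (.comp A)) :
    Q Γ Δ (.comp (.csum A B)) :=
  Quotient.map (fun t => ⟨.cinl t.1, Ty.cinl t.2⟩) (fun _ _ h => .cinl_cong h) t

def cinr {Γ : List VType} {Δ : Option CType} {A B : CType} (t : Q Γ Δ (.comp B)) :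
    Q Γ Δ (.comp (.csum A B)) :=
  Quotient.map (fun t => ⟨.cinr t.1, Ty.cinr t.2⟩) (fun _ _ h => .cinr_cong h) t

def ccase {Γ : List VType} {Δ : Option CType} {A B C : CType} (s : Q Γ Δ (.comp (.csum A B))) (t : Q Γ (some A) (.comp C)) (u : Q Γ (some B) (.comp C)) :
    Q Γ Δ (.comp C) :=
  Quotient.lift₂ (fun s t : Tms _ _ _ => (Quotient.map
      (fun u => (⟨.ccase s.1 t.1 u.1, Ty.ccase s.2 t.2 u.2⟩ : Tms Γ Δ (.comp C)))
      (fun _ _ h => EEq.ccase_cong (.refl s.2.some) (.refl t.2.some) h) u : Q Γ Δ (.comp C)))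
    (fun _ _ _ _ h h' => by
      obtain ⟨⟨u, hu⟩, rfl⟩ := Quotient.exists_rep u
      exact Quotient.sound (EEq.ccase_cong h h' (.refl hu.some))) s t

def llam {Γ : List VType} {A B : CType} (t : Q Γ (some A) (.comp B)) :
    Q Γ none (.lin A B) :=
  Quotient.map (fun t => ⟨.llam A t.1, Ty.llam t.2⟩) (fun _ _ h => .llam_cong h) t

def lapp {Γ : List VType} {Δ : Option CType} {A B : CType} (s : Q Γ none (.lin A B)) (t : Q Γ Δ (.comp A)) :
    Q Γ Δ (.comp B) :=
  Quotient.map₂ (fun t u => ⟨.lapp t.1 u.1, Ty.lapp t.2 u.2⟩)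
    (fun _ _ h _ _ h' => .lapp_cong h h') s t

end Q

/-- Parallel substitutions modulo provable equality. -/
def Sub (Γ Γ' : List VType) : Type := ∀ (n : ℕ) (A : VType), Γ[n]? = some A → Q Γ' none A

namespace Sub

open Classical in
/-- A representing raw substitution. -/
noncomputable def rep {Γ Γ' : List VType} (σ : Sub Γ Γ') (n : ℕ) : Tm :=
  if h : ∃ A, Γ[n]? = some A then (Quotient.out (σ n _ h.choose_spec)).1 else .var n

theorem rep_eq {Γ Γ' : List VType} (σ : Sub Γ Γ') (n : ℕ) (A : VType) (h : Γ[n]? = some A) :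
    σ.rep n = (Quotient.out (σ n _ h)).1 := by
  have h' : ∃ A, Γ[n]? = some A := ⟨A, h⟩
  have e : h'.choose = A := Option.some.inj (h'.choose_spec.symm.trans h)
  rw [rep, dif_pos h']
  have key : ∀ B (hB : Γ[n]? = some B), B = A →
      (Quotient.out (σ n B hB)).1 = (Quotient.out (σ n A h)).1 := by
    rintro B hB rfl; rfl
  exact key _ _ e

theorem rep_tsub {Γ Γ' : List VType} (σ : Sub Γ Γ') : TSub Γ Γ' σ.rep where
  ty n A h := by rw [rep_eq σ n A h]; exact (Quotient.out (σ n _ h)).2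
  sfree n := by
    by_cases h : ∃ A, Γ[n]? = some A
    · obtain ⟨A, h⟩ := h
      rw [rep_eq σ n A h]; exact (Quotient.out (σ n _ h)).2.some.sfree rfl
    · rw [rep, dif_neg h]; trivial

theorem mk_rep {Γ Γ' : List VType} (σ : Sub Γ Γ') (n : ℕ) (A : VType) (h : Γ[n]? = some A) :
    Q.mk (σ.rep n) (σ.rep_tsub.ty n A h) = σ n A h := by
  rw [Q.mk_congr (rep_eq σ n A h) (h' := (Quotient.out (σ n _ h)).2)]
  exact Quotient.out_eq (σ n A h)

def id {Γ : List VType} : Sub Γ Γ := fun n _ h => .var n h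

def wk {Γ : List VType} {A : VType} : Sub Γ (A :: Γ) := fun n _ h => .var (n + 1) h

def cons {Γ Γ' : List VType} {A : VType} (u : Q Γ' none A) (σ : Sub Γ Γ') : Sub (A :: Γ) Γ'
  | 0, _, h => Option.some.inj h ▸ u
  | n + 1, B, h => σ n B h

end Sub

namespace Q

noncomputable def ps {Γ Γ' : List VType} {Δ : Option CType} {A : VType} (σ : Sub Γ Γ')
    (t : Q Γ Δ A) : Q Γ' Δ A :=
  Quotient.map (fun t => ⟨t.1.psubst σ.rep, t.2.psubst σ.rep_tsub⟩)
    (fun _ _ h => EEq.psubst h σ.rep_tsub) t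

theorem ps_mk {Γ Γ' Δ A t} {s : ℕ → Tm} (σ : Sub Γ Γ') (hs : TSub Γ Γ' s)
    (e : ∀ n B h, σ n B h = mk (s n) (hs.ty n B h)) (h : Ty Γ Δ t A) :
    ps σ (mk t h) = mk (t.psubst s) (h.psubst hs) :=
  mk_eq.2 <| EEq.psubst_right h σ.rep_tsub hs fun n B hn =>
    mk_eq.1 ((σ.mk_rep n B hn).trans (e n B hn))

theorem ps_wk_mk {Γ Δ A t} (B : VType) (h : Ty Γ Δ t A) :
    ps (.wk (A := B)) (mk t h) = mk t.shift (h.shift B) :=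
  (ps_mk _ (TSub.wk Γ B) (fun _ _ _ => rfl) h).trans (mk_congr (Tm.rename_eq_psubst _ _).symm)

@[simp] theorem ps_var {Γ Γ' : List VType} (σ : Sub Γ Γ') (n : ℕ) {A : VType}
    (h : Γ[n]? = some A) : ps σ (var n h) = σ n A h :=
  σ.mk_rep n A h

@[simp] theorem ps_svar {Γ Γ' : List VType} {A : CType} (σ : Sub Γ Γ') :
    ps σ (svar (A := A)) = svar := rfl

end Q

namespace Sub

noncomputable def comp {Γ Γ' Γ'' : List VType} (σ : Sub Γ Γ') (τ : Sub Γ' Γ'') : Sub Γ Γ'' :=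
  fun n A h => (σ n A h).ps τ

noncomputable abbrev lift (A : VType) {Γ Γ' : List VType} (σ : Sub Γ Γ') :
    Sub (A :: Γ) (A :: Γ') :=
  cons (.var 0 rfl) (σ.comp wk)

end Sub

namespace Q

theorem ps_lift_mk {Γ Γ' Δ A t} (B : VType) (σ : Sub Γ Γ') (h : Ty (B :: Γ) Δ t A) :
    ps (.lift B σ) (mk t h) = mk (t.psubst (Tm.liftS σ.rep)) (h.psubst (σ.rep_tsub.lift B)) := by
  refine ps_mk _ (σ.rep_tsub.lift B) (fun n C hn => ?_) h
  cases n with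
  | zero => cases hn; rfl
  | succ n =>
    change ps .wk (σ n C hn) = _
    rw [← σ.mk_rep, ps_wk_mk]; rfl

/-- Substitution for the stoup variable. -/
def ss {Γ : List VType} {Δ : Option CType} {B C : CType} (t : Q Γ (some B) (.comp C))
    (u : Q Γ Δ (.comp B)) : Q Γ Δ (.comp C) :=
  Quotient.map₂ (fun t u => ⟨Tm.ssubst u.1 t.1, t.2.ssubst u.2⟩)
    (fun _ b h a _ h' => (h.ssubst a.2).trans (h'.ssubst_right b.2)) t u

@[simp] theorem ss_svar_left {Γ Δ B} (u : Q Γ Δ (.comp B)) : ss svar u = u := by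
  obtain ⟨u, hu, rfl⟩ := u.exists_rep
  rfl

@[simp] theorem ss_svar_right {Γ B C} (t : Q Γ (some B) (.comp C)) : ss t svar = t := by
  obtain ⟨t, ht, rfl⟩ := t.exists_rep
  exact mk_congr (Tm.ssubst_svar t)

theorem ss_ss {Γ Δ B C D} (t : Q Γ (some C) (.comp D)) (u : Q Γ (some B) (.comp C))
    (v : Q Γ Δ (.comp B)) : ss (ss t u) v = ss t (ss u v) := by
  obtain ⟨t, ht, rfl⟩ := t.exists_rep
  obtain ⟨u, hu, rfl⟩ := u.exists_rep
  obtain ⟨v, hv, rfl⟩ := v.exists_rep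
  exact mk_congr (Tm.ssubst_ssubst t v u)

@[simp] theorem ps_ss {Γ Γ' Δ B C} (σ : Sub Γ Γ') (t : Q Γ (some B) (.comp C))
    (u : Q Γ Δ (.comp B)) : ps σ (ss t u) = ss (ps σ t) (ps σ u) := by
  obtain ⟨t, ht, rfl⟩ := t.exists_rep
  obtain ⟨u, hu, rfl⟩ := u.exists_rep
  exact mk_congr (Tm.psubst_ssubst t σ.rep u σ.rep_tsub.sfree)

@[simp] theorem ps_unit {Γ Γ' : List VType}  (σ : Sub Γ Γ') :
    ps σ (unit : Q Γ none .unit) = unit := rfl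

@[simp] theorem ps_vpair {Γ Γ' : List VType} {A B : VType} (σ : Sub Γ Γ') (t : Q Γ none A) (u : Q Γ none B) :
    ps σ (vpair t u) = vpair (ps σ t) (ps σ u) := by
  obtain ⟨t, ht, rfl⟩ := t.exists_rep
  obtain ⟨u, hu, rfl⟩ := u.exists_rep
  rfl

@[simp] theorem ps_vfst {Γ Γ' : List VType} {A B : VType} (σ : Sub Γ Γ') (t : Q Γ none (.prod A B)) :
    ps σ (vfst t) = vfst (ps σ t) := by
  obtain ⟨t, ht, rfl⟩ := t.exists_rep
  rfl

@[simp] theorem ps_vsnd {Γ Γ' : List VType} {A B : VType} (σ : Sub Γ Γ') (t : Q Γ none (.prod A B)) :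
    ps σ (vsnd t) = vsnd (ps σ t) := by
  obtain ⟨t, ht, rfl⟩ := t.exists_rep
  rfl

@[simp] theorem ps_vlam {Γ Γ' : List VType} {A B : VType} (σ : Sub Γ Γ') (t : Q (A :: Γ) none B) :
    ps σ (vlam t) = vlam (ps (.lift A σ) t) := by
  obtain ⟨t, ht, rfl⟩ := t.exists_rep
  rw [ps_lift_mk]
  rfl

@[simp] theorem ps_vapp {Γ Γ' : List VType} {A B : VType} (σ : Sub Γ Γ') (s : Q Γ none (.arr A B)) (t : Q Γ none A) :
    ps σ (vapp s t) = vapp (ps σ s) (ps σ t) := by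
  obtain ⟨s, hs, rfl⟩ := s.exists_rep
  obtain ⟨t, ht, rfl⟩ := t.exists_rep
  rfl

@[simp] theorem ps_cunit {Γ Γ' : List VType} {Δ : Option CType} (σ : Sub Γ Γ') :
    ps σ (cunit : Q Γ Δ (.comp .cunit)) = cunit := rfl

@[simp] theorem ps_cpair {Γ Γ' : List VType} {Δ : Option CType} {A B : CType} (σ : Sub Γ Γ') (t : Q Γ Δ (.comp A)) (u : Q Γ Δ (.comp B)) :
    ps σ (cpair t u) = cpair (ps σ t) (ps σ u) := by
  obtain ⟨t, ht, rfl⟩ := t.exists_rep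
  obtain ⟨u, hu, rfl⟩ := u.exists_rep
  rfl

@[simp] theorem ps_cfst {Γ Γ' : List VType} {Δ : Option CType} {A B : CType} (σ : Sub Γ Γ') (t : Q Γ Δ (.comp (.cand A B))) :
    ps σ (cfst t) = cfst (ps σ t) := by
  obtain ⟨t, ht, rfl⟩ := t.exists_rep
  rfl

@[simp] theorem ps_csnd {Γ Γ' : List VType} {Δ : Option CType} {A B : CType} (σ : Sub Γ Γ') (t : Q Γ Δ (.comp (.cand A B))) :
    ps σ (csnd t) = csnd (ps σ t) := by
  obtain ⟨t, ht, rfl⟩ := t.exists_rep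
  rfl

@[simp] theorem ps_clam {Γ Γ' : List VType} {Δ : Option CType} {A : VType} {B : CType} (σ : Sub Γ Γ') (t : Q (A :: Γ) Δ (.comp B)) :
    ps σ (clam t) = clam (ps (.lift A σ) t) := by
  obtain ⟨t, ht, rfl⟩ := t.exists_rep
  rw [ps_lift_mk]
  rfl

@[simp] theorem ps_capp {Γ Γ' : List VType} {Δ : Option CType} {A : VType} {B : CType} (σ : Sub Γ Γ') (s : Q Γ Δ (.comp (.carr A B))) (t : Q Γ none A) :
    ps σ (capp s t) = capp (ps σ s) (ps σ t) := by
  obtain ⟨s, hs, rfl⟩ := s.exists_rep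
  obtain ⟨t, ht, rfl⟩ := t.exists_rep
  rfl

@[simp] theorem ps_top {Γ Γ' : List VType}  (σ : Sub Γ Γ') :
    ps σ (top : Q Γ none (.comp .iunit)) = top := rfl

@[simp] theorem ps_ilet {Γ Γ' : List VType} {Δ : Option CType} {A : CType} (σ : Sub Γ Γ') (t : Q Γ Δ (.comp .iunit)) (u : Q Γ none (.comp A)) :
    ps σ (ilet t u) = ilet (ps σ t) (ps σ u) := by
  obtain ⟨t, ht, rfl⟩ := t.exists_rep
  obtain ⟨u, hu, rfl⟩ := u.exists_rep
  rfl

@[simp] theorem ps_bang {Γ Γ' : List VType} {A : VType} (σ : Sub Γ Γ') (t : Q Γ none A) :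
    ps σ (bang t) = bang (ps σ t) := by
  obtain ⟨t, ht, rfl⟩ := t.exists_rep
  rfl

@[simp] theorem ps_banglet {Γ Γ' : List VType} {Δ : Option CType} {A : VType} {B : CType} (σ : Sub Γ Γ') (t : Q Γ Δ (.comp (.bang A))) (u : Q (A :: Γ) none (.comp B)) :
    ps σ (banglet t u) = banglet (ps σ t) (ps (.lift A σ) u) := by
  obtain ⟨t, ht, rfl⟩ := t.exists_rep
  obtain ⟨u, hu, rfl⟩ := u.exists_rep
  rw [ps_lift_mk]
  rfl

@[simp] theorem ps_copow {Γ Γ' : List VType} {Δ : Option CType} {A : VType} {B : CType} (σ : Sub Γ Γ') (t : Q Γ none A) (u : Q Γ Δ (.comp B)) :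
    ps σ (copow t u) = copow (ps σ t) (ps σ u) := by
  obtain ⟨t, ht, rfl⟩ := t.exists_rep
  obtain ⟨u, hu, rfl⟩ := u.exists_rep
  rfl

@[simp] theorem ps_copowlet {Γ Γ' : List VType} {Δ : Option CType} {A : VType} {B C : CType} (σ : Sub Γ Γ') (s : Q Γ Δ (.comp (.copow A B))) (t : Q (A :: Γ) (some B) (.comp C)) :
    ps σ (copowlet s t) = copowlet (ps σ s) (ps (.lift A σ) t) := by
  obtain ⟨s, hs, rfl⟩ := s.exists_rep
  obtain ⟨t, ht, rfl⟩ := t.exists_rep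
  rw [ps_lift_mk]
  rfl

@[simp] theorem ps_cimage {Γ Γ' : List VType} {Δ : Option CType} {A : CType} (σ : Sub Γ Γ') (t : Q Γ Δ (.comp .czero)) :
    ps σ (cimage A t) = cimage A (ps σ t) := by
  obtain ⟨t, ht, rfl⟩ := t.exists_rep
  rfl

@[simp] theorem ps_cinl {Γ Γ' : List VType} {Δ : Option CType} {A B : CType} (σ : Sub Γ Γ') (t : Q Γ Δ (.comp A)) :
    ps σ (cinl (B := B) t) = cinl (B := B) (ps σ t) := by
  obtain ⟨t, ht, rfl⟩ := t.exists_rep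
  rfl

@[simp] theorem ps_cinr {Γ Γ' : List VType} {Δ : Option CType} {A B : CType} (σ : Sub Γ Γ') (t : Q Γ Δ (.comp B)) :
    ps σ (cinr (A := A) t) = cinr (A := A) (ps σ t) := by
  obtain ⟨t, ht, rfl⟩ := t.exists_rep
  rfl

@[simp] theorem ps_ccase {Γ Γ' : List VType} {Δ : Option CType} {A B C : CType} (σ : Sub Γ Γ') (s : Q Γ Δ (.comp (.csum A B))) (t : Q Γ (some A) (.comp C)) (u : Q Γ (some B) (.comp C)) :
    ps σ (ccase s t u) = ccase (ps σ s) (ps σ t) (ps σ u) := by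
  obtain ⟨s, hs, rfl⟩ := s.exists_rep
  obtain ⟨t, ht, rfl⟩ := t.exists_rep
  obtain ⟨u, hu, rfl⟩ := u.exists_rep
  rfl

@[simp] theorem ps_llam {Γ Γ' : List VType} {A B : CType} (σ : Sub Γ Γ') (t : Q Γ (some A) (.comp B)) :
    ps σ (llam t) = llam (ps σ t) := by
  obtain ⟨t, ht, rfl⟩ := t.exists_rep
  rfl

@[simp] theorem ps_lapp {Γ Γ' : List VType} {Δ : Option CType} {A B : CType} (σ : Sub Γ Γ') (s : Q Γ none (.lin A B)) (t : Q Γ Δ (.comp A)) :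
    ps σ (lapp s t) = lapp (ps σ s) (ps σ t) := by
  obtain ⟨s, hs, rfl⟩ := s.exists_rep
  obtain ⟨t, ht, rfl⟩ := t.exists_rep
  rfl

@[simp] theorem ss_cunit {Γ : List VType} {Δ : Option CType} {X : CType}
    (e : Q Γ Δ (.comp X)) : ss (cunit : Q Γ (some X) (.comp .cunit)) e = cunit := by
  obtain ⟨e, he, rfl⟩ := e.exists_rep
  rfl

@[simp] theorem ss_cpair {Γ : List VType} {Δ : Option CType} {A B : CType} {X : CType} (t : Q Γ (some X) (.comp A)) (u : Q Γ (some X) (.comp B))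
    (e : Q Γ Δ (.comp X)) : ss (cpair t u) e = cpair (ss t e) (ss u e) := by
  obtain ⟨t, ht, rfl⟩ := t.exists_rep
  obtain ⟨u, hu, rfl⟩ := u.exists_rep
  obtain ⟨e, he, rfl⟩ := e.exists_rep
  rfl

@[simp] theorem ss_cfst {Γ : List VType} {Δ : Option CType} {A B : CType} {X : CType} (t : Q Γ (some X) (.comp (.cand A B)))
    (e : Q Γ Δ (.comp X)) : ss (cfst t) e = cfst (ss t e) := by
  obtain ⟨t, ht, rfl⟩ := t.exists_rep
  obtain ⟨e, he, rfl⟩ := e.exists_rep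
  rfl

@[simp] theorem ss_csnd {Γ : List VType} {Δ : Option CType} {A B : CType} {X : CType} (t : Q Γ (some X) (.comp (.cand A B)))
    (e : Q Γ Δ (.comp X)) : ss (csnd t) e = csnd (ss t e) := by
  obtain ⟨t, ht, rfl⟩ := t.exists_rep
  obtain ⟨e, he, rfl⟩ := e.exists_rep
  rfl

@[simp] theorem ss_clam {Γ : List VType} {Δ : Option CType} {A : VType} {B : CType} {X : CType} (t : Q (A :: Γ) (some X) (.comp B))
    (e : Q Γ Δ (.comp X)) : ss (clam t) e = clam (ss t (ps .wk e)) := by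
  obtain ⟨t, ht, rfl⟩ := t.exists_rep
  obtain ⟨e, he, rfl⟩ := e.exists_rep
  rw [ps_wk_mk]
  rfl

@[simp] theorem ss_capp {Γ : List VType} {Δ : Option CType} {A : VType} {B : CType} {X : CType} (s : Q Γ (some X) (.comp (.carr A B))) (t : Q Γ none A)
    (e : Q Γ Δ (.comp X)) : ss (capp s t) e = capp (ss s e) t := by
  obtain ⟨s, hs, rfl⟩ := s.exists_rep
  obtain ⟨t, ht, rfl⟩ := t.exists_rep
  obtain ⟨e, he, rfl⟩ := e.exists_rep
  exact mk_congr (by rw [Tm.ssubst, ht.ssubst_eq])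

@[simp] theorem ss_ilet {Γ : List VType} {Δ : Option CType} {A : CType} {X : CType} (t : Q Γ (some X) (.comp .iunit)) (u : Q Γ none (.comp A))
    (e : Q Γ Δ (.comp X)) : ss (ilet t u) e = ilet (ss t e) u := by
  obtain ⟨t, ht, rfl⟩ := t.exists_rep
  obtain ⟨u, hu, rfl⟩ := u.exists_rep
  obtain ⟨e, he, rfl⟩ := e.exists_rep
  exact mk_congr (by rw [Tm.ssubst, hu.ssubst_eq])

@[simp] theorem ss_banglet {Γ : List VType} {Δ : Option CType} {A : VType} {B : CType} {X : CType} (t : Q Γ (some X) (.comp (.bang A))) (u : Q (A :: Γ) none (.comp B))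
    (e : Q Γ Δ (.comp X)) : ss (banglet t u) e = banglet (ss t e) u := by
  obtain ⟨t, ht, rfl⟩ := t.exists_rep
  obtain ⟨u, hu, rfl⟩ := u.exists_rep
  obtain ⟨e, he, rfl⟩ := e.exists_rep
  exact mk_congr (by rw [Tm.ssubst, hu.ssubst_eq])

@[simp] theorem ss_copow {Γ : List VType} {Δ : Option CType} {A : VType} {B : CType} {X : CType} (t : Q Γ none A) (u : Q Γ (some X) (.comp B))
    (e : Q Γ Δ (.comp X)) : ss (copow t u) e = copow t (ss u e) := by
  obtain ⟨t, ht, rfl⟩ := t.exists_rep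
  obtain ⟨u, hu, rfl⟩ := u.exists_rep
  obtain ⟨e, he, rfl⟩ := e.exists_rep
  exact mk_congr (by rw [Tm.ssubst, ht.ssubst_eq])

@[simp] theorem ss_copowlet {Γ : List VType} {Δ : Option CType} {A : VType} {B C : CType} {X : CType} (s : Q Γ (some X) (.comp (.copow A B))) (t : Q (A :: Γ) (some B) (.comp C))
    (e : Q Γ Δ (.comp X)) : ss (copowlet s t) e = copowlet (ss s e) t := by
  obtain ⟨s, hs, rfl⟩ := s.exists_rep
  obtain ⟨t, ht, rfl⟩ := t.exists_rep
  obtain ⟨e, he, rfl⟩ := e.exists_rep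
  rfl

@[simp] theorem ss_cimage {Γ : List VType} {Δ : Option CType} {A : CType} {X : CType} (t : Q Γ (some X) (.comp .czero))
    (e : Q Γ Δ (.comp X)) : ss (cimage A t) e = cimage A (ss t e) := by
  obtain ⟨t, ht, rfl⟩ := t.exists_rep
  obtain ⟨e, he, rfl⟩ := e.exists_rep
  rfl

@[simp] theorem ss_cinl {Γ : List VType} {Δ : Option CType} {A B : CType} {X : CType} (t : Q Γ (some X) (.comp A))
    (e : Q Γ Δ (.comp X)) : ss (cinl (B := B) t) e = cinl (B := B) (ss t e) := by
  obtain ⟨t, ht, rfl⟩ := t.exists_rep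
  obtain ⟨e, he, rfl⟩ := e.exists_rep
  rfl

@[simp] theorem ss_cinr {Γ : List VType} {Δ : Option CType} {A B : CType} {X : CType} (t : Q Γ (some X) (.comp B))
    (e : Q Γ Δ (.comp X)) : ss (cinr (A := A) t) e = cinr (A := A) (ss t e) := by
  obtain ⟨t, ht, rfl⟩ := t.exists_rep
  obtain ⟨e, he, rfl⟩ := e.exists_rep
  rfl

@[simp] theorem ss_ccase {Γ : List VType} {Δ : Option CType} {A B C : CType} {X : CType} (s : Q Γ (some X) (.comp (.csum A B))) (t : Q Γ (some A) (.comp C)) (u : Q Γ (some B) (.comp C))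
    (e : Q Γ Δ (.comp X)) : ss (ccase s t u) e = ccase (ss s e) t u := by
  obtain ⟨s, hs, rfl⟩ := s.exists_rep
  obtain ⟨t, ht, rfl⟩ := t.exists_rep
  obtain ⟨u, hu, rfl⟩ := u.exists_rep
  obtain ⟨e, he, rfl⟩ := e.exists_rep
  rfl

@[simp] theorem ss_lapp {Γ : List VType} {Δ : Option CType} {A B : CType} {X : CType} (s : Q Γ none (.lin A B)) (t : Q Γ (some X) (.comp A))
    (e : Q Γ Δ (.comp X)) : ss (lapp s t) e = lapp s (ss t e) := by
  obtain ⟨s, hs, rfl⟩ := s.exists_rep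
  obtain ⟨t, ht, rfl⟩ := t.exists_rep
  obtain ⟨e, he, rfl⟩ := e.exists_rep
  exact mk_congr (by rw [Tm.ssubst, hs.ssubst_eq])
end Q
end EEC

namespace EEC

/-! ## Equational laws on the quotient -/

namespace Sub

@[simp] theorem cons_zero {Γ Γ' : List VType} {A : VType} (u : Q Γ' none A) (σ : Sub Γ Γ')
    (h : (A :: Γ)[0]? = some A) : cons u σ 0 A h = u := rfl

@[simp] theorem cons_succ {Γ Γ' : List VType} {A B : VType} (u : Q Γ' none A) (σ : Sub Γ Γ')
    (n : ℕ) (h : (A :: Γ)[n + 1]? = some B) : cons u σ (n + 1) B h = σ n B h := rfl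

@[simp] theorem wk_apply {Γ : List VType} {A B : VType} (n : ℕ) (h : Γ[n]? = some B) :
    wk (A := A) n B h = .var (n + 1) h := rfl

@[simp] theorem id_apply {Γ : List VType} {B : VType} (n : ℕ) (h : Γ[n]? = some B) :
    id n B h = .var n h := rfl

@[simp] theorem comp_apply {Γ Γ' Γ'' : List VType} {B : VType} (σ : Sub Γ Γ') (τ : Sub Γ' Γ'')
    (n : ℕ) (h : Γ[n]? = some B) : σ.comp τ n B h = Q.ps τ (σ n B h) := rfl

@[simp] theorem lift_eq {Γ Γ' : List VType} (A : VType) (σ : Sub Γ Γ') :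
    lift A σ = cons (.var 0 rfl) (σ.comp wk) := rfl

theorem cons_congr {Γ Γ' : List VType} {A : VType} {σ τ : Sub (A :: Γ) Γ'}
    (h₀ : σ 0 A rfl = τ 0 A rfl) (h : wk.comp σ = wk.comp τ) : σ = τ := by
  funext n B hn
  cases n with
  | zero => cases hn; exact h₀
  | succ n => simpa using congrFun (congrFun (congrFun h n) B) hn

end Sub

namespace Q

@[simp] theorem ps_ps {Γ Γ' Γ'' : List VType} {Δ : Option CType} {A : VType} (σ : Sub Γ Γ')
    (τ : Sub Γ' Γ'') (t : Q Γ Δ A) : ps τ (ps σ t) = ps (σ.comp τ) t := by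
  obtain ⟨t, ht, rfl⟩ := t.exists_rep
  refine Eq.trans (mk_congr (Tm.psubst_psubst t τ.rep σ.rep)) (ps_mk (σ.comp τ)
    ⟨fun n A h => (σ.rep_tsub.ty n A h).psubst τ.rep_tsub,
      fun n => (σ.rep_tsub.sfree n).psubst τ.rep_tsub.sfree⟩ (fun n B h => ?_) ht).symm
  rw [Sub.comp_apply, ← σ.mk_rep]; rfl

@[simp] theorem ps_id {Γ : List VType} {Δ : Option CType} {A : VType} (t : Q Γ Δ A) :
    ps .id t = t := by
  obtain ⟨t, ht, rfl⟩ := t.exists_rep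
  exact (ps_mk _ (s := .var) ⟨fun n A h => ⟨.var _ _ _ h⟩, fun _ => trivial⟩
    (fun _ _ _ => rfl) ht).trans (mk_congr (Tm.psubst_var t))

end Q

namespace Sub

@[simp] theorem comp_id {Γ Γ' : List VType} (σ : Sub Γ Γ') : σ.comp id = σ := by
  funext n A h; simp

@[simp] theorem id_comp {Γ Γ' : List VType} (σ : Sub Γ Γ') : id.comp σ = σ := by
  funext n A h; simp

@[simp] theorem comp_comp {Γ Γ' Γ'' Γ''' : List VType} (σ : Sub Γ Γ') (τ : Sub Γ' Γ'')
    (ρ : Sub Γ'' Γ''') : (σ.comp τ).comp ρ = σ.comp (τ.comp ρ) := by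
  funext n A h; simp

@[simp] theorem wk_comp_cons {Γ Γ' : List VType} {A : VType} (u : Q Γ' none A) (σ : Sub Γ Γ') :
    wk.comp (cons u σ) = σ := by
  funext n A h; simp

@[simp] theorem cons_comp {Γ Γ' Γ'' : List VType} {A : VType} (u : Q Γ' none A) (σ : Sub Γ Γ')
    (τ : Sub Γ' Γ'') : (cons u σ).comp τ = cons (u.ps τ) (σ.comp τ) :=
  cons_congr rfl (by funext n A h; simp)

@[simp] theorem cons_var_wk {Γ : List VType} {A : VType} :
    cons (.var 0 rfl) wk = (id : Sub (A :: Γ) (A :: Γ)) :=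
  cons_congr rfl rfl

end Sub

namespace Q

theorem ps_single_mk {Γ Δ A B t u} (ht : Ty (A :: Γ) Δ t B) (hu : Ty Γ none u A) :
    ps (.cons (mk u hu) .id) (mk t ht) = mk (Tm.subst0 u t) (Ty.subst0 ht hu) := by
  refine (ps_mk _ (TSub.single hu) (fun n C hn => ?_) ht).trans (mk_congr (Tm.subst0_eq _ _).symm)
  cases n with
  | zero => cases hn; rfl
  | succ n => rfl

/-! ### β and η -/

theorem unit_uniq {Γ} (t : Q Γ none .unit) : t = unit := by
  obtain ⟨t, ht, rfl⟩ := t.exists_rep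
  exact mk_eq.2 (.unit_eta ht.some)

@[simp] theorem vfst_vpair {Γ A B} (t : Q Γ none A) (u : Q Γ none B) : vfst (vpair t u) = t := by
  obtain ⟨t, ht, rfl⟩ := t.exists_rep
  obtain ⟨u, hu, rfl⟩ := u.exists_rep
  exact mk_eq.2 (.vfst_beta ht.some hu.some)

@[simp] theorem vsnd_vpair {Γ A B} (t : Q Γ none A) (u : Q Γ none B) : vsnd (vpair t u) = u := by
  obtain ⟨t, ht, rfl⟩ := t.exists_rep
  obtain ⟨u, hu, rfl⟩ := u.exists_rep
  exact mk_eq.2 (.vsnd_beta ht.some hu.some)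

@[simp] theorem vpair_eta {Γ A B} (t : Q Γ none (.prod A B)) : vpair (vfst t) (vsnd t) = t := by
  obtain ⟨t, ht, rfl⟩ := t.exists_rep
  exact mk_eq.2 (.vpair_eta ht.some)

@[simp] theorem vapp_vlam {Γ A B} (t : Q (A :: Γ) none B) (u : Q Γ none A) :
    vapp (vlam t) u = ps (.cons u .id) t := by
  obtain ⟨t, ht, rfl⟩ := t.exists_rep
  obtain ⟨u, hu, rfl⟩ := u.exists_rep
  rw [ps_single_mk]
  exact mk_eq.2 (.vlam_beta ht.some hu.some)

@[simp] theorem vlam_eta {Γ A B} (t : Q Γ none (.arr A B)) :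
    vlam (vapp (ps .wk t) (var 0 rfl)) = t := by
  obtain ⟨t, ht, rfl⟩ := t.exists_rep
  rw [ps_wk_mk]
  exact mk_eq.2 (.vlam_eta ht.some)

theorem cunit_uniq {Γ Δ} (t : Q Γ Δ (.comp .cunit)) : t = cunit := by
  obtain ⟨t, ht, rfl⟩ := t.exists_rep
  exact mk_eq.2 (.cunit_eta ht.some)

@[simp] theorem cfst_cpair {Γ Δ A B} (t : Q Γ Δ (.comp A)) (u : Q Γ Δ (.comp B)) :
    cfst (cpair t u) = t := by
  obtain ⟨t, ht, rfl⟩ := t.exists_rep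
  obtain ⟨u, hu, rfl⟩ := u.exists_rep
  exact mk_eq.2 (.cfst_beta ht.some hu.some)

@[simp] theorem csnd_cpair {Γ Δ A B} (t : Q Γ Δ (.comp A)) (u : Q Γ Δ (.comp B)) :
    csnd (cpair t u) = u := by
  obtain ⟨t, ht, rfl⟩ := t.exists_rep
  obtain ⟨u, hu, rfl⟩ := u.exists_rep
  exact mk_eq.2 (.csnd_beta ht.some hu.some)

@[simp] theorem cpair_eta {Γ Δ A B} (t : Q Γ Δ (.comp (.cand A B))) :
    cpair (cfst t) (csnd t) = t := by
  obtain ⟨t, ht, rfl⟩ := t.exists_rep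
  exact mk_eq.2 (.cpair_eta ht.some)

@[simp] theorem capp_clam {Γ Δ A B} (t : Q (A :: Γ) Δ (.comp B)) (u : Q Γ none A) :
    capp (clam t) u = ps (.cons u .id) t := by
  obtain ⟨t, ht, rfl⟩ := t.exists_rep
  obtain ⟨u, hu, rfl⟩ := u.exists_rep
  rw [ps_single_mk]
  exact mk_eq.2 (.clam_beta ht.some hu.some)

@[simp] theorem clam_eta {Γ Δ A B} (t : Q Γ Δ (.comp (.carr A B))) :
    clam (capp (ps .wk t) (var 0 rfl)) = t := by
  obtain ⟨t, ht, rfl⟩ := t.exists_rep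
  rw [ps_wk_mk]
  exact mk_eq.2 (.clam_eta ht.some)

@[simp] theorem ilet_top {Γ A} (t : Q Γ none (.comp A)) : ilet top t = t := by
  obtain ⟨t, ht, rfl⟩ := t.exists_rep
  exact mk_eq.2 (.ilet_beta ht.some)

theorem ilet_eta {Γ Δ A} (t : Q Γ Δ (.comp .iunit)) (u : Q Γ (some .iunit) (.comp A)) :
    ilet t (ss u top) = ss u t := by
  obtain ⟨t, ht, rfl⟩ := t.exists_rep
  obtain ⟨u, hu, rfl⟩ := u.exists_rep
  exact mk_eq.2 (.ilet_eta ht.some hu.some)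

@[simp] theorem banglet_bang {Γ A B} (t : Q Γ none A) (u : Q (A :: Γ) none (.comp B)) :
    banglet (bang t) u = ps (.cons t .id) u := by
  obtain ⟨t, ht, rfl⟩ := t.exists_rep
  obtain ⟨u, hu, rfl⟩ := u.exists_rep
  rw [ps_single_mk]
  exact mk_eq.2 (.bang_beta ht.some hu.some)

theorem bang_eta {Γ Δ A B} (t : Q Γ Δ (.comp (.bang A))) (u : Q Γ (some (.bang A)) (.comp B)) :
    banglet t (ss (ps .wk u) (bang (var 0 rfl))) = ss u t := by
  obtain ⟨t, ht, rfl⟩ := t.exists_rep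
  obtain ⟨u, hu, rfl⟩ := u.exists_rep
  rw [ps_wk_mk]
  exact mk_eq.2 (.bang_eta ht.some hu.some)

@[simp] theorem copowlet_copow {Γ Δ A B C} (t : Q Γ none A) (s : Q Γ Δ (.comp B))
    (u : Q (A :: Γ) (some B) (.comp C)) :
    copowlet (copow t s) u = ss (ps (.cons t .id) u) s := by
  obtain ⟨t, ht, rfl⟩ := t.exists_rep
  obtain ⟨s, hs, rfl⟩ := s.exists_rep
  obtain ⟨u, hu, rfl⟩ := u.exists_rep
  rw [ps_single_mk]
  exact mk_eq.2 (.copow_beta ht.some hs.some hu.some)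

theorem copow_eta {Γ Δ A B C} (t : Q Γ Δ (.comp (.copow A B)))
    (u : Q Γ (some (.copow A B)) (.comp C)) :
    copowlet t (ss (ps .wk u) (copow (var 0 rfl) svar)) = ss u t := by
  obtain ⟨t, ht, rfl⟩ := t.exists_rep
  obtain ⟨u, hu, rfl⟩ := u.exists_rep
  rw [ps_wk_mk]
  exact mk_eq.2 (.copow_eta ht.some hu.some)

theorem czero_eta {Γ Δ A} (t : Q Γ Δ (.comp .czero)) (u : Q Γ (some .czero) (.comp A)) :
    cimage A t = ss u t := by
  obtain ⟨t, ht, rfl⟩ := t.exists_rep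
  obtain ⟨u, hu, rfl⟩ := u.exists_rep
  exact mk_eq.2 (.czero_eta ht.some hu.some)

@[simp] theorem ccase_cinl {Γ Δ A B C} (t : Q Γ Δ (.comp A)) (u : Q Γ (some A) (.comp C))
    (u' : Q Γ (some B) (.comp C)) : ccase (cinl t) u u' = ss u t := by
  obtain ⟨t, ht, rfl⟩ := t.exists_rep
  obtain ⟨u, hu, rfl⟩ := u.exists_rep
  obtain ⟨u', hu', rfl⟩ := u'.exists_rep
  exact mk_eq.2 (.csum_beta_inl hu.some hu'.some ht.some)

@[simp] theorem ccase_cinr {Γ Δ A B C} (t : Q Γ Δ (.comp B)) (u : Q Γ (some A) (.comp C))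
    (u' : Q Γ (some B) (.comp C)) : ccase (cinr t) u u' = ss u' t := by
  obtain ⟨t, ht, rfl⟩ := t.exists_rep
  obtain ⟨u, hu, rfl⟩ := u.exists_rep
  obtain ⟨u', hu', rfl⟩ := u'.exists_rep
  exact mk_eq.2 (.csum_beta_inr hu.some hu'.some ht.some)

theorem csum_eta {Γ Δ A B C} (t : Q Γ Δ (.comp (.csum A B)))
    (u : Q Γ (some (.csum A B)) (.comp C)) :
    ccase t (ss u (cinl svar)) (ss u (cinr svar)) = ss u t := by
  obtain ⟨t, ht, rfl⟩ := t.exists_rep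
  obtain ⟨u, hu, rfl⟩ := u.exists_rep
  exact mk_eq.2 (.csum_eta ht.some hu.some)

@[simp] theorem lapp_llam {Γ Δ A B} (t : Q Γ (some A) (.comp B)) (u : Q Γ Δ (.comp A)) :
    lapp (llam t) u = ss t u := by
  obtain ⟨t, ht, rfl⟩ := t.exists_rep
  obtain ⟨u, hu, rfl⟩ := u.exists_rep
  exact mk_eq.2 (.llam_beta ht.some hu.some)

@[simp] theorem llam_eta {Γ A B} (t : Q Γ none (.lin A B)) : llam (lapp t svar) = t := by
  obtain ⟨t, ht, rfl⟩ := t.exists_rep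
  exact mk_eq.2 (.llam_eta ht.some)

/-! ### Extensionality -/

theorem carr_ext {Γ Δ A B} {t u : Q Γ Δ (.comp (.carr A B))}
    (h : capp (ps .wk t) (var 0 rfl) = capp (ps .wk u) (var 0 rfl)) : t = u := by
  rw [← clam_eta t, h, clam_eta]

theorem iunit_ext {Γ A} {t u : Q Γ (some .iunit) (.comp A)} (h : ss t top = ss u top) :
    t = u := by
  rw [← ss_svar_right t, ← ilet_eta, h, ilet_eta, ss_svar_right]

theorem bang_ext {Γ A B} {t u : Q Γ (some (.bang A)) (.comp B)}
    (h : ss (ps .wk t) (bang (var 0 rfl)) = ss (ps .wk u) (bang (var 0 rfl))) : t = u := by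
  rw [← ss_svar_right t, ← bang_eta, h, bang_eta, ss_svar_right]

theorem copow_ext {Γ A B C} {t u : Q Γ (some (.copow A B)) (.comp C)}
    (h : ss (ps .wk t) (copow (var 0 rfl) svar) = ss (ps .wk u) (copow (var 0 rfl) svar)) :
    t = u := by
  rw [← ss_svar_right t, ← copow_eta, h, copow_eta, ss_svar_right]

theorem czero_ext {Γ A} (t u : Q Γ (some .czero) (.comp A)) : t = u := by
  rw [← ss_svar_right t, ← czero_eta, czero_eta _ u, ss_svar_right]

theorem csum_ext {Γ A B C} {t u : Q Γ (some (.csum A B)) (.comp C)}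
    (h : ss t (cinl svar) = ss u (cinl svar)) (h' : ss t (cinr svar) = ss u (cinr svar)) :
    t = u := by
  rw [← ss_svar_right t, ← csum_eta, h, h', csum_eta, ss_svar_right]

/-! ### Commuting conversions -/

@[simp] theorem ss_ilet_comm {Γ Δ A B} (k : Q Γ (some A) (.comp B)) (t : Q Γ Δ (.comp .iunit))
    (u : Q Γ none (.comp A)) : ss k (ilet t u) = ilet t (ss k u) := by
  have key : ss k (ilet svar u) = ilet svar (ss k u) := iunit_ext (by simp [ss_ss])
  have := congrArg (fun x => ss x t) key
  simpa [ss_ss] using this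

@[simp] theorem ss_banglet_comm {Γ Δ A B C} (k : Q Γ (some B) (.comp C))
    (t : Q Γ Δ (.comp (.bang A))) (u : Q (A :: Γ) none (.comp B)) :
    ss k (banglet t u) = banglet t (ss (ps .wk k) u) := by
  have key : ss k (banglet svar u) = banglet svar (ss (ps .wk k) u) :=
    bang_ext (by simp [ss_ss])
  have := congrArg (fun x => ss x t) key
  simpa [ss_ss] using this

@[simp] theorem ss_copowlet_comm {Γ Δ A B C D} (k : Q Γ (some C) (.comp D))
    (t : Q Γ Δ (.comp (.copow A B))) (u : Q (A :: Γ) (some B) (.comp C)) :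
    ss k (copowlet t u) = copowlet t (ss (ps .wk k) u) := by
  have key : ss k (copowlet svar u) = copowlet svar (ss (ps .wk k) u) :=
    copow_ext (by simp [ss_ss])
  have := congrArg (fun x => ss x t) key
  simpa [ss_ss] using this

@[simp] theorem ss_cimage_comm {Γ Δ A B} (k : Q Γ (some A) (.comp B))
    (t : Q Γ Δ (.comp .czero)) : ss k (cimage A t) = cimage B t := by
  have := congrArg (fun x => ss x t) (czero_ext (ss k (cimage A svar)) (cimage B svar))
  simpa [ss_ss] using this

@[simp] theorem ss_ccase_comm {Γ Δ A B C D} (k : Q Γ (some C) (.comp D))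
    (s : Q Γ Δ (.comp (.csum A B))) (t : Q Γ (some A) (.comp C)) (u : Q Γ (some B) (.comp C)) :
    ss k (ccase s t u) = ccase s (ss k t) (ss k u) := by
  have key : ss k (ccase svar t u) = ccase svar (ss k t) (ss k u) :=
    csum_ext (by simp [ss_ss]) (by simp [ss_ss])
  have := congrArg (fun x => ss x s) key
  simpa [ss_ss] using this

end Q
end EEC

namespace EEC

/-- Induction on derivations with one motive for value judgements and one for computation
judgements in an arbitrary stoup. -/
theorem Deriv.vk
    (PV : ∀ {Γ : List VType} {t : Tm} {A : VType}, Deriv Γ none t A → Prop)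
    (PK : ∀ {Γ : List VType} {Δ : Option CType} {t : Tm} {B : CType},
      Deriv Γ Δ t (.comp B) → Prop)
    (vk : ∀ {Γ : List VType} {t : Tm} {B : CType} (d : Deriv Γ none t (.comp B)), PV d ↔ PK d)
    (var : ∀ {Γ : List VType} (n : ℕ) {A : VType} (h : Γ[n]? = some A), PV (.var Γ n A h))
    (svar : ∀ {Γ : List VType} {A : CType}, PK (.svar Γ A))
    (unit : ∀ {Γ : List VType} ,
      PV (.unit Γ))
    (vpair : ∀ {Γ : List VType} {t u : Tm} {A B : VType} (d1 : Deriv Γ none t A) (d2 : Deriv Γ none u B),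
      PV d1 → PV d2 → PV (.vpair Γ t u A B d1 d2))
    (vfst : ∀ {Γ : List VType} {t : Tm} {A B : VType} (d1 : Deriv Γ none t (.prod A B)),
      PV d1 → PV (.vfst Γ t A B d1))
    (vsnd : ∀ {Γ : List VType} {t : Tm} {A B : VType} (d1 : Deriv Γ none t (.prod A B)),
      PV d1 → PV (.vsnd Γ t A B d1))
    (vlam : ∀ {Γ : List VType} {t : Tm} {A B : VType} (d1 : Deriv (A :: Γ) none t B),
      PV d1 → PV (.vlam Γ t A B d1))
    (vapp : ∀ {Γ : List VType} {s t : Tm} {A B : VType} (d1 : Deriv Γ none s (.arr A B)) (d2 : Deriv Γ none t A),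
      PV d1 → PV d2 → PV (.vapp Γ s t A B d1 d2))
    (cunit : ∀ {Γ : List VType} {Δ : Option CType} ,
      PK (.cunit Γ Δ))
    (cpair : ∀ {Γ : List VType} {Δ : Option CType} {t u : Tm} {A B : CType} (d1 : Deriv Γ Δ t (.comp A)) (d2 : Deriv Γ Δ u (.comp B)),
      PK d1 → PK d2 → PK (.cpair Γ Δ t u A B d1 d2))
    (cfst : ∀ {Γ : List VType} {Δ : Option CType} {t : Tm} {A B : CType} (d1 : Deriv Γ Δ t (.comp (.cand A B))),
      PK d1 → PK (.cfst Γ Δ t A B d1))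
    (csnd : ∀ {Γ : List VType} {Δ : Option CType} {t : Tm} {A B : CType} (d1 : Deriv Γ Δ t (.comp (.cand A B))),
      PK d1 → PK (.csnd Γ Δ t A B d1))
    (clam : ∀ {Γ : List VType} {Δ : Option CType} {t : Tm} {A : VType} {B : CType} (d1 : Deriv (A :: Γ) Δ t (.comp B)),
      PK d1 → PK (.clam Γ Δ t A B d1))
    (capp : ∀ {Γ : List VType} {Δ : Option CType} {s t : Tm} {A : VType} {B : CType} (d1 : Deriv Γ Δ s (.comp (.carr A B))) (d2 : Deriv Γ none t A),
      PK d1 → PV d2 → PK (.capp Γ Δ s t A B d1 d2))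
    (top : ∀ {Γ : List VType} ,
      PK (.top Γ))
    (ilet : ∀ {Γ : List VType} {Δ : Option CType} {t u : Tm} {A : CType} (d1 : Deriv Γ Δ t (.comp .iunit)) (d2 : Deriv Γ none u (.comp A)),
      PK d1 → PK d2 → PK (.ilet Γ Δ t u A d1 d2))
    (bang : ∀ {Γ : List VType} {t : Tm} {A : VType} (d1 : Deriv Γ none t A),
      PV d1 → PK (.bang Γ t A d1))
    (banglet : ∀ {Γ : List VType} {Δ : Option CType} {t u : Tm} {A : VType} {B : CType} (d1 : Deriv Γ Δ t (.comp (.bang A))) (d2 : Deriv (A :: Γ) none u (.comp B)),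
      PK d1 → PK d2 → PK (.banglet Γ Δ t u A B d1 d2))
    (copow : ∀ {Γ : List VType} {Δ : Option CType} {t u : Tm} {A : VType} {B : CType} (d1 : Deriv Γ none t A) (d2 : Deriv Γ Δ u (.comp B)),
      PV d1 → PK d2 → PK (.copow Γ Δ t u A B d1 d2))
    (copowlet : ∀ {Γ : List VType} {Δ : Option CType} {s t : Tm} {A : VType} {B C : CType} (d1 : Deriv Γ Δ s (.comp (.copow A B))) (d2 : Deriv (A :: Γ) (some B) t (.comp C)),
      PK d1 → PK d2 → PK (.copowlet Γ Δ s t A B C d1 d2))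
    (cimage : ∀ {Γ : List VType} {Δ : Option CType} {t : Tm} {A : CType} (d1 : Deriv Γ Δ t (.comp .czero)),
      PK d1 → PK (.cimage Γ Δ t A d1))
    (cinl : ∀ {Γ : List VType} {Δ : Option CType} {t : Tm} {A B : CType} (d1 : Deriv Γ Δ t (.comp A)),
      PK d1 → PK (.cinl Γ Δ t A B d1))
    (cinr : ∀ {Γ : List VType} {Δ : Option CType} {t : Tm} {A B : CType} (d1 : Deriv Γ Δ t (.comp B)),
      PK d1 → PK (.cinr Γ Δ t A B d1))
    (ccase : ∀ {Γ : List VType} {Δ : Option CType} {s t u : Tm} {A B C : CType} (d1 : Deriv Γ Δ s (.comp (.csum A B))) (d2 : Deriv Γ (some A) t (.comp C)) (d3 : Deriv Γ (some B) u (.comp C)),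
      PK d1 → PK d2 → PK d3 → PK (.ccase Γ Δ s t u A B C d1 d2 d3))
    (llam : ∀ {Γ : List VType} {t : Tm} {A B : CType} (d1 : Deriv Γ (some A) t (.comp B)),
      PK d1 → PV (.llam Γ t A B d1))
    (lapp : ∀ {Γ : List VType} {Δ : Option CType} {s t : Tm} {A B : CType} (d1 : Deriv Γ none s (.lin A B)) (d2 : Deriv Γ Δ t (.comp A)),
      PV d1 → PK d2 → PK (.lapp Γ Δ s t A B d1 d2))
    : (∀ {Γ : List VType} {t : Tm} {A : VType} (d : Deriv Γ none t A), PV d) ∧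
      (∀ {Γ : List VType} {Δ : Option CType} {t : Tm} {B : CType}
        (d : Deriv Γ Δ t (.comp B)), PK d) := by
  have main : ∀ {Γ : List VType} {Δ : Option CType} {t : Tm} {A : VType} (d : Deriv Γ Δ t A),
      (∀ e : Δ = none, PV (e ▸ d)) ∧ (∀ B (e : A = .comp B), PK (e ▸ d)) := by
    intro Γ Δ t A d
    have ofK : ∀ {Γ : List VType} {Δ : Option CType} {t : Tm} {B : CType}
        (d : Deriv Γ Δ t (.comp B)), PK d →
        (∀ e : Δ = none, PV (e ▸ d)) ∧ (∀ C (e : VType.comp B = .comp C), PK (e ▸ d)) := by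
      intro Γ Δ t B d h
      exact ⟨by rintro rfl; exact (vk d).2 h, by rintro C ⟨⟩; exact h⟩
    have ofV : ∀ {Γ : List VType} {t : Tm} {A : VType} (d : Deriv Γ none t A), PV d →
        (∀ e : none = none, PV (e ▸ d)) ∧ (∀ C (e : A = .comp C), PK (e ▸ d)) := by
      intro Γ t A d h
      exact ⟨fun _ => h, by rintro C rfl; exact (vk d).1 h⟩
    induction d with
    | var _ n _ h => exact ofV _ (var n h)
    | svar _ _ => exact ofK _ svar
    | unit _ => exact ofV _ (unit)
    | vpair _ _ _ _ _ _ _ ih1 ih2 => exact ofV _ (vpair _ _ (ih1.1 rfl) (ih2.1 rfl))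
    | vfst _ _ _ _ _ ih1 => exact ofV _ (vfst _ (ih1.1 rfl))
    | vsnd _ _ _ _ _ ih1 => exact ofV _ (vsnd _ (ih1.1 rfl))
    | vlam _ _ _ _ _ ih1 => exact ofV _ (vlam _ (ih1.1 rfl))
    | vapp _ _ _ _ _ _ _ ih1 ih2 => exact ofV _ (vapp _ _ (ih1.1 rfl) (ih2.1 rfl))
    | cunit _ _ => exact ofK _ (cunit)
    | cpair _ _ _ _ _ _ _ _ ih1 ih2 => exact ofK _ (cpair _ _ (ih1.2 _ rfl) (ih2.2 _ rfl))
    | cfst _ _ _ _ _ _ ih1 => exact ofK _ (cfst _ (ih1.2 _ rfl))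
    | csnd _ _ _ _ _ _ ih1 => exact ofK _ (csnd _ (ih1.2 _ rfl))
    | clam _ _ _ _ _ _ ih1 => exact ofK _ (clam _ (ih1.2 _ rfl))
    | capp _ _ _ _ _ _ _ _ ih1 ih2 => exact ofK _ (capp _ _ (ih1.2 _ rfl) (ih2.1 rfl))
    | top _ => exact ofK _ (top)
    | ilet _ _ _ _ _ _ _ ih1 ih2 => exact ofK _ (ilet _ _ (ih1.2 _ rfl) (ih2.2 _ rfl))
    | bang _ _ _ _ ih1 => exact ofK _ (bang _ (ih1.1 rfl))
    | banglet _ _ _ _ _ _ _ _ ih1 ih2 => exact ofK _ (banglet _ _ (ih1.2 _ rfl) (ih2.2 _ rfl))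
    | copow _ _ _ _ _ _ _ _ ih1 ih2 => exact ofK _ (copow _ _ (ih1.1 rfl) (ih2.2 _ rfl))
    | copowlet _ _ _ _ _ _ _ _ _ ih1 ih2 => exact ofK _ (copowlet _ _ (ih1.2 _ rfl) (ih2.2 _ rfl))
    | cimage _ _ _ _ _ ih1 => exact ofK _ (cimage _ (ih1.2 _ rfl))
    | cinl _ _ _ _ _ _ ih1 => exact ofK _ (cinl _ (ih1.2 _ rfl))
    | cinr _ _ _ _ _ _ ih1 => exact ofK _ (cinr _ (ih1.2 _ rfl))
    | ccase _ _ _ _ _ _ _ _ _ _ _ ih1 ih2 ih3 => exact ofK _ (ccase _ _ _ (ih1.2 _ rfl) (ih2.2 _ rfl) (ih3.2 _ rfl))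
    | llam _ _ _ _ _ ih1 => exact ofV _ (llam _ (ih1.2 _ rfl))
    | lapp _ _ _ _ _ _ _ _ ih1 ih2 => exact ofK _ (lapp _ _ (ih1.1 rfl) (ih2.2 _ rfl))
  exact ⟨fun d => (main d).1 rfl, fun d => (main d).2 _ rfl⟩

end EEC

namespace EEC

/-! ## The self-translation on the quotient -/

/-- The answer type of a translated judgement with stoup `Δ`. -/
abbrev res (R : CType) : Option CType → CType
  | none => R
  | some D => cpsC R D

theorem cpsCtx_get {R : CType} {Γ : List VType} {n : ℕ} {A : VType} (h : Γ[n]? = some A) :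
    (cpsCtx R Γ)[n]? = some (cpsV R A) := by
  simp [cpsCtx, h]

theorem cps_typed (R : CType) :
    (∀ {Γ : List VType} {t : Tm} {A : VType} (d : Deriv Γ none t A),
      Ty (cpsCtx R Γ) none (cps R d) (cpsV R A)) ∧
    (∀ {Γ : List VType} {Δ : Option CType} {t : Tm} {B : CType} (d : Deriv Γ Δ t (.comp B)),
      match Δ, d with
      | none, d => Ty (cpsCtx R Γ) none (cps R d) (.lin (cpsC R B) R)
      | some D, d => Ty (cpsCtx R Γ) (some (cpsC R B)) (cps R d) (.comp (cpsC R D))) := by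
  apply Deriv.vk
  case vk => intros; exact Iff.rfl
  case var => intro Γ n A h; exact ⟨.var _ _ _ (cpsCtx_get h)⟩
  case svar => intros; exact Ty.svar
  case unit => intros; exact Ty.unit
  case vpair => intros; exact Ty.vpair ‹_› ‹_›
  case vfst => intros; exact Ty.vfst (by assumption)
  case vsnd => intros; exact Ty.vsnd (by assumption)
  case vlam => intros; exact Ty.vlam (by assumption)
  case vapp => intro _ _ _ _ _ _ _ h h'; exact Ty.vapp h h'
  case cunit =>
    intro Γ Δ
    cases Δ
    · exact Ty.llam (Ty.cimage Ty.svar)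
    · exact Ty.cimage Ty.svar
  case cpair =>
    intro Γ Δ t u A B d1 d2 h h'
    cases Δ
    · exact Ty.llam (Ty.ccase Ty.svar (Ty.lapp h Ty.svar) (Ty.lapp h' Ty.svar))
    · exact Ty.ccase Ty.svar h h'
  case cfst =>
    intro Γ Δ t A B d1 h
    cases Δ
    · exact Ty.llam (Ty.lapp h (Ty.cinl Ty.svar))
    · exact Ty.ssubst h (Ty.cinl Ty.svar)
  case csnd =>
    intro Γ Δ t A B d1 h
    cases Δ
    · exact Ty.llam (Ty.lapp h (Ty.cinr Ty.svar))
    · exact Ty.ssubst h (Ty.cinr Ty.svar)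
  case clam =>
    intro Γ Δ t A B d1 h
    cases Δ
    · exact Ty.llam (Ty.copowlet Ty.svar (Ty.lapp h Ty.svar))
    · exact Ty.copowlet Ty.svar h
  case capp =>
    intro Γ Δ s t A B d1 d2 h h'
    cases Δ
    · exact Ty.llam (Ty.lapp h (Ty.copow h' Ty.svar))
    · exact Ty.ssubst h (Ty.copow h' Ty.svar)
  case top => intros; exact Ty.llam Ty.svar
  case ilet =>
    intro Γ Δ t u A d1 d2 h h'
    cases Δ
    · exact Ty.llam (Ty.lapp h (Ty.lapp h' Ty.svar))
    · exact Ty.ssubst h (Ty.lapp h' Ty.svar)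
  case bang => intro Γ t A d1 h; exact Ty.llam (Ty.capp Ty.svar h)
  case banglet =>
    intro Γ Δ t u A B d1 d2 h h'
    cases Δ
    · exact Ty.llam (Ty.lapp h (Ty.clam (Ty.lapp h' Ty.svar)))
    · exact Ty.ssubst h (Ty.clam (Ty.lapp h' Ty.svar))
  case copow =>
    intro Γ Δ t u A B d1 d2 h h'
    cases Δ
    · exact Ty.llam (Ty.lapp h' (Ty.capp Ty.svar h))
    · exact Ty.ssubst h' (Ty.capp Ty.svar h)
  case copowlet =>
    intro Γ Δ s t A B C d1 d2 h h'
    cases Δ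
    · exact Ty.llam (Ty.lapp h (Ty.clam h'))
    · exact Ty.ssubst h (Ty.clam h')
  case cimage =>
    intro Γ Δ t A d1 h
    cases Δ
    · exact Ty.llam (Ty.lapp h Ty.cunit)
    · exact Ty.ssubst h Ty.cunit
  case cinl =>
    intro Γ Δ t A B d1 h
    cases Δ
    · exact Ty.llam (Ty.lapp h (Ty.cfst Ty.svar))
    · exact Ty.ssubst h (Ty.cfst Ty.svar)
  case cinr =>
    intro Γ Δ t A B d1 h
    cases Δ
    · exact Ty.llam (Ty.lapp h (Ty.csnd Ty.svar))
    · exact Ty.ssubst h (Ty.csnd Ty.svar)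
  case ccase =>
    intro Γ Δ s t u A B C d1 d2 d3 h h' h''
    cases Δ
    · exact Ty.llam (Ty.lapp h (Ty.cpair h' h''))
    · exact Ty.ssubst h (Ty.cpair h' h'')
  case llam => intro Γ t A B d1 h; exact Ty.llam h
  case lapp =>
    intro Γ Δ s t A B d1 d2 h h'
    cases Δ
    · exact Ty.llam (Ty.lapp h' (Ty.lapp h Ty.svar))
    · exact Ty.ssubst h' (Ty.lapp h Ty.svar)

end EEC

namespace EEC.Dual

/-! ## The dual structure -/

variable {R : CType} {Γ Γ' Γ'' Θ : List VType}

/-- Terms of translated value type in translated context. -/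
def V (R : CType) (Γ : List VType) (A : VType) : Type := Q (cpsCtx R Γ) none (cpsV R A)

/-- Terms transforming continuations for `B` into continuations for the stoup `Δ`. -/
def K (R : CType) (Γ : List VType) (Δ : Option CType) (B : CType) : Type :=
  Q (cpsCtx R Γ) (some (cpsC R B)) (.comp (res R Δ))

/-- Substitutions between translated contexts. -/
def S (R : CType) (Γ Γ' : List VType) : Type := Sub (cpsCtx R Γ) (cpsCtx R Γ')

namespace S

def get (σ : S R Γ Γ') (n : ℕ) {A : VType} (h : Γ[n]? = some A) : V R Γ' A := σ n _ (cpsCtx_get h)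

def id : S R Γ Γ := Sub.id

def wk {A : VType} : S R Γ (A :: Γ) := Sub.wk (A := cpsV R A)

def cons {A : VType} (u : V R Γ' A) (σ : S R Γ Γ') : S R (A :: Γ) Γ' := Sub.cons u σ

noncomputable def comp (σ : S R Γ Γ') (τ : S R Γ' Γ'') : S R Γ Γ'' := Sub.comp σ τ

end S

def var (n : ℕ) {A : VType} (h : Γ[n]? = some A) : V R Γ A := Q.var n (cpsCtx_get h)

def svar {A : CType} : K R Γ (some A) A := Q.svar

noncomputable def psV {A : VType} (σ : S R Γ Γ') (t : V R Γ A) : V R Γ' A := Q.ps σ t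

noncomputable def ps {Δ : Option CType} {B : CType} (σ : S R Γ Γ') (t : K R Γ Δ B) : K R Γ' Δ B :=
  Q.ps σ t

def ss {Δ : Option CType} {B C : CType} (t : K R Γ (some B) C) (u : K R Γ Δ B) : K R Γ Δ C :=
  Q.ss u t

namespace S

noncomputable abbrev lift (A : VType) (σ : S R Γ Γ') : S R (A :: Γ) (A :: Γ') :=
  cons (var 0 rfl) (σ.comp wk)

@[simp] theorem get_cons_zero {A : VType} (u : V R Γ' A) (σ : S R Γ Γ') :
    (cons u σ).get 0 (A := A) rfl = u := rfl

@[simp] theorem get_cons_succ {A B : VType} (u : V R Γ' A) (σ : S R Γ Γ') (n : ℕ)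
    (h : (A :: Γ)[n + 1]? = some B) :
    (cons u σ).get (n + 1) h = σ.get n (by simpa using h) := rfl

@[simp] theorem get_id (n : ℕ) {A : VType} (h : Γ[n]? = some A) : (id (R := R)).get n h = var n h := rfl

@[simp] theorem get_wk (n : ℕ) {A B : VType} (h : Γ[n]? = some B) :
    (wk (R := R) (A := A)).get n h = var (n + 1) (by simpa using h) := rfl

@[simp] theorem get_comp (σ : S R Γ Γ') (τ : S R Γ' Γ'') (n : ℕ) {A : VType}
    (h : Γ[n]? = some A) : (σ.comp τ).get n h = psV τ (σ.get n h) := rfl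

@[simp] theorem comp_id (σ : S R Γ Γ') : σ.comp id = σ := Sub.comp_id σ

@[simp] theorem id_comp (σ : S R Γ Γ') : id.comp σ = σ := Sub.id_comp σ

@[simp] theorem comp_comp (σ : S R Γ Γ') (τ : S R Γ' Γ'') (ρ : S R Γ'' Θ) :
    (σ.comp τ).comp ρ = σ.comp (τ.comp ρ) := Sub.comp_comp σ τ ρ

@[simp] theorem wk_comp_cons {A : VType} (u : V R Γ' A) (σ : S R Γ Γ') :
    wk.comp (cons u σ) = σ := Sub.wk_comp_cons (A := cpsV R A) u σ

@[simp] theorem cons_comp {A : VType} (u : V R Γ' A) (σ : S R Γ Γ') (τ : S R Γ' Γ'') :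
    (cons u σ).comp τ = cons (psV τ u) (σ.comp τ) := Sub.cons_comp (A := cpsV R A) u σ τ

@[simp] theorem cons_var_wk {A : VType} : cons (var 0 rfl) wk = (id : S R (A :: Γ) (A :: Γ)) :=
  Sub.cons_var_wk (A := cpsV R A)

end S

@[simp] theorem psV_psV {A : VType} (σ : S R Γ Γ') (τ : S R Γ' Γ'') (t : V R Γ A) :
    psV τ (psV σ t) = psV (σ.comp τ) t := Q.ps_ps σ τ t

@[simp] theorem ps_ps {Δ : Option CType} {B : CType} (σ : S R Γ Γ') (τ : S R Γ' Γ'')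
    (t : K R Γ Δ B) : ps τ (ps σ t) = ps (σ.comp τ) t := Q.ps_ps σ τ t

@[simp] theorem psV_id {A : VType} (t : V R Γ A) : psV .id t = t := Q.ps_id t

@[simp] theorem ps_id {Δ : Option CType} {B : CType} (t : K R Γ Δ B) : ps .id t = t := Q.ps_id t

@[simp] theorem psV_var (σ : S R Γ Γ') (n : ℕ) {A : VType} (h : Γ[n]? = some A) :
    psV σ (var n h) = σ.get n h := Q.ps_var σ n _

@[simp] theorem ps_svar (σ : S R Γ Γ') {A : CType} : ps σ (svar (A := A)) = svar := rfl

@[simp] theorem ss_svar_left {Δ : Option CType} {B : CType} (u : K R Γ Δ B) : ss svar u = u :=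
  Q.ss_svar_right u

@[simp] theorem ss_svar_right {B C : CType} (u : K R Γ (some B) C) : ss u svar = u :=
  Q.ss_svar_left u

theorem ss_ss {Δ : Option CType} {B C D : CType} (t : K R Γ (some C) D) (u : K R Γ (some B) C)
    (w : K R Γ Δ B) : ss (ss t u) w = ss t (ss u w) := (Q.ss_ss w u t).symm

@[simp] theorem ps_ss {Δ : Option CType} {B C : CType} (σ : S R Γ Γ') (t : K R Γ (some B) C)
    (u : K R Γ Δ B) : ps σ (ss t u) = ss (ps σ t) (ps σ u) := Q.ps_ss σ u t

def unit  : V R Γ .unit :=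
  Q.unit

def vpair {A B : VType} (t : V R Γ A) (u : V R Γ B) : V R Γ (.prod A B) :=
  Q.vpair t u

def vfst {A B : VType} (t : V R Γ (.prod A B)) : V R Γ A :=
  Q.vfst (B := cpsV R B) t

def vsnd {A B : VType} (t : V R Γ (.prod A B)) : V R Γ B :=
  Q.vsnd (A := cpsV R A) t

def vlam {A B : VType} (t : V R (A :: Γ) B) : V R Γ (.arr A B) :=
  Q.vlam (Γ := cpsCtx R Γ) t

def vapp {A B : VType} (s : V R Γ (.arr A B)) (t : V R Γ A) : V R Γ B :=
  Q.vapp (A := cpsV R A) (B := cpsV R B) s t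

def llam {A B : CType} (t : K R Γ (some A) B) : V R Γ (.lin A B) :=
  Q.llam (A := cpsC R B) (B := cpsC R A) t

def ofK {B : CType} (t : K R Γ none B) : V R Γ (.comp B) :=
  Q.llam (A := cpsC R B) (B := R) t

def toK {B : CType} (t : V R Γ (.comp B)) : K R Γ none B :=
  Q.lapp (A := cpsC R B) (B := R) t .svar

def cunit {Δ : Option CType} : K R Γ Δ .cunit :=
  Q.cimage (res R Δ) .svar

def cpair {Δ : Option CType} {A B : CType} (t : K R Γ Δ A) (u : K R Γ Δ B) : K R Γ Δ (.cand A B) :=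
  Q.ccase (A := cpsC R A) (B := cpsC R B) .svar t u

def cfst {Δ : Option CType} {A B : CType} (t : K R Γ Δ (.cand A B)) : K R Γ Δ A :=
  Q.ss (B := .csum (cpsC R A) (cpsC R B)) t (.cinl .svar)

def csnd {Δ : Option CType} {A B : CType} (t : K R Γ Δ (.cand A B)) : K R Γ Δ B :=
  Q.ss (B := .csum (cpsC R A) (cpsC R B)) t (.cinr .svar)

def clam {Δ : Option CType} {A : VType} {B : CType} (t : K R (A :: Γ) Δ B) : K R Γ Δ (.carr A B) :=
  Q.copowlet (Γ := cpsCtx R Γ) (A := cpsV R A) (B := cpsC R B) .svar t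

def capp {Δ : Option CType} {A : VType} {B : CType} (s : K R Γ Δ (.carr A B)) (t : V R Γ A) : K R Γ Δ B :=
  Q.ss (B := .copow (cpsV R A) (cpsC R B)) s (.copow t .svar)

def top  : K R Γ none .iunit :=
  Q.svar

def ilet {Δ : Option CType} {A : CType} (t : K R Γ Δ .iunit) (u : K R Γ none A) : K R Γ Δ A :=
  Q.ss (B := R) t u

def bang {A : VType} (t : V R Γ A) : K R Γ none (.bang A) :=
  Q.capp (A := cpsV R A) (B := R) .svar t

def banglet {Δ : Option CType} {A : VType} {B : CType} (t : K R Γ Δ (.bang A)) (u : K R (A :: Γ) none B) : K R Γ Δ B :=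
  Q.ss (B := .carr (cpsV R A) R) t (Q.clam (Γ := cpsCtx R Γ) u)

def copow {Δ : Option CType} {A : VType} {B : CType} (t : V R Γ A) (u : K R Γ Δ B) : K R Γ Δ (.copow A B) :=
  Q.ss (B := cpsC R B) u (Q.capp (A := cpsV R A) (B := cpsC R B) .svar t)

def copowlet {Δ : Option CType} {A : VType} {B C : CType} (s : K R Γ Δ (.copow A B)) (t : K R (A :: Γ) (some B) C) : K R Γ Δ C :=
  Q.ss (B := .carr (cpsV R A) (cpsC R B)) s (Q.clam (Γ := cpsCtx R Γ) t)

def cimage {Δ : Option CType} (A : CType) (t : K R Γ Δ .czero) : K R Γ Δ A :=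
  Q.ss (B := .cunit) t .cunit

def cinl {Δ : Option CType} {A B : CType} (t : K R Γ Δ A) : K R Γ Δ (.csum A B) :=
  Q.ss t (Q.cfst (A := cpsC R A) (B := cpsC R B) .svar)

def cinr {Δ : Option CType} {A B : CType} (t : K R Γ Δ B) : K R Γ Δ (.csum A B) :=
  Q.ss t (Q.csnd (A := cpsC R A) (B := cpsC R B) .svar)

def ccase {Δ : Option CType} {A B C : CType} (s : K R Γ Δ (.csum A B)) (t : K R Γ (some A) C) (u : K R Γ (some B) C) : K R Γ Δ C :=
  Q.ss (B := .cand (cpsC R A) (cpsC R B)) s (Q.cpair t u)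

def lapp {Δ : Option CType} {A B : CType} (s : V R Γ (.lin A B)) (t : K R Γ Δ A) : K R Γ Δ B :=
  Q.ss t (Q.lapp (A := cpsC R B) (B := cpsC R A) s .svar)

@[simp] theorem ps_unit  (σ : S R Γ Γ') :
    psV σ (unit : V R Γ .unit) = unit := by
  revert σ
  dsimp only [K, V, S, S.comp, S.wk, svar, ps, psV, ss, res, cpsC, cpsV, cpsCtx, List.map_cons, unit]
  intros
  simp

@[simp] theorem ps_vpair {A B : VType} (σ : S R Γ Γ') (t : V R Γ A) (u : V R Γ B) :
    psV σ (vpair t u) = vpair (psV σ t) (psV σ u) := by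
  revert σ t u
  dsimp only [K, V, S, S.comp, S.wk, svar, ps, psV, ss, res, cpsC, cpsV, cpsCtx, List.map_cons, vpair]
  intros
  simp

@[simp] theorem ps_vfst {A B : VType} (σ : S R Γ Γ') (t : V R Γ (.prod A B)) :
    psV σ (vfst t) = vfst (psV σ t) := by
  revert σ t
  dsimp only [K, V, S, S.comp, S.wk, svar, ps, psV, ss, res, cpsC, cpsV, cpsCtx, List.map_cons, vfst]
  intros
  simp

@[simp] theorem ps_vsnd {A B : VType} (σ : S R Γ Γ') (t : V R Γ (.prod A B)) :
    psV σ (vsnd t) = vsnd (psV σ t) := by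
  revert σ t
  dsimp only [K, V, S, S.comp, S.wk, svar, ps, psV, ss, res, cpsC, cpsV, cpsCtx, List.map_cons, vsnd]
  intros
  simp

@[simp] theorem ps_vlam {A B : VType} (σ : S R Γ Γ') (t : V R (A :: Γ) B) :
    psV σ (vlam t) = vlam (psV (.lift A σ) t) := by
  revert σ t
  dsimp only [K, V, S, S.comp, S.wk, svar, ps, psV, ss, res, cpsC, cpsV, cpsCtx, List.map_cons, vlam]
  intros
  simp
  rfl

@[simp] theorem ps_vapp {A B : VType} (σ : S R Γ Γ') (s : V R Γ (.arr A B)) (t : V R Γ A) :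
    psV σ (vapp s t) = vapp (psV σ s) (psV σ t) := by
  revert σ s t
  dsimp only [K, V, S, S.comp, S.wk, svar, ps, psV, ss, res, cpsC, cpsV, cpsCtx, List.map_cons, vapp]
  intros
  simp

@[simp] theorem ps_llam {A B : CType} (σ : S R Γ Γ') (t : K R Γ (some A) B) :
    psV σ (llam t) = llam (ps σ t) := by
  revert σ t
  dsimp only [K, V, S, S.comp, S.wk, svar, ps, psV, ss, res, cpsC, cpsV, cpsCtx, List.map_cons, llam]
  intros
  simp

@[simp] theorem ps_ofK {B : CType} (σ : S R Γ Γ') (t : K R Γ none B) :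
    psV σ (ofK t) = ofK (ps σ t) := by
  revert σ t
  dsimp only [K, V, S, S.comp, S.wk, svar, ps, psV, ss, res, cpsC, cpsV, cpsCtx, List.map_cons, ofK]
  intros
  simp

@[simp] theorem ps_toK {B : CType} (σ : S R Γ Γ') (t : V R Γ (.comp B)) :
    ps σ (toK t) = toK (psV σ t) := by
  revert σ t
  dsimp only [K, V, S, S.comp, S.wk, svar, ps, psV, ss, res, cpsC, cpsV, cpsCtx, List.map_cons, toK]
  intros
  simp

@[simp] theorem ps_cunit {Δ : Option CType} (σ : S R Γ Γ') :
    ps σ (cunit : K R Γ Δ .cunit) = cunit := by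
  revert σ
  dsimp only [K, V, S, S.comp, S.wk, svar, ps, psV, ss, res, cpsC, cpsV, cpsCtx, List.map_cons, cunit]
  intros
  simp

@[simp] theorem ss_cunit {Δ : Option CType} {X : CType} (e : K R Γ Δ X) :
    ss (cunit : K R Γ (some X) .cunit) e = cunit := by
  revert e
  dsimp only [K, V, S, S.comp, S.wk, svar, ps, psV, ss, res, cpsC, cpsV, cpsCtx, List.map_cons, cunit]
  intros
  simp

@[simp] theorem ps_cpair {Δ : Option CType} {A B : CType} (σ : S R Γ Γ') (t : K R Γ Δ A) (u : K R Γ Δ B) :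
    ps σ (cpair t u) = cpair (ps σ t) (ps σ u) := by
  revert σ t u
  dsimp only [K, V, S, S.comp, S.wk, svar, ps, psV, ss, res, cpsC, cpsV, cpsCtx, List.map_cons, cpair]
  intros
  simp

@[simp] theorem ss_cpair {Δ : Option CType} {A B : CType} {X : CType} (t : K R Γ (some X) A) (u : K R Γ (some X) B) (e : K R Γ Δ X) :
    ss (cpair t u) e = cpair (ss t e) (ss u e) := by
  revert t u e
  dsimp only [K, V, S, S.comp, S.wk, svar, ps, psV, ss, res, cpsC, cpsV, cpsCtx, List.map_cons, cpair]
  intros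
  simp

@[simp] theorem ps_cfst {Δ : Option CType} {A B : CType} (σ : S R Γ Γ') (t : K R Γ Δ (.cand A B)) :
    ps σ (cfst t) = cfst (ps σ t) := by
  revert σ t
  dsimp only [K, V, S, S.comp, S.wk, svar, ps, psV, ss, res, cpsC, cpsV, cpsCtx, List.map_cons, cfst]
  intros
  simp

@[simp] theorem ss_cfst {Δ : Option CType} {A B : CType} {X : CType} (t : K R Γ (some X) (.cand A B)) (e : K R Γ Δ X) :
    ss (cfst t) e = cfst (ss t e) := by
  revert t e
  dsimp only [K, V, S, S.comp, S.wk, svar, ps, psV, ss, res, cpsC, cpsV, cpsCtx, List.map_cons, cfst]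
  intros
  simp [Q.ss_ss]

@[simp] theorem ps_csnd {Δ : Option CType} {A B : CType} (σ : S R Γ Γ') (t : K R Γ Δ (.cand A B)) :
    ps σ (csnd t) = csnd (ps σ t) := by
  revert σ t
  dsimp only [K, V, S, S.comp, S.wk, svar, ps, psV, ss, res, cpsC, cpsV, cpsCtx, List.map_cons, csnd]
  intros
  simp

@[simp] theorem ss_csnd {Δ : Option CType} {A B : CType} {X : CType} (t : K R Γ (some X) (.cand A B)) (e : K R Γ Δ X) :
    ss (csnd t) e = csnd (ss t e) := by
  revert t e
  dsimp only [K, V, S, S.comp, S.wk, svar, ps, psV, ss, res, cpsC, cpsV, cpsCtx, List.map_cons, csnd]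
  intros
  simp [Q.ss_ss]

@[simp] theorem ps_clam {Δ : Option CType} {A : VType} {B : CType} (σ : S R Γ Γ') (t : K R (A :: Γ) Δ B) :
    ps σ (clam t) = clam (ps (.lift A σ) t) := by
  revert σ t
  dsimp only [K, V, S, S.comp, S.wk, svar, ps, psV, ss, res, cpsC, cpsV, cpsCtx, List.map_cons, clam]
  intros
  simp
  rfl

@[simp] theorem ss_clam {Δ : Option CType} {A : VType} {B : CType} {X : CType} (t : K R (A :: Γ) (some X) B) (e : K R Γ Δ X) :
    ss (clam t) e = clam (ss t (ps .wk e)) := by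
  revert t e
  dsimp only [K, V, S, S.comp, S.wk, svar, ps, psV, ss, res, cpsC, cpsV, cpsCtx, List.map_cons, clam]
  intros
  simp

@[simp] theorem ps_capp {Δ : Option CType} {A : VType} {B : CType} (σ : S R Γ Γ') (s : K R Γ Δ (.carr A B)) (t : V R Γ A) :
    ps σ (capp s t) = capp (ps σ s) (psV σ t) := by
  revert σ s t
  dsimp only [K, V, S, S.comp, S.wk, svar, ps, psV, ss, res, cpsC, cpsV, cpsCtx, List.map_cons, capp]
  intros
  simp

@[simp] theorem ss_capp {Δ : Option CType} {A : VType} {B : CType} {X : CType} (s : K R Γ (some X) (.carr A B)) (t : V R Γ A) (e : K R Γ Δ X) :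
    ss (capp s t) e = capp (ss s e) t := by
  revert s t e
  dsimp only [K, V, S, S.comp, S.wk, svar, ps, psV, ss, res, cpsC, cpsV, cpsCtx, List.map_cons, capp]
  intros
  simp [Q.ss_ss]

@[simp] theorem ps_top  (σ : S R Γ Γ') :
    ps σ (top : K R Γ none .iunit) = top := by
  revert σ
  dsimp only [K, V, S, S.comp, S.wk, svar, ps, psV, ss, res, cpsC, cpsV, cpsCtx, List.map_cons, top]
  intros
  simp

@[simp] theorem ps_ilet {Δ : Option CType} {A : CType} (σ : S R Γ Γ') (t : K R Γ Δ .iunit) (u : K R Γ none A) :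
    ps σ (ilet t u) = ilet (ps σ t) (ps σ u) := by
  revert σ t u
  dsimp only [K, V, S, S.comp, S.wk, svar, ps, psV, ss, res, cpsC, cpsV, cpsCtx, List.map_cons, ilet]
  intros
  simp

@[simp] theorem ss_ilet {Δ : Option CType} {A : CType} {X : CType} (t : K R Γ (some X) .iunit) (u : K R Γ none A) (e : K R Γ Δ X) :
    ss (ilet t u) e = ilet (ss t e) u := by
  revert t u e
  dsimp only [K, V, S, S.comp, S.wk, svar, ps, psV, ss, res, cpsC, cpsV, cpsCtx, List.map_cons, ilet]
  intros
  simp [Q.ss_ss]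

@[simp] theorem ps_bang {A : VType} (σ : S R Γ Γ') (t : V R Γ A) :
    ps σ (bang t) = bang (psV σ t) := by
  revert σ t
  dsimp only [K, V, S, S.comp, S.wk, svar, ps, psV, ss, res, cpsC, cpsV, cpsCtx, List.map_cons, bang]
  intros
  simp

@[simp] theorem ps_banglet {Δ : Option CType} {A : VType} {B : CType} (σ : S R Γ Γ') (t : K R Γ Δ (.bang A)) (u : K R (A :: Γ) none B) :
    ps σ (banglet t u) = banglet (ps σ t) (ps (.lift A σ) u) := by
  revert σ t u
  dsimp only [K, V, S, S.comp, S.wk, svar, ps, psV, ss, res, cpsC, cpsV, cpsCtx, List.map_cons, banglet]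
  intros
  simp
  rfl

@[simp] theorem ss_banglet {Δ : Option CType} {A : VType} {B : CType} {X : CType} (t : K R Γ (some X) (.bang A)) (u : K R (A :: Γ) none B) (e : K R Γ Δ X) :
    ss (banglet t u) e = banglet (ss t e) u := by
  revert t u e
  dsimp only [K, V, S, S.comp, S.wk, svar, ps, psV, ss, res, cpsC, cpsV, cpsCtx, List.map_cons, banglet]
  intros
  simp [Q.ss_ss]

@[simp] theorem ps_copow {Δ : Option CType} {A : VType} {B : CType} (σ : S R Γ Γ') (t : V R Γ A) (u : K R Γ Δ B) :
    ps σ (copow t u) = copow (psV σ t) (ps σ u) := by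
  revert σ t u
  dsimp only [K, V, S, S.comp, S.wk, svar, ps, psV, ss, res, cpsC, cpsV, cpsCtx, List.map_cons, copow]
  intros
  simp

@[simp] theorem ss_copow {Δ : Option CType} {A : VType} {B : CType} {X : CType} (t : V R Γ A) (u : K R Γ (some X) B) (e : K R Γ Δ X) :
    ss (copow t u) e = copow t (ss u e) := by
  revert t u e
  dsimp only [K, V, S, S.comp, S.wk, svar, ps, psV, ss, res, cpsC, cpsV, cpsCtx, List.map_cons, copow]
  intros
  simp [Q.ss_ss]

@[simp] theorem ps_copowlet {Δ : Option CType} {A : VType} {B C : CType} (σ : S R Γ Γ') (s : K R Γ Δ (.copow A B)) (t : K R (A :: Γ) (some B) C) :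
    ps σ (copowlet s t) = copowlet (ps σ s) (ps (.lift A σ) t) := by
  revert σ s t
  dsimp only [K, V, S, S.comp, S.wk, svar, ps, psV, ss, res, cpsC, cpsV, cpsCtx, List.map_cons, copowlet]
  intros
  simp
  rfl

@[simp] theorem ss_copowlet {Δ : Option CType} {A : VType} {B C : CType} {X : CType} (s : K R Γ (some X) (.copow A B)) (t : K R (A :: Γ) (some B) C) (e : K R Γ Δ X) :
    ss (copowlet s t) e = copowlet (ss s e) t := by
  revert s t e
  dsimp only [K, V, S, S.comp, S.wk, svar, ps, psV, ss, res, cpsC, cpsV, cpsCtx, List.map_cons, copowlet]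
  intros
  simp [Q.ss_ss]

@[simp] theorem ps_cimage {Δ : Option CType} (A : CType) (σ : S R Γ Γ') (t : K R Γ Δ .czero) :
    ps σ (cimage A t) = cimage A (ps σ t) := by
  revert σ t
  dsimp only [K, V, S, S.comp, S.wk, svar, ps, psV, ss, res, cpsC, cpsV, cpsCtx, List.map_cons, cimage]
  intros
  simp

@[simp] theorem ss_cimage {Δ : Option CType} (A : CType) {X : CType} (t : K R Γ (some X) .czero) (e : K R Γ Δ X) :
    ss (cimage A t) e = cimage A (ss t e) := by
  revert t e
  dsimp only [K, V, S, S.comp, S.wk, svar, ps, psV, ss, res, cpsC, cpsV, cpsCtx, List.map_cons, cimage]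
  intros
  simp [Q.ss_ss]

@[simp] theorem ps_cinl {Δ : Option CType} {A B : CType} (σ : S R Γ Γ') (t : K R Γ Δ A) :
    ps σ (cinl (B := B) t) = cinl (B := B) (ps σ t) := by
  revert σ t
  dsimp only [K, V, S, S.comp, S.wk, svar, ps, psV, ss, res, cpsC, cpsV, cpsCtx, List.map_cons, cinl]
  intros
  simp

@[simp] theorem ss_cinl {Δ : Option CType} {A B : CType} {X : CType} (t : K R Γ (some X) A) (e : K R Γ Δ X) :
    ss (cinl (B := B) t) e = cinl (B := B) (ss t e) := by
  revert t e
  dsimp only [K, V, S, S.comp, S.wk, svar, ps, psV, ss, res, cpsC, cpsV, cpsCtx, List.map_cons, cinl]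
  intros
  simp [Q.ss_ss]

@[simp] theorem ps_cinr {Δ : Option CType} {A B : CType} (σ : S R Γ Γ') (t : K R Γ Δ B) :
    ps σ (cinr (A := A) t) = cinr (A := A) (ps σ t) := by
  revert σ t
  dsimp only [K, V, S, S.comp, S.wk, svar, ps, psV, ss, res, cpsC, cpsV, cpsCtx, List.map_cons, cinr]
  intros
  simp

@[simp] theorem ss_cinr {Δ : Option CType} {A B : CType} {X : CType} (t : K R Γ (some X) B) (e : K R Γ Δ X) :
    ss (cinr (A := A) t) e = cinr (A := A) (ss t e) := by
  revert t e
  dsimp only [K, V, S, S.comp, S.wk, svar, ps, psV, ss, res, cpsC, cpsV, cpsCtx, List.map_cons, cinr]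
  intros
  simp [Q.ss_ss]

@[simp] theorem ps_ccase {Δ : Option CType} {A B C : CType} (σ : S R Γ Γ') (s : K R Γ Δ (.csum A B)) (t : K R Γ (some A) C) (u : K R Γ (some B) C) :
    ps σ (ccase s t u) = ccase (ps σ s) (ps σ t) (ps σ u) := by
  revert σ s t u
  dsimp only [K, V, S, S.comp, S.wk, svar, ps, psV, ss, res, cpsC, cpsV, cpsCtx, List.map_cons, ccase]
  intros
  simp

@[simp] theorem ss_ccase {Δ : Option CType} {A B C : CType} {X : CType} (s : K R Γ (some X) (.csum A B)) (t : K R Γ (some A) C) (u : K R Γ (some B) C) (e : K R Γ Δ X) :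
    ss (ccase s t u) e = ccase (ss s e) t u := by
  revert s t u e
  dsimp only [K, V, S, S.comp, S.wk, svar, ps, psV, ss, res, cpsC, cpsV, cpsCtx, List.map_cons, ccase]
  intros
  simp [Q.ss_ss]

@[simp] theorem ps_lapp {Δ : Option CType} {A B : CType} (σ : S R Γ Γ') (s : V R Γ (.lin A B)) (t : K R Γ Δ A) :
    ps σ (lapp s t) = lapp (psV σ s) (ps σ t) := by
  revert σ s t
  dsimp only [K, V, S, S.comp, S.wk, svar, ps, psV, ss, res, cpsC, cpsV, cpsCtx, List.map_cons, lapp]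
  intros
  simp

@[simp] theorem ss_lapp {Δ : Option CType} {A B : CType} {X : CType} (s : V R Γ (.lin A B)) (t : K R Γ (some X) A) (e : K R Γ Δ X) :
    ss (lapp s t) e = lapp s (ss t e) := by
  revert s t e
  dsimp only [K, V, S, S.comp, S.wk, svar, ps, psV, ss, res, cpsC, cpsV, cpsCtx, List.map_cons, lapp]
  intros
  simp [Q.ss_ss]

end EEC.Dual

namespace EEC.Dual

variable {R : CType} {Γ Γ' : List VType} {Δ : Option CType}

/-! ### β and η for the dual structure -/

theorem unit_uniq (t : V R Γ .unit) :
    t = unit :=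
  Q.unit_uniq t

@[simp] theorem vfst_vpair {A B : VType} (t : V R Γ A) (u : V R Γ B) :
    vfst (vpair t u) = t := by
  revert t u
  dsimp only [K, V, S, S.comp, S.wk, svar, ps, psV, ss, res, cpsC, cpsV, cpsCtx, List.map_cons, vpair, vfst]
  intros
  simp

@[simp] theorem vsnd_vpair {A B : VType} (t : V R Γ A) (u : V R Γ B) :
    vsnd (vpair t u) = u := by
  revert t u
  dsimp only [K, V, S, S.comp, S.wk, svar, ps, psV, ss, res, cpsC, cpsV, cpsCtx, List.map_cons, vpair, vsnd]
  intros
  simp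

@[simp] theorem vpair_eta {A B : VType} (t : V R Γ (.prod A B)) :
    vpair (vfst t) (vsnd t) = t := by
  revert t
  dsimp only [K, V, S, S.comp, S.wk, svar, ps, psV, ss, res, cpsC, cpsV, cpsCtx, List.map_cons, vpair, vfst, vsnd]
  intros
  simp

@[simp] theorem vapp_vlam {A B : VType} (t : V R (A :: Γ) B) (u : V R Γ A) :
    vapp (vlam t) u = psV (.cons u .id) t :=
  Q.vapp_vlam (A := cpsV R A) t u

@[simp] theorem vlam_eta {A B : VType} (t : V R Γ (.arr A B)) :
    vlam (vapp (psV .wk t) (var 0 rfl)) = t :=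
  Q.vlam_eta (A := cpsV R A) t

@[simp] theorem ofK_toK {B : CType} (t : V R Γ (.comp B)) :
    ofK (toK t) = t :=
  Q.llam_eta (A := cpsC R B) (B := R) t

@[simp] theorem toK_ofK {B : CType} (t : K R Γ none B) :
    toK (ofK t) = t := by
  revert t
  dsimp only [K, V, S, S.comp, S.wk, svar, ps, psV, ss, res, cpsC, cpsV, cpsCtx, List.map_cons, ofK, toK]
  intros
  simp

@[simp] theorem llam_eta {A B : CType} (t : V R Γ (.lin A B)) :
    llam (lapp t svar) = t := by
  revert t
  dsimp only [K, V, S, S.comp, S.wk, svar, ps, psV, ss, res, cpsC, cpsV, cpsCtx, List.map_cons, llam, lapp]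
  intros
  simp

@[simp] theorem lapp_llam {A B : CType} (t : K R Γ (some A) B) (u : K R Γ Δ A) :
    lapp (llam t) u = ss t u := by
  revert t u
  dsimp only [K, V, S, S.comp, S.wk, svar, ps, psV, ss, res, cpsC, cpsV, cpsCtx, List.map_cons, llam, lapp]
  intros
  simp

theorem cunit_uniq (t : K R Γ Δ .cunit) :
    t = cunit :=
  Q.czero_ext _ _

@[simp] theorem cfst_cpair {A B : CType} (t : K R Γ Δ A) (u : K R Γ Δ B) :
    cfst (cpair t u) = t := by
  revert t u
  dsimp only [K, V, S, S.comp, S.wk, svar, ps, psV, ss, res, cpsC, cpsV, cpsCtx, List.map_cons, cfst, cpair]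
  intros
  simp

@[simp] theorem csnd_cpair {A B : CType} (t : K R Γ Δ A) (u : K R Γ Δ B) :
    csnd (cpair t u) = u := by
  revert t u
  dsimp only [K, V, S, S.comp, S.wk, svar, ps, psV, ss, res, cpsC, cpsV, cpsCtx, List.map_cons, csnd, cpair]
  intros
  simp

@[simp] theorem cpair_eta {A B : CType} (t : K R Γ Δ (.cand A B)) :
    cpair (cfst t) (csnd t) = t :=
  (Q.csum_eta _ t).trans (Q.ss_svar_right t)

@[simp] theorem capp_clam {A : VType} {B : CType} (t : K R (A :: Γ) Δ B) (u : V R Γ A) :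
    capp (clam t) u = ps (.cons u .id) t := by
  revert t A u
  dsimp only [K, V, S, S.comp, S.wk, svar, ps, psV, ss, res, cpsC, cpsV, cpsCtx, List.map_cons, capp, clam, S.cons, S.id]
  intros
  simp

@[simp] theorem clam_eta {A : VType} {B : CType} (t : K R Γ Δ (.carr A B)) :
    clam (capp (ps .wk t) (var 0 rfl)) = t :=
  (Q.copow_eta _ t).trans (Q.ss_svar_right t)

@[simp] theorem ilet_top {A : CType} (t : K R Γ none A) :
    ilet top t = t :=
  Q.ss_svar_left (Δ := some (cpsC R A)) t

theorem ilet_eta {A : CType} (t : K R Γ Δ .iunit) (u : K R Γ (some .iunit) A) :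
    ilet t (ss u top) = ss u t :=
  congrArg (Q.ss t) (Q.ss_svar_left u)

@[simp] theorem banglet_bang {A : VType} {B : CType} (t : V R Γ A) (u : K R (A :: Γ) none B) :
    banglet (bang t) u = ps (.cons t .id) u := by
  revert t u A
  dsimp only [K, V, S, S.comp, S.wk, svar, ps, psV, ss, res, cpsC, cpsV, cpsCtx, List.map_cons, banglet, bang, S.cons, S.id]
  intros
  simp

theorem bang_eta {A : VType} {B : CType} (t : K R Γ Δ (.bang A)) (u : K R Γ (some (.bang A)) B) :
    banglet t (ss (ps .wk u) (bang (var 0 rfl))) = ss u t := by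
  revert t u
  dsimp only [K, V, S, S.comp, S.wk, svar, ps, psV, ss, res, cpsC, cpsV, cpsCtx, List.map_cons, banglet, bang, var]
  intros
  simp

@[simp] theorem copowlet_copow {A : VType} {B C : CType} (t : V R Γ A) (s : K R Γ Δ B)
    (u : K R (A :: Γ) (some B) C) :
    copowlet (copow t s) u = ss (ps (.cons t .id) u) s := by
  revert t s u A
  dsimp only [K, V, S, S.comp, S.wk, svar, ps, psV, ss, res, cpsC, cpsV, cpsCtx, List.map_cons, copowlet, copow, S.cons, S.id]
  intros
  simp [Q.ss_ss]

theorem copow_eta {A : VType} {B C : CType} (t : K R Γ Δ (.copow A B)) (u : K R Γ (some (.copow A B)) C) :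
    copowlet t (ss (ps .wk u) (copow (var 0 rfl) svar)) = ss u t := by
  revert t u
  dsimp only [K, V, S, S.comp, S.wk, svar, ps, psV, ss, res, cpsC, cpsV, cpsCtx, List.map_cons, copowlet, copow, var]
  intros
  simp

theorem czero_eta {A : CType} (t : K R Γ Δ .czero) (u : K R Γ (some .czero) A) :
    cimage A t = ss u t :=
  congrArg (Q.ss t) (Q.cunit_uniq u).symm

@[simp] theorem ccase_cinl {A B C : CType} (t : K R Γ Δ A) (u : K R Γ (some A) C) (u' : K R Γ (some B) C) :
    ccase (cinl t) u u' = ss u t := by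
  revert t u u'
  dsimp only [K, V, S, S.comp, S.wk, svar, ps, psV, ss, res, cpsC, cpsV, cpsCtx, List.map_cons, ccase, cinl]
  intros
  simp [Q.ss_ss]

@[simp] theorem ccase_cinr {A B C : CType} (t : K R Γ Δ B) (u : K R Γ (some A) C) (u' : K R Γ (some B) C) :
    ccase (cinr t) u u' = ss u' t := by
  revert t u u'
  dsimp only [K, V, S, S.comp, S.wk, svar, ps, psV, ss, res, cpsC, cpsV, cpsCtx, List.map_cons, ccase, cinr]
  intros
  simp [Q.ss_ss]

theorem csum_eta {A B C : CType} (t : K R Γ Δ (.csum A B)) (u : K R Γ (some (.csum A B)) C) :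
    ccase t (ss u (cinl svar)) (ss u (cinr svar)) = ss u t := by
  revert t u
  dsimp only [K, V, S, S.comp, S.wk, svar, ps, psV, ss, res, cpsC, cpsV, cpsCtx, List.map_cons, ccase, cinl, cinr]
  intros
  simp

end EEC.Dual

namespace EEC

open EEC.Dual

/-- The translation of a value derivation. -/
def FV (R : CType) {Γ : List VType} {t : Tm} {A : VType} (d : Deriv Γ none t A) : V R Γ A :=
  Q.mk (cps R d) ((cps_typed R).1 d)

/-- The translation of a computation derivation, as a map of continuations. -/
def FK (R : CType) {Γ : List VType} {Δ : Option CType} {t : Tm} {B : CType}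
    (d : Deriv Γ Δ t (.comp B)) : K R Γ Δ B :=
  match Δ, d with
  | none, d => toK (FV R d)
  | some _, d => Q.mk (cps R d) ((cps_typed R).2 d)

section Clauses

variable {R : CType} {Γ : List VType} {Δ : Option CType} {t u s : Tm}

theorem FK_none {B : CType} (d : Deriv Γ none t (.comp B)) : FK R d = toK (FV R d) := rfl

theorem FV_comp {B : CType} (d : Deriv Γ none t (.comp B)) : FV R d = ofK (FK R d) :=
  (ofK_toK _).symm

theorem FV_var (n : ℕ) {A : VType} (h : Γ[n]? = some A) : FV R (.var Γ n A h) = var n h := rfl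

theorem FK_svar {A : CType} : FK R (.svar Γ A) = svar := rfl

theorem FV_unit : FV R (.unit Γ) = unit := rfl

theorem FV_vpair {A B : VType} (d : Deriv Γ none t A) (e : Deriv Γ none u B) :
    FV R (.vpair _ _ _ _ _ d e) = vpair (FV R d) (FV R e) := rfl

theorem FV_vfst {A B : VType} (d : Deriv Γ none t (.prod A B)) :
    FV R (.vfst _ _ _ _ d) = vfst (FV R d) := rfl

theorem FV_vsnd {A B : VType} (d : Deriv Γ none t (.prod A B)) :
    FV R (.vsnd _ _ _ _ d) = vsnd (FV R d) := rfl

theorem FV_vlam {A B : VType} (d : Deriv (A :: Γ) none t B) :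
    FV R (.vlam _ _ _ _ d) = vlam (FV R d) := rfl

theorem FV_vapp {A B : VType} (d : Deriv Γ none s (.arr A B)) (e : Deriv Γ none t A) :
    FV R (.vapp _ _ _ _ _ d e) = vapp (FV R d) (FV R e) := rfl

theorem FV_llam {A B : CType} (d : Deriv Γ (some A) t (.comp B)) :
    FV R (.llam _ _ _ _ d) = llam (FK R d) := rfl

theorem FK_cunit : FK R (.cunit Γ Δ) = cunit := by
  cases Δ
  · exact toK_ofK (cunit)
  · rfl

theorem FK_top : FK R (.top Γ) = top := toK_ofK (top)

theorem FK_cpair {A B : CType} (d : Deriv Γ Δ t (.comp A)) (e : Deriv Γ Δ u (.comp B)) :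
    FK R (.cpair _ _ _ _ _ _ d e) = cpair (FK R d) (FK R e) := by
  cases Δ
  · exact toK_ofK (cpair (FK R d) (FK R e))
  · rfl

theorem lapp_eq_ss {Γ' : List VType} {A B C : CType} (f : Q Γ' none (.lin A C))
    (k : Q Γ' (some B) (.comp A)) :
    Q.lapp (Q.llam (Q.lapp f k)) .svar = Q.ss (Q.lapp f .svar) k := by simp

theorem toK_llam {A B : CType} (f : V R Γ (.comp A))
    (k : Q (cpsCtx R Γ) (some (cpsC R B)) (.comp (cpsC R A))) :
    toK (B := B) (Q.llam (B := R) (Q.lapp (A := cpsC R A) (B := R) f k)) = Q.ss (toK f) k :=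
  lapp_eq_ss (A := cpsC R A) (C := R) f k

theorem FK_cfst {A B : CType} (d : Deriv Γ Δ t (.comp (.cand A B))) :
    FK R (.cfst _ _ _ _ _ d) = cfst (FK R d) := by
  cases Δ
  · exact toK_llam (A := .cand A B) (B := A) (FV R d)
      (Q.cinl (A := cpsC R A) (B := cpsC R B) .svar)
  · rfl

theorem FK_csnd {A B : CType} (d : Deriv Γ Δ t (.comp (.cand A B))) :
    FK R (.csnd _ _ _ _ _ d) = csnd (FK R d) := by
  cases Δ
  · exact toK_llam (A := .cand A B) (B := B) (FV R d)
      (Q.cinr (A := cpsC R A) (B := cpsC R B) .svar)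
  · rfl

theorem FK_clam {A : VType} {B : CType} (d : Deriv (A :: Γ) Δ t (.comp B)) :
    FK R (.clam _ _ _ _ _ d) = clam (FK R d) := by
  cases Δ
  · exact toK_ofK (clam (FK R d))
  · rfl

theorem FK_capp {A : VType} {B : CType} (d : Deriv Γ Δ s (.comp (.carr A B)))
    (e : Deriv Γ none t A) : FK R (.capp _ _ _ _ _ _ d e) = capp (FK R d) (FV R e) := by
  cases Δ
  · exact toK_llam (A := .carr A B) (B := B) (FV R d)
      (Q.copow (A := cpsV R A) (B := cpsC R B) (FV R e) .svar)
  · rfl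

theorem FK_ilet {A : CType} (d : Deriv Γ Δ t (.comp .iunit)) (e : Deriv Γ none u (.comp A)) :
    FK R (.ilet _ _ _ _ _ d e) = ilet (FK R d) (FK R e) := by
  cases Δ
  · exact toK_llam (A := .iunit) (B := A) (FV R d)
      (FK R e)
  · rfl

theorem FK_bang {A : VType} (d : Deriv Γ none t A) : FK R (.bang _ _ _ d) = bang (FV R d) :=
  toK_ofK (bang (FV R d))

theorem FK_banglet {A : VType} {B : CType} (d : Deriv Γ Δ t (.comp (.bang A)))
    (e : Deriv (A :: Γ) none u (.comp B)) :
    FK R (.banglet _ _ _ _ _ _ d e) = banglet (FK R d) (FK R e) := by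
  cases Δ
  · exact toK_llam (A := .bang A) (B := B) (FV R d)
      (Q.clam (Γ := cpsCtx R Γ) (A := cpsV R A) (FK R e))
  · rfl

theorem FK_copow {A : VType} {B : CType} (d : Deriv Γ none t A) (e : Deriv Γ Δ u (.comp B)) :
    FK R (.copow _ _ _ _ _ _ d e) = copow (FV R d) (FK R e) := by
  cases Δ
  · exact toK_llam (A := B) (B := .copow A B) (FV R e)
      (Q.capp (A := cpsV R A) (B := cpsC R B) .svar (FV R d))
  · rfl

theorem FK_copowlet {A : VType} {B C : CType} (d : Deriv Γ Δ s (.comp (.copow A B)))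
    (e : Deriv (A :: Γ) (some B) t (.comp C)) :
    FK R (.copowlet _ _ _ _ _ _ _ d e) = copowlet (FK R d) (FK R e) := by
  cases Δ
  · exact toK_llam (A := .copow A B) (B := C) (FV R d)
      (Q.clam (Γ := cpsCtx R Γ) (A := cpsV R A) (FK R e))
  · rfl

theorem FK_cimage {A : CType} (d : Deriv Γ Δ t (.comp .czero)) :
    FK R (.cimage _ _ _ A d) = cimage A (FK R d) := by
  cases Δ
  · exact toK_llam (A := .czero) (B := A) (FV R d)
      Q.cunit
  · rfl

theorem FK_cinl {A B : CType} (d : Deriv Γ Δ t (.comp A)) :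
    FK R (.cinl _ _ _ A B d) = cinl (FK R d) := by
  cases Δ
  · exact toK_llam (A := A) (B := .csum A B) (FV R d)
      (Q.cfst (A := cpsC R A) (B := cpsC R B) .svar)
  · rfl

theorem FK_cinr {A B : CType} (d : Deriv Γ Δ t (.comp B)) :
    FK R (.cinr _ _ _ A B d) = cinr (FK R d) := by
  cases Δ
  · exact toK_llam (A := B) (B := .csum A B) (FV R d)
      (Q.csnd (A := cpsC R A) (B := cpsC R B) .svar)
  · rfl

theorem FK_ccase {A B C : CType} (d : Deriv Γ Δ s (.comp (.csum A B)))
    (e : Deriv Γ (some A) t (.comp C)) (e' : Deriv Γ (some B) u (.comp C)) :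
    FK R (.ccase _ _ _ _ _ _ _ _ d e e') = ccase (FK R d) (FK R e) (FK R e') := by
  cases Δ
  · exact toK_llam (A := .csum A B) (B := C) (FV R d)
      (Q.cpair (A := cpsC R A) (B := cpsC R B) (FK R e) (FK R e'))
  · rfl

theorem FK_lapp {A B : CType} (d : Deriv Γ none s (.lin A B)) (e : Deriv Γ Δ t (.comp A)) :
    FK R (.lapp _ _ _ _ _ _ d e) = lapp (FV R d) (FK R e) := by
  cases Δ
  · exact toK_llam (A := A) (B := B) (FV R e)
      (Q.lapp (A := cpsC R B) (B := cpsC R A) (FV R d) .svar)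
  · rfl

end Clauses

end EEC

namespace EEC

open EEC.Dual

/-- `x` is the translation of some derivation of the value judgement `Γ ⊢ t : A`. -/
def HasV (R : CType) (Γ : List VType) (t : Tm) {A : VType} (x : V R Γ A) : Prop :=
  ∃ d : Deriv Γ none t A, FV R d = x

/-- `x` is the translation of some derivation of the computation judgement `Γ | Δ ⊢ t : B`. -/
def HasK (R : CType) (Γ : List VType) (Δ : Option CType) (t : Tm) {B : CType} (x : K R Γ Δ B) :
    Prop :=
  ∃ d : Deriv Γ Δ t (.comp B), FK R d = x

section Intro

variable {R : CType} {Γ : List VType} {Δ : Option CType}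

theorem HasK.ofK {t : Tm} {B : CType} {x : K R Γ none B} (h : HasK R Γ none t x) :
    HasV R Γ t (ofK x) := by
  obtain ⟨d, rfl⟩ := h
  exact ⟨d, FV_comp d⟩

theorem HasV.toK {t : Tm} {B : CType} {x : V R Γ (.comp B)} (h : HasV R Γ t x) :
    HasK R Γ none t (toK x) := by
  obtain ⟨d, rfl⟩ := h
  exact ⟨d, FK_none d⟩

theorem HasV.var (n : ℕ) {A : VType} (h : Γ[n]? = some A) : HasV R Γ (.var n) (Dual.var n h) :=
  ⟨.var _ _ _ h, FV_var n h⟩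

theorem HasK.svar {A : CType} : HasK R Γ (some A) .svar (svar (A := A)) :=
  ⟨.svar _ _, FK_svar⟩

theorem HasV.unit :
    HasV R Γ .unit (Dual.unit (R := R) (Γ := Γ)) := by
  exact ⟨.unit _, FV_unit⟩

theorem HasV.vpair {A B : VType} {t u : Tm} {x : V R Γ A} {y : V R Γ B} (h1 : HasV R Γ t x) (h2 : HasV R Γ u y) :
    HasV R Γ (.vpair t u) (Dual.vpair x y) := by
  obtain ⟨d1, rfl⟩ := h1
  obtain ⟨d2, rfl⟩ := h2
  exact ⟨.vpair _ _ _ _ _ d1 d2, FV_vpair d1 d2⟩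

theorem HasV.vfst {A B : VType} {t : Tm} {x : V R Γ (.prod A B)} (h1 : HasV R Γ t x) :
    HasV R Γ (.vfst t) (Dual.vfst x) := by
  obtain ⟨d1, rfl⟩ := h1
  exact ⟨.vfst _ _ _ _ d1, FV_vfst d1⟩

theorem HasV.vsnd {A B : VType} {t : Tm} {x : V R Γ (.prod A B)} (h1 : HasV R Γ t x) :
    HasV R Γ (.vsnd t) (Dual.vsnd x) := by
  obtain ⟨d1, rfl⟩ := h1
  exact ⟨.vsnd _ _ _ _ d1, FV_vsnd d1⟩

theorem HasV.vlam {A B : VType} {t : Tm} {x : V R (A :: Γ) B} (h1 : HasV R (A :: Γ) t x) :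
    HasV R Γ (.vlam A t) (Dual.vlam x) := by
  obtain ⟨d1, rfl⟩ := h1
  exact ⟨.vlam _ _ _ _ d1, FV_vlam d1⟩

theorem HasV.vapp {A B : VType} {s t : Tm} {z : V R Γ (.arr A B)} {x : V R Γ A} (h1 : HasV R Γ s z) (h2 : HasV R Γ t x) :
    HasV R Γ (.vapp s t) (Dual.vapp z x) := by
  obtain ⟨d1, rfl⟩ := h1
  obtain ⟨d2, rfl⟩ := h2
  exact ⟨.vapp _ _ _ _ _ d1 d2, FV_vapp d1 d2⟩

theorem HasV.llam {A B : CType} {t : Tm} {x : K R Γ (some A) B} (h1 : HasK R Γ (some A) t x) :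
    HasV R Γ (.llam A t) (Dual.llam x) := by
  obtain ⟨d1, rfl⟩ := h1
  exact ⟨.llam _ _ _ _ d1, FV_llam d1⟩

theorem HasK.cunit :
    HasK R Γ Δ .cunit (Dual.cunit (R := R) (Γ := Γ) (Δ := Δ)) := by
  exact ⟨.cunit _ _, FK_cunit⟩

theorem HasK.cpair {A B : CType} {t u : Tm} {x : K R Γ Δ A} {y : K R Γ Δ B} (h1 : HasK R Γ Δ t x) (h2 : HasK R Γ Δ u y) :
    HasK R Γ Δ (.cpair t u) (Dual.cpair x y) := by
  obtain ⟨d1, rfl⟩ := h1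
  obtain ⟨d2, rfl⟩ := h2
  exact ⟨.cpair _ _ _ _ _ _ d1 d2, FK_cpair d1 d2⟩

theorem HasK.cfst {A B : CType} {t : Tm} {x : K R Γ Δ (.cand A B)} (h1 : HasK R Γ Δ t x) :
    HasK R Γ Δ (.cfst t) (Dual.cfst x) := by
  obtain ⟨d1, rfl⟩ := h1
  exact ⟨.cfst _ _ _ _ _ d1, FK_cfst d1⟩

theorem HasK.csnd {A B : CType} {t : Tm} {x : K R Γ Δ (.cand A B)} (h1 : HasK R Γ Δ t x) :
    HasK R Γ Δ (.csnd t) (Dual.csnd x) := by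
  obtain ⟨d1, rfl⟩ := h1
  exact ⟨.csnd _ _ _ _ _ d1, FK_csnd d1⟩

theorem HasK.clam {A : VType} {B : CType} {t : Tm} {x : K R (A :: Γ) Δ B} (h1 : HasK R (A :: Γ) Δ t x) :
    HasK R Γ Δ (.clam A t) (Dual.clam x) := by
  obtain ⟨d1, rfl⟩ := h1
  exact ⟨.clam _ _ _ _ _ d1, FK_clam d1⟩

theorem HasK.capp {A : VType} {B : CType} {s t : Tm} {z : K R Γ Δ (.carr A B)} {x : V R Γ A} (h1 : HasK R Γ Δ s z) (h2 : HasV R Γ t x) :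
    HasK R Γ Δ (.capp s t) (Dual.capp z x) := by
  obtain ⟨d1, rfl⟩ := h1
  obtain ⟨d2, rfl⟩ := h2
  exact ⟨.capp _ _ _ _ _ _ d1 d2, FK_capp d1 d2⟩

theorem HasK.top :
    HasK R Γ none .top (Dual.top (R := R) (Γ := Γ)) := by
  exact ⟨.top _, FK_top⟩

theorem HasK.ilet {A : CType} {t u : Tm} {x : K R Γ Δ .iunit} {y : K R Γ none A} (h1 : HasK R Γ Δ t x) (h2 : HasK R Γ none u y) :
    HasK R Γ Δ (.ilet t u) (Dual.ilet x y) := by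
  obtain ⟨d1, rfl⟩ := h1
  obtain ⟨d2, rfl⟩ := h2
  exact ⟨.ilet _ _ _ _ _ d1 d2, FK_ilet d1 d2⟩

theorem HasK.bang {A : VType} {t : Tm} {x : V R Γ A} (h1 : HasV R Γ t x) :
    HasK R Γ none (.bang t) (Dual.bang x) := by
  obtain ⟨d1, rfl⟩ := h1
  exact ⟨.bang _ _ _ d1, FK_bang d1⟩

theorem HasK.banglet {A : VType} {B : CType} {t u : Tm} {x : K R Γ Δ (.bang A)} {y : K R (A :: Γ) none B} (h1 : HasK R Γ Δ t x) (h2 : HasK R (A :: Γ) none u y) :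
    HasK R Γ Δ (.banglet t u) (Dual.banglet x y) := by
  obtain ⟨d1, rfl⟩ := h1
  obtain ⟨d2, rfl⟩ := h2
  exact ⟨.banglet _ _ _ _ _ _ d1 d2, FK_banglet d1 d2⟩

theorem HasK.copow {A : VType} {B : CType} {t u : Tm} {x : V R Γ A} {y : K R Γ Δ B} (h1 : HasV R Γ t x) (h2 : HasK R Γ Δ u y) :
    HasK R Γ Δ (.copow t u) (Dual.copow x y) := by
  obtain ⟨d1, rfl⟩ := h1
  obtain ⟨d2, rfl⟩ := h2
  exact ⟨.copow _ _ _ _ _ _ d1 d2, FK_copow d1 d2⟩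

theorem HasK.copowlet {A : VType} {B C : CType} {s t : Tm} {z : K R Γ Δ (.copow A B)} {x : K R (A :: Γ) (some B) C} (h1 : HasK R Γ Δ s z) (h2 : HasK R (A :: Γ) (some B) t x) :
    HasK R Γ Δ (.copowlet s t) (Dual.copowlet z x) := by
  obtain ⟨d1, rfl⟩ := h1
  obtain ⟨d2, rfl⟩ := h2
  exact ⟨.copowlet _ _ _ _ _ _ _ d1 d2, FK_copowlet d1 d2⟩

theorem HasK.cimage {A : CType} {t : Tm} {x : K R Γ Δ .czero} (h1 : HasK R Γ Δ t x) :
    HasK R Γ Δ (.cimage A t) (Dual.cimage A x) := by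
  obtain ⟨d1, rfl⟩ := h1
  exact ⟨.cimage _ _ _ _ d1, FK_cimage d1⟩

theorem HasK.cinl {A B : CType} {t : Tm} {x : K R Γ Δ A} (h1 : HasK R Γ Δ t x) :
    HasK R Γ Δ (.cinl t) (Dual.cinl (B := B) x) := by
  obtain ⟨d1, rfl⟩ := h1
  exact ⟨.cinl _ _ _ _ _ d1, FK_cinl d1⟩

theorem HasK.cinr {A B : CType} {t : Tm} {x : K R Γ Δ B} (h1 : HasK R Γ Δ t x) :
    HasK R Γ Δ (.cinr t) (Dual.cinr (A := A) x) := by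
  obtain ⟨d1, rfl⟩ := h1
  exact ⟨.cinr _ _ _ _ _ d1, FK_cinr d1⟩

theorem HasK.ccase {A B C : CType} {s t u : Tm} {z : K R Γ Δ (.csum A B)} {x : K R Γ (some A) C} {y : K R Γ (some B) C} (h1 : HasK R Γ Δ s z) (h2 : HasK R Γ (some A) t x) (h3 : HasK R Γ (some B) u y) :
    HasK R Γ Δ (.ccase s t u) (Dual.ccase z x y) := by
  obtain ⟨d1, rfl⟩ := h1
  obtain ⟨d2, rfl⟩ := h2
  obtain ⟨d3, rfl⟩ := h3
  exact ⟨.ccase _ _ _ _ _ _ _ _ d1 d2 d3, FK_ccase d1 d2 d3⟩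

theorem HasK.lapp {A B : CType} {s t : Tm} {z : V R Γ (.lin A B)} {x : K R Γ Δ A} (h1 : HasV R Γ s z) (h2 : HasK R Γ Δ t x) :
    HasK R Γ Δ (.lapp s t) (Dual.lapp z x) := by
  obtain ⟨d1, rfl⟩ := h1
  obtain ⟨d2, rfl⟩ := h2
  exact ⟨.lapp _ _ _ _ _ _ d1 d2, FK_lapp d1 d2⟩

end Intro

/-- Substitution of value variables is translated to substitution. -/
theorem Has_psubst_of {R : CType} (P : ∀ {Γ Γ' : List VType}, (ℕ → Tm) → S R Γ Γ' → Prop)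
    (lift : ∀ {Γ Γ' : List VType} {σ : ℕ → Tm} {s : S R Γ Γ'} (A : VType), P σ s →
      P (Tm.liftS σ) (S.lift A s))
    (pt : ∀ {Γ Γ' : List VType} {σ : ℕ → Tm} {s : S R Γ Γ'}, P σ s →
      ∀ n A (h : Γ[n]? = some A), HasV R Γ' (σ n) (s.get n h)) :
    (∀ {Γ : List VType} {t : Tm} {A : VType} (d : Deriv Γ none t A), ∀ {Γ' : List VType}
      {σ : ℕ → Tm} {s : S R Γ Γ'}, P σ s → HasV R Γ' (Tm.psubst σ t) (psV s (FV R d))) ∧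
    (∀ {Γ : List VType} {Δ : Option CType} {t : Tm} {B : CType} (d : Deriv Γ Δ t (.comp B)),
      ∀ {Γ' : List VType} {σ : ℕ → Tm} {s : S R Γ Γ'}, P σ s →
      HasK R Γ' Δ (Tm.psubst σ t) (ps s (FK R d))) := by
  apply Deriv.vk
  case vk =>
    intro Γ t B d
    refine ⟨fun h Γ' σ s p => ?_, fun h Γ' σ s p => ?_⟩
    · simpa [FK_none] using (h p).toK
    · simpa [FV_comp] using (h p).ofK
  case var =>
    intro Γ n A h Γ' σ s p
    rw [FV_var, psV_var]
    exact pt p n A h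
  case svar =>
    intro Γ A Γ' σ s p
    exact .svar

  case unit =>
    intros
    rename_i _ _ _ p
    rw [FV_unit, ps_unit]
    exact .unit

  case vpair =>
    intros
    rename_i ih1 ih2 _ _ _ p
    rw [FV_vpair, ps_vpair]
    exact .vpair (ih1 p) (ih2 p)

  case vfst =>
    intros
    rename_i ih1 _ _ _ p
    rw [FV_vfst, ps_vfst]
    exact .vfst (ih1 p)

  case vsnd =>
    intros
    rename_i ih1 _ _ _ p
    rw [FV_vsnd, ps_vsnd]
    exact .vsnd (ih1 p)

  case vlam =>
    intros
    rename_i ih1 _ _ _ p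
    rw [FV_vlam, ps_vlam]
    exact .vlam (ih1 (lift _ p))

  case vapp =>
    intros
    rename_i ih1 ih2 _ _ _ p
    rw [FV_vapp, ps_vapp]
    exact .vapp (ih1 p) (ih2 p)

  case llam =>
    intros
    rename_i ih1 _ _ _ p
    rw [FV_llam, ps_llam]
    exact .llam (ih1 p)

  case cunit =>
    intros
    rename_i _ _ _ p
    rw [FK_cunit, ps_cunit]
    exact .cunit

  case cpair =>
    intros
    rename_i ih1 ih2 _ _ _ p
    rw [FK_cpair, ps_cpair]
    exact .cpair (ih1 p) (ih2 p)

  case cfst =>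
    intros
    rename_i ih1 _ _ _ p
    rw [FK_cfst, ps_cfst]
    exact .cfst (ih1 p)

  case csnd =>
    intros
    rename_i ih1 _ _ _ p
    rw [FK_csnd, ps_csnd]
    exact .csnd (ih1 p)

  case clam =>
    intros
    rename_i ih1 _ _ _ p
    rw [FK_clam, ps_clam]
    exact .clam (ih1 (lift _ p))

  case capp =>
    intros
    rename_i ih1 ih2 _ _ _ p
    rw [FK_capp, ps_capp]
    exact .capp (ih1 p) (ih2 p)

  case top =>
    intros
    rename_i _ _ _ p
    rw [FK_top, ps_top]
    exact .top

  case ilet =>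
    intros
    rename_i ih1 ih2 _ _ _ p
    rw [FK_ilet, ps_ilet]
    exact .ilet (ih1 p) (ih2 p)

  case bang =>
    intros
    rename_i ih1 _ _ _ p
    rw [FK_bang, ps_bang]
    exact .bang (ih1 p)

  case banglet =>
    intros
    rename_i ih1 ih2 _ _ _ p
    rw [FK_banglet, ps_banglet]
    exact .banglet (ih1 p) (ih2 (lift _ p))

  case copow =>
    intros
    rename_i ih1 ih2 _ _ _ p
    rw [FK_copow, ps_copow]
    exact .copow (ih1 p) (ih2 p)

  case copowlet =>
    intros
    rename_i ih1 ih2 _ _ _ p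
    rw [FK_copowlet, ps_copowlet]
    exact .copowlet (ih1 p) (ih2 (lift _ p))

  case cimage =>
    intros
    rename_i ih1 _ _ _ p
    rw [FK_cimage, ps_cimage]
    exact .cimage (ih1 p)

  case cinl =>
    intros
    rename_i ih1 _ _ _ p
    rw [FK_cinl, ps_cinl]
    exact .cinl (ih1 p)

  case cinr =>
    intros
    rename_i ih1 _ _ _ p
    rw [FK_cinr, ps_cinr]
    exact .cinr (ih1 p)

  case ccase =>
    intros
    rename_i ih1 ih2 ih3 _ _ _ p
    rw [FK_ccase, ps_ccase]
    exact .ccase (ih1 p) (ih2 p) (ih3 p)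

  case lapp =>
    intros
    rename_i ih1 ih2 _ _ _ p
    rw [FK_lapp, ps_lapp]
    exact .lapp (ih1 p) (ih2 p)

/-- `σ` is a raw substitution translated by `s`. -/
def HasS {R : CType} {Γ Γ' : List VType} (σ : ℕ → Tm) (s : S R Γ Γ') : Prop :=
  ∀ n A (h : Γ[n]? = some A), HasV R Γ' (σ n) (s.get n h)

/-- `σ` is a raw renaming translated by `s`. -/
def HasRen {R : CType} {Γ Γ' : List VType} (σ : ℕ → Tm) (s : S R Γ Γ') : Prop :=
  ∃ f : ℕ → ℕ, (σ = fun n => .var (f n)) ∧ ∀ n A (h : Γ[n]? = some A),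
    ∃ h' : Γ'[f n]? = some A, s.get n h = Dual.var (f n) h'

section Subst

variable {R : CType} {Γ Γ' : List VType}

theorem HasRen.hasS {σ : ℕ → Tm} {s : S R Γ Γ'} (h : HasRen σ s) : HasS σ s := by
  obtain ⟨f, rfl, h⟩ := h
  intro n A hn
  obtain ⟨h', e⟩ := h n A hn
  rw [e]
  exact .var _ _

theorem HasRen.lift {σ : ℕ → Tm} {s : S R Γ Γ'} (A : VType) (h : HasRen σ s) :
    HasRen (Tm.liftS σ) (S.lift A s) := by
  obtain ⟨f, rfl, h⟩ := h
  refine ⟨Tm.liftN f, funext fun n => by cases n <;> rfl, fun n B hn => ?_⟩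
  cases n with
  | zero =>
    obtain rfl : A = B := by simpa using hn
    exact ⟨rfl, rfl⟩
  | succ n =>
    obtain ⟨h', e⟩ := h n B (by simpa using hn)
    exact ⟨h', by rw [S.get_cons_succ, S.get_comp, e, psV_var, S.get_wk]; rfl⟩

theorem HasRen.wk {A : VType} : HasRen (fun n => .var (n + 1)) (S.wk (R := R) (Γ := Γ) (A := A)) :=
  ⟨Nat.succ, rfl, fun _ _ h => ⟨by simpa using h, S.get_wk _ h⟩⟩

theorem HasV.shift {t : Tm} {A B : VType} {x : V R Γ A} (h : HasV R Γ t x) :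
    HasV R (B :: Γ) (Tm.shift t) (psV .wk x) := by
  obtain ⟨d, rfl⟩ := h
  rw [Tm.shift, Tm.rename_eq_psubst]
  exact (Has_psubst_of (R := R) HasRen HasRen.lift HasRen.hasS).1 d HasRen.wk

theorem HasK.shift {Δ : Option CType} {t : Tm} {A : CType} {B : VType} {x : K R Γ Δ A}
    (h : HasK R Γ Δ t x) : HasK R (B :: Γ) Δ (Tm.shift t) (ps .wk x) := by
  obtain ⟨d, rfl⟩ := h
  rw [Tm.shift, Tm.rename_eq_psubst]
  exact (Has_psubst_of (R := R) HasRen HasRen.lift HasRen.hasS).2 d HasRen.wk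

theorem HasS.lift {σ : ℕ → Tm} {s : S R Γ Γ'} (A : VType) (h : HasS σ s) :
    HasS (Tm.liftS σ) (S.lift A s) := by
  intro n B hn
  cases n with
  | zero =>
    obtain rfl : A = B := by simpa using hn
    exact .var 0 rfl
  | succ n => exact (h n B (by simpa using hn)).shift

theorem HasS.single {u : Tm} {A : VType} {y : V R Γ A} (h : HasV R Γ u y) :
    HasS (Tm.single u) (S.cons y S.id) := by
  intro n B hn
  cases n with
  | zero =>
    obtain rfl : A = B := by simpa using hn
    exact h
  | succ n => exact .var n (by simpa using hn)

theorem HasV.psubst {σ : ℕ → Tm} {s : S R Γ Γ'} {t : Tm} {A : VType} {x : V R Γ A}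
    (h : HasV R Γ t x) (hσ : HasS σ s) : HasV R Γ' (Tm.psubst σ t) (psV s x) := by
  obtain ⟨d, rfl⟩ := h
  exact (Has_psubst_of (R := R) HasS HasS.lift fun h => h).1 d hσ

theorem HasK.psubst {σ : ℕ → Tm} {s : S R Γ Γ'} {Δ : Option CType} {t : Tm} {A : CType}
    {x : K R Γ Δ A} (h : HasK R Γ Δ t x) (hσ : HasS σ s) :
    HasK R Γ' Δ (Tm.psubst σ t) (ps s x) := by
  obtain ⟨d, rfl⟩ := h
  exact (Has_psubst_of (R := R) HasS HasS.lift fun h => h).2 d hσ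

theorem HasV.subst0 {t u : Tm} {A B : VType} {x : V R (A :: Γ) B} {y : V R Γ A}
    (h : HasV R (A :: Γ) t x) (hu : HasV R Γ u y) :
    HasV R Γ (Tm.subst0 u t) (psV (.cons y .id) x) := by
  rw [Tm.subst0_eq]
  exact h.psubst (.single hu)

theorem HasK.subst0 {Δ : Option CType} {t u : Tm} {A : VType} {B : CType} {x : K R (A :: Γ) Δ B}
    {y : V R Γ A} (h : HasK R (A :: Γ) Δ t x) (hu : HasV R Γ u y) :
    HasK R Γ Δ (Tm.subst0 u t) (ps (.cons y .id) x) := by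
  rw [Tm.subst0_eq]
  exact h.psubst (.single hu)

end Subst

/-- Substitution for the stoup variable is translated to composition. -/
theorem HasK.ssubst {R : CType} {Γ : List VType} {Δ : Option CType} {t u : Tm} {B C : CType}
    {x : K R Γ (some B) C} {y : K R Γ Δ B}
    (ht : HasK R Γ (some B) t x) (hu : HasK R Γ Δ u y) :
    HasK R Γ Δ (Tm.ssubst u t) (ss x y) := by
  obtain ⟨d, rfl⟩ := ht
  suffices main : (∀ {Γ : List VType} {t : Tm} {A : VType} (d : Deriv Γ none t A), True) ∧
      (∀ {Γ : List VType} {Δ' : Option CType} {t : Tm} {C : CType} (d : Deriv Γ Δ' t (.comp C)),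
        ∀ (B : CType) (e : Δ' = some B) {Δ : Option CType} {u : Tm} {y : K R Γ Δ B},
        HasK R Γ Δ u y → HasK R Γ Δ (Tm.ssubst u t) (ss (e ▸ FK R d) y)) from
    main.2 d B rfl hu
  apply Deriv.vk
  case vk =>
    intro Γ t B d
    refine ⟨fun _ B e => ?_, fun _ => trivial⟩
    cases e
  case unit => intros; trivial
  case vpair => intros; trivial
  case vfst => intros; trivial
  case vsnd => intros; trivial
  case vlam => intros; trivial
  case vapp => intros; trivial
  case llam => intros; trivial
  case cunit =>
    intros
    rename_i B e _ _ _ hu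
    cases e
    dsimp only
    rw [FK_cunit, ss_cunit, Tm.ssubst]
    exact .cunit
  case cpair =>
    intros
    rename_i d1 d2 ih1 ih2 B e _ _ _ hu
    cases e
    dsimp only
    rw [FK_cpair, ss_cpair, Tm.ssubst]
    exact .cpair (ih1 _ rfl hu) (ih2 _ rfl hu)
  case cfst =>
    intros
    rename_i d1 ih1 B e _ _ _ hu
    cases e
    dsimp only
    rw [FK_cfst, ss_cfst, Tm.ssubst]
    exact .cfst (ih1 _ rfl hu)
  case csnd =>
    intros
    rename_i d1 ih1 B e _ _ _ hu
    cases e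
    dsimp only
    rw [FK_csnd, ss_csnd, Tm.ssubst]
    exact .csnd (ih1 _ rfl hu)
  case clam =>
    intros
    rename_i d1 ih1 B e _ _ _ hu
    cases e
    dsimp only
    rw [FK_clam, ss_clam, Tm.ssubst]
    exact .clam (ih1 _ rfl hu.shift)
  case capp =>
    intros
    rename_i d1 d2 ih1 ih2 B e _ _ _ hu
    cases e
    dsimp only
    rw [FK_capp, ss_capp, Tm.ssubst, Tm.SFree.ssubst (d2.sfree rfl)]
    exact .capp (ih1 _ rfl hu) ⟨_, rfl⟩
  case top =>
    intros
    rename_i e _ _ _ _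
    cases e
  case ilet =>
    intros
    rename_i d1 d2 ih1 ih2 B e _ _ _ hu
    cases e
    dsimp only
    rw [FK_ilet, ss_ilet, Tm.ssubst, Tm.SFree.ssubst (d2.sfree rfl)]
    exact .ilet (ih1 _ rfl hu) ⟨_, rfl⟩
  case bang =>
    intros
    rename_i e _ _ _ _
    cases e
  case banglet =>
    intros
    rename_i d1 d2 ih1 ih2 B e _ _ _ hu
    cases e
    dsimp only
    rw [FK_banglet, ss_banglet, Tm.ssubst, Tm.SFree.ssubst (d2.sfree rfl)]
    exact .banglet (ih1 _ rfl hu) ⟨_, rfl⟩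
  case copow =>
    intros
    rename_i d1 d2 ih1 ih2 B e _ _ _ hu
    cases e
    dsimp only
    rw [FK_copow, ss_copow, Tm.ssubst, Tm.SFree.ssubst (d1.sfree rfl)]
    exact .copow ⟨_, rfl⟩ (ih2 _ rfl hu)
  case copowlet =>
    intros
    rename_i d1 d2 ih1 ih2 B e _ _ _ hu
    cases e
    dsimp only
    rw [FK_copowlet, ss_copowlet, Tm.ssubst]
    exact .copowlet (ih1 _ rfl hu) ⟨_, rfl⟩
  case cimage =>
    intros
    rename_i d1 ih1 B e _ _ _ hu
    cases e
    dsimp only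
    rw [FK_cimage, ss_cimage, Tm.ssubst]
    exact .cimage (ih1 _ rfl hu)
  case cinl =>
    intros
    rename_i d1 ih1 B e _ _ _ hu
    cases e
    dsimp only
    rw [FK_cinl, ss_cinl, Tm.ssubst]
    exact .cinl (ih1 _ rfl hu)
  case cinr =>
    intros
    rename_i d1 ih1 B e _ _ _ hu
    cases e
    dsimp only
    rw [FK_cinr, ss_cinr, Tm.ssubst]
    exact .cinr (ih1 _ rfl hu)
  case ccase =>
    intros
    rename_i d1 d2 d3 ih1 ih2 ih3 B e _ _ _ hu
    cases e
    dsimp only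
    rw [FK_ccase, ss_ccase, Tm.ssubst]
    exact .ccase (ih1 _ rfl hu) ⟨_, rfl⟩ ⟨_, rfl⟩
  case lapp =>
    intros
    rename_i d1 d2 ih1 ih2 B e _ _ _ hu
    cases e
    dsimp only
    rw [FK_lapp, ss_lapp, Tm.ssubst, Tm.SFree.ssubst (d1.sfree rfl)]
    exact .lapp ⟨_, rfl⟩ (ih2 _ rfl hu)
  case var => intros; trivial
  case svar =>
    intros
    rename_i e _ _ _ hu
    cases e
    dsimp only
    rw [FK_svar, ss_svar_left]
    exact hu

end EEC

namespace EEC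

open EEC.Dual

mutual
  /-- The order on value types generated by letting `0̲` be below every computation type,
  with domains of functions kept fixed. -/
  inductive VLe : VType → VType → Type
    | base (a : ℕ) : VLe (.base a) (.base a)
    | unit : VLe .unit .unit
    | prod {A A' B B' : VType} : VLe A A' → VLe B B' → VLe (.prod A B) (.prod A' B')
    | arr (A : VType) {B B' : VType} : VLe B B' → VLe (.arr A B) (.arr A B')
    | comp {A A' : CType} : CLe A A' → VLe (.comp A) (.comp A')
    | lin (A : CType) {B B' : CType} : CLe B B' → VLe (.lin A B) (.lin A B')
  /-- The order on computation types accompanying `VLe`. -/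
  inductive CLe : CType → CType → Type
    | zero (A : CType) : CLe .czero A
    | base (a : ℕ) : CLe (.base a) (.base a)
    | cunit : CLe .cunit .cunit
    | cand {A A' B B' : CType} : CLe A A' → CLe B B' → CLe (.cand A B) (.cand A' B')
    | carr (A : VType) {B B' : CType} : CLe B B' → CLe (.carr A B) (.carr A B')
    | iunit : CLe .iunit .iunit
    | bang {A A' : VType} : VLe A A' → CLe (.bang A) (.bang A')
    | copow {A A' : VType} {B B' : CType} : VLe A A' → CLe B B' → CLe (.copow A B) (.copow A' B')
    | csum {A A' B B' : CType} : CLe A A' → CLe B B' → CLe (.csum A B) (.csum A' B')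
end

mutual
  def VLe.refl : (A : VType) → VLe A A
    | .base a => .base a
    | .unit => .unit
    | .prod A B => .prod (VLe.refl A) (VLe.refl B)
    | .arr A B => .arr A (VLe.refl B)
    | .comp A => .comp (CLe.refl A)
    | .lin A B => .lin A (CLe.refl B)
  def CLe.refl : (A : CType) → CLe A A
    | .base a => .base a
    | .cunit => .cunit
    | .cand A B => .cand (CLe.refl A) (CLe.refl B)
    | .carr A B => .carr A (CLe.refl B)
    | .iunit => .iunit
    | .bang A => .bang (VLe.refl A)
    | .copow A B => .copow (VLe.refl A) (CLe.refl B)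
    | .czero => .zero _
    | .csum A B => .csum (CLe.refl A) (CLe.refl B)
end

mutual
  theorem VLe.eq : {A B : VType} → (h h' : VLe A B) → h = h'
    | _, _, .base _, .base _ => rfl
    | _, _, .unit, .unit => rfl
    | _, _, .prod h k, .prod h' k' => by rw [VLe.eq h h', VLe.eq k k']
    | _, _, .arr _ h, .arr _ h' => by rw [VLe.eq h h']
    | _, _, .comp h, .comp h' => by rw [CLe.eq h h']
    | _, _, .lin _ h, .lin _ h' => by rw [CLe.eq h h']
  theorem CLe.eq : {A B : CType} → (h h' : CLe A B) → h = h'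
    | _, _, .zero _, .zero _ => rfl
    | _, _, .base _, .base _ => rfl
    | _, _, .cunit, .cunit => rfl
    | _, _, .cand h k, .cand h' k' => by rw [CLe.eq h h', CLe.eq k k']
    | _, _, .carr _ h, .carr _ h' => by rw [CLe.eq h h']
    | _, _, .iunit, .iunit => rfl
    | _, _, .bang h, .bang h' => by rw [VLe.eq h h']
    | _, _, .copow h k, .copow h' k' => by rw [VLe.eq h h', CLe.eq k k']
    | _, _, .csum h k, .csum h' k' => by rw [CLe.eq h h', CLe.eq k k']
end

mutual
  /-- Least upper bounds of bounded pairs of value types. -/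
  theorem VLe.lub : {A B C D : VType} → VLe A C → VLe A D → VLe B C → VLe B D →
      ∃ M, Nonempty (VLe A M) ∧ Nonempty (VLe B M) ∧ Nonempty (VLe M C) ∧ Nonempty (VLe M D)
    | _, _, _, _, .base a, .base _, .base _, .base _ => ⟨_, ⟨.base a⟩, ⟨.base a⟩, ⟨.base a⟩, ⟨.base a⟩⟩
    | _, _, _, _, .unit, .unit, .unit, .unit => ⟨_, ⟨.unit⟩, ⟨.unit⟩, ⟨.unit⟩, ⟨.unit⟩⟩
    | _, _, _, _, .prod h1 k1, .prod h2 k2, .prod h3 k3, .prod h4 k4 => by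
      obtain ⟨_, ⟨a1⟩, ⟨a2⟩, ⟨a3⟩, ⟨a4⟩⟩ := VLe.lub h1 h2 h3 h4
      obtain ⟨_, ⟨b1⟩, ⟨b2⟩, ⟨b3⟩, ⟨b4⟩⟩ := VLe.lub k1 k2 k3 k4
      exact ⟨_, ⟨.prod a1 b1⟩, ⟨.prod a2 b2⟩, ⟨.prod a3 b3⟩, ⟨.prod a4 b4⟩⟩
    | _, _, _, _, .arr _ h1, .arr _ h2, .arr _ h3, .arr _ h4 => by
      obtain ⟨_, ⟨a1⟩, ⟨a2⟩, ⟨a3⟩, ⟨a4⟩⟩ := VLe.lub h1 h2 h3 h4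
      exact ⟨_, ⟨.arr _ a1⟩, ⟨.arr _ a2⟩, ⟨.arr _ a3⟩, ⟨.arr _ a4⟩⟩
    | _, _, _, _, .comp h1, .comp h2, .comp h3, .comp h4 => by
      obtain ⟨_, ⟨a1⟩, ⟨a2⟩, ⟨a3⟩, ⟨a4⟩⟩ := CLe.lub h1 h2 h3 h4
      exact ⟨_, ⟨.comp a1⟩, ⟨.comp a2⟩, ⟨.comp a3⟩, ⟨.comp a4⟩⟩
    | _, _, _, _, .lin _ h1, .lin _ h2, .lin _ h3, .lin _ h4 => by
      obtain ⟨_, ⟨a1⟩, ⟨a2⟩, ⟨a3⟩, ⟨a4⟩⟩ := CLe.lub h1 h2 h3 h4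
      exact ⟨_, ⟨.lin _ a1⟩, ⟨.lin _ a2⟩, ⟨.lin _ a3⟩, ⟨.lin _ a4⟩⟩
  /-- Least upper bounds of bounded pairs of computation types. -/
  theorem CLe.lub : {A B C D : CType} → CLe A C → CLe A D → CLe B C → CLe B D →
      ∃ M, Nonempty (CLe A M) ∧ Nonempty (CLe B M) ∧ Nonempty (CLe M C) ∧ Nonempty (CLe M D)
    | _, _, _, _, .zero _, .zero _, h, k => ⟨_, ⟨.zero _⟩, ⟨.refl _⟩, ⟨h⟩, ⟨k⟩⟩
    | _, _, _, _, h, k, .zero _, .zero _ => ⟨_, ⟨.refl _⟩, ⟨.zero _⟩, ⟨h⟩, ⟨k⟩⟩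
    | _, _, _, _, .base a, .base _, .base _, .base _ => ⟨_, ⟨.base a⟩, ⟨.base a⟩, ⟨.base a⟩, ⟨.base a⟩⟩
    | _, _, _, _, .cunit, .cunit, .cunit, .cunit => ⟨_, ⟨.cunit⟩, ⟨.cunit⟩, ⟨.cunit⟩, ⟨.cunit⟩⟩
    | _, _, _, _, .iunit, .iunit, .iunit, .iunit => ⟨_, ⟨.iunit⟩, ⟨.iunit⟩, ⟨.iunit⟩, ⟨.iunit⟩⟩
    | _, _, _, _, .cand h1 k1, .cand h2 k2, .cand h3 k3, .cand h4 k4 => by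
      obtain ⟨_, ⟨a1⟩, ⟨a2⟩, ⟨a3⟩, ⟨a4⟩⟩ := CLe.lub h1 h2 h3 h4
      obtain ⟨_, ⟨b1⟩, ⟨b2⟩, ⟨b3⟩, ⟨b4⟩⟩ := CLe.lub k1 k2 k3 k4
      exact ⟨_, ⟨.cand a1 b1⟩, ⟨.cand a2 b2⟩, ⟨.cand a3 b3⟩, ⟨.cand a4 b4⟩⟩
    | _, _, _, _, .carr _ h1, .carr _ h2, .carr _ h3, .carr _ h4 => by
      obtain ⟨_, ⟨a1⟩, ⟨a2⟩, ⟨a3⟩, ⟨a4⟩⟩ := CLe.lub h1 h2 h3 h4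
      exact ⟨_, ⟨.carr _ a1⟩, ⟨.carr _ a2⟩, ⟨.carr _ a3⟩, ⟨.carr _ a4⟩⟩
    | _, _, _, _, .bang h1, .bang h2, .bang h3, .bang h4 => by
      obtain ⟨_, ⟨a1⟩, ⟨a2⟩, ⟨a3⟩, ⟨a4⟩⟩ := VLe.lub h1 h2 h3 h4
      exact ⟨_, ⟨.bang a1⟩, ⟨.bang a2⟩, ⟨.bang a3⟩, ⟨.bang a4⟩⟩
    | _, _, _, _, .copow h1 k1, .copow h2 k2, .copow h3 k3, .copow h4 k4 => by
      obtain ⟨_, ⟨a1⟩, ⟨a2⟩, ⟨a3⟩, ⟨a4⟩⟩ := VLe.lub h1 h2 h3 h4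
      obtain ⟨_, ⟨b1⟩, ⟨b2⟩, ⟨b3⟩, ⟨b4⟩⟩ := CLe.lub k1 k2 k3 k4
      exact ⟨_, ⟨.copow a1 b1⟩, ⟨.copow a2 b2⟩, ⟨.copow a3 b3⟩, ⟨.copow a4 b4⟩⟩
    | _, _, _, _, .csum h1 k1, .csum h2 k2, .csum h3 k3, .csum h4 k4 => by
      obtain ⟨_, ⟨a1⟩, ⟨a2⟩, ⟨a3⟩, ⟨a4⟩⟩ := CLe.lub h1 h2 h3 h4
      obtain ⟨_, ⟨b1⟩, ⟨b2⟩, ⟨b3⟩, ⟨b4⟩⟩ := CLe.lub k1 k2 k3 k4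
      exact ⟨_, ⟨.csum a1 b1⟩, ⟨.csum a2 b2⟩, ⟨.csum a3 b3⟩, ⟨.csum a4 b4⟩⟩
end

mutual
  /-- The coercion along an inequality of value types. -/
  noncomputable def coeV (R : CType) : {A B : VType} → VLe A B → (Γ : List VType) → V R Γ A → V R Γ B
    | _, _, .base _, _, t => t
    | _, _, .unit, _, t => t
    | _, _, .prod h k, Γ, t => vpair (coeV R h Γ (vfst t)) (coeV R k Γ (vsnd t))
    | _, _, .arr A h, Γ, t => vlam (coeV R h (A :: Γ) (vapp (psV .wk t) (var 0 rfl)))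
    | _, _, .comp h, Γ, t => ofK (ss (coeC R h Γ) (toK t))
    | _, _, .lin _ h, Γ, t => llam (ss (coeC R h Γ) (lapp t svar))
  /-- The coercion along an inequality of computation types. -/
  noncomputable def coeC (R : CType) : {A B : CType} → CLe A B → (Γ : List VType) → K R Γ (some A) B
    | _, _, .zero A, _ => cimage A svar
    | _, _, .base _, _ => svar
    | _, _, .cunit, _ => svar
    | _, _, .cand h k, Γ => cpair (ss (coeC R h Γ) (cfst svar)) (ss (coeC R k Γ) (csnd svar))
    | _, _, .carr A h, Γ => clam (ss (coeC R h (A :: Γ)) (capp svar (var 0 rfl)))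
    | _, _, .iunit, _ => svar
    | _, _, .bang (A := A) h, Γ => banglet svar (bang (coeV R h (A :: Γ) (var 0 rfl)))
    | _, _, .copow (A := A) h k, Γ =>
      copowlet svar (copow (coeV R h (A :: Γ) (var 0 rfl)) (coeC R k (A :: Γ)))
    | _, _, .csum h k, Γ => ccase svar (cinl (coeC R h Γ)) (cinr (coeC R k Γ))
end

end EEC

namespace EEC

open EEC.Dual

namespace Dual

variable {R : CType} {Γ : List VType} {Δ : Option CType}

theorem ss_ilet_comm {A B : CType} (k : K R Γ (some A) B) (t : K R Γ Δ .iunit)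
    (u : K R Γ none A) : ss k (ilet t u) = ilet t (ss k u) := by
  revert k t u
  dsimp only [K, V, ss, res, cpsC, ilet]
  intros
  simp [Q.ss_ss]

theorem ss_banglet_comm {A : VType} {B C : CType} (k : K R Γ (some B) C) (t : K R Γ Δ (.bang A))
    (u : K R (A :: Γ) none B) : ss k (banglet t u) = banglet t (ss (ps .wk k) u) := by
  revert k t u
  dsimp only [K, V, S, S.wk, ps, ss, res, cpsC, cpsV, cpsCtx, List.map_cons, banglet]
  intros
  simp [Q.ss_ss]

theorem ss_copowlet_comm {A : VType} {B C D : CType} (k : K R Γ (some C) D)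
    (s : K R Γ Δ (.copow A B)) (t : K R (A :: Γ) (some B) C) :
    ss k (copowlet s t) = copowlet s (ss (ps .wk k) t) := by
  revert k s t
  dsimp only [K, V, S, S.wk, ps, ss, res, cpsC, cpsV, cpsCtx, List.map_cons, copowlet]
  intros
  simp [Q.ss_ss]

theorem ss_cimage_comm {A B : CType} (k : K R Γ (some A) B) (t : K R Γ Δ .czero) :
    ss k (cimage A t) = cimage B t := by
  revert k t
  dsimp only [K, V, ss, res, cpsC, cimage]
  intros
  simp [Q.ss_ss]

theorem ss_ccase_comm {A B C D : CType} (k : K R Γ (some C) D) (s : K R Γ Δ (.csum A B))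
    (t : K R Γ (some A) C) (u : K R Γ (some B) C) :
    ss k (ccase s t u) = ccase s (ss k t) (ss k u) := by
  revert k s t u
  dsimp only [K, V, ss, res, cpsC, ccase]
  intros
  simp [Q.ss_ss]

end Dual

section Coercions

variable {R : CType}

mutual
  theorem psV_coeV : {A B : VType} → (h : VLe A B) → {Γ Γ' : List VType} → (σ : S R Γ Γ') →
      (t : V R Γ A) → psV σ (coeV R h Γ t) = coeV R h Γ' (psV σ t)
    | _, _, .base _, _, _, _, _ => by simp only [coeV]
    | _, _, .unit, _, _, _, _ => by simp only [coeV]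
    | _, _, .prod h k, _, _, σ, t => by simp [coeV, psV_coeV h, psV_coeV k]
    | _, _, .arr A h, _, _, σ, t => by simp [coeV, psV_coeV h]
    | _, _, .comp h, _, _, σ, t => by simp [coeV, ps_coeC h]
    | _, _, .lin _ h, _, _, σ, t => by simp [coeV, ps_coeC h]
  theorem ps_coeC : {A B : CType} → (h : CLe A B) → {Γ Γ' : List VType} → (σ : S R Γ Γ') →
      ps σ (coeC R h Γ) = coeC R h Γ'
    | _, _, .zero _, _, _, _ => by simp [coeC]
    | _, _, .base _, _, _, _ => by simp [coeC]
    | _, _, .cunit, _, _, _ => by simp [coeC]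
    | _, _, .cand h k, _, _, σ => by simp [coeC, ps_coeC h, ps_coeC k]
    | _, _, .carr A h, _, _, σ => by simp [coeC, ps_coeC h]
    | _, _, .iunit, _, _, _ => by simp [coeC]
    | _, _, .bang h, _, _, σ => by simp [coeC, psV_coeV h]
    | _, _, .copow h k, _, _, σ => by simp [coeC, psV_coeV h, ps_coeC k]
    | _, _, .csum h k, _, _, σ => by simp [coeC, ps_coeC h, ps_coeC k]
end

mutual
  theorem coeV_refl : (A : VType) → {Γ : List VType} → (t : V R Γ A) → coeV R (.refl A) Γ t = t
    | .base _, _, _ => by simp only [VLe.refl, coeV]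
    | .unit, _, _ => by simp only [VLe.refl, coeV]
    | .prod A B, _, t => by simp [VLe.refl, coeV, coeV_refl A, coeV_refl B]
    | .arr A B, _, t => by simp [VLe.refl, coeV, coeV_refl B]
    | .comp A, _, t => by simp [VLe.refl, coeV, coeC_refl A]
    | .lin A B, _, t => by simp [VLe.refl, coeV, coeC_refl B]
  theorem coeC_refl : (A : CType) → {Γ : List VType} → coeC R (.refl A) Γ = svar
    | .base _, _ => by simp only [CLe.refl, coeC]
    | .cunit, _ => by simp only [CLe.refl, coeC]
    | .cand A B, _ => by simp [CLe.refl, coeC, coeC_refl A, coeC_refl B]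
    | .carr A B, _ => by simpa [CLe.refl, coeC, coeC_refl B] using clam_eta (svar (A := .carr A B))
    | .iunit, _ => by simp only [CLe.refl, coeC]
    | .bang A, _ => by
      simpa [CLe.refl, coeC, coeV_refl A] using bang_eta (svar (A := .bang A)) svar
    | .copow A B, _ => by
      simpa [CLe.refl, coeC, coeV_refl A, coeC_refl B] using copow_eta (svar (A := .copow A B)) svar
    | .czero, _ => by
      simpa [CLe.refl, coeC] using czero_eta (svar (A := .czero)) svar
    | .csum A B, _ => by
      simpa [CLe.refl, coeC, coeC_refl A, coeC_refl B] using csum_eta (svar (A := .csum A B)) svar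
end

mutual
  theorem coeV_trans : {A B C : VType} → (h : VLe A B) → (k : VLe B C) → (l : VLe A C) →
      {Γ : List VType} → (t : V R Γ A) → coeV R k Γ (coeV R h Γ t) = coeV R l Γ t
    | _, _, _, .base _, .base _, .base _, _, _ => by simp only [coeV]
    | _, _, _, .unit, .unit, .unit, _, _ => by simp only [coeV]
    | _, _, _, .prod h1 h2, .prod k1 k2, .prod l1 l2, _, _ => by
      simp [coeV, coeV_trans h1 k1 l1, coeV_trans h2 k2 l2]
    | _, _, _, .arr _ h1, .arr _ k1, .arr _ l1, _, _ => by
      simp [coeV, psV_coeV, coeV_trans h1 k1 l1]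
    | _, _, _, .comp h1, .comp k1, .comp l1, _, _ => by
      simp [coeV, ← ss_ss, coeC_trans h1 k1 l1]
    | _, _, _, .lin _ h1, .lin _ k1, .lin _ l1, _, _ => by
      simp [coeV, ← ss_ss, coeC_trans h1 k1 l1]
  theorem coeC_trans : {A B C : CType} → (h : CLe A B) → (k : CLe B C) → (l : CLe A C) →
      {Γ : List VType} → ss (coeC R k Γ) (coeC R h Γ) = coeC R l Γ
    | _, _, _, .zero _, k, .zero _, _ => by
      simpa [coeC] using (czero_eta svar (ss (coeC R k _) (cimage _ svar))).symm
    | _, _, _, .base _, .base _, .base _, _ => by simp [coeC]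
    | _, _, _, .cunit, .cunit, .cunit, _ => by simp [coeC]
    | _, _, _, .iunit, .iunit, .iunit, _ => by simp [coeC]
    | _, _, _, .cand h1 h2, .cand k1 k2, .cand l1 l2, _ => by
      simp [coeC, ss_ss, ← coeC_trans h1 k1 l1, ← coeC_trans h2 k2 l2]
    | _, _, _, .carr _ h1, .carr _ k1, .carr _ l1, _ => by
      simp [coeC, ss_ss, ← coeC_trans h1 k1 l1]
    | _, _, _, .bang h1, .bang k1, .bang l1, _ => by
      simp only [coeC, ss_banglet_comm]
      simp [psV_coeV, ← coeV_trans h1 k1 l1]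
    | _, _, _, .copow h1 h2, .copow k1 k2, .copow l1 l2, _ => by
      simp only [coeC, ss_copowlet_comm]
      simp [psV_coeV, ps_coeC, ← coeV_trans h1 k1 l1, ← coeC_trans h2 k2 l2]
    | _, _, _, .csum h1 h2, .csum k1 k2, .csum l1 l2, _ => by
      simp only [coeC, ss_ccase_comm]
      simp [← coeC_trans h1 k1 l1, ← coeC_trans h2 k2 l2]
end

end Coercions

end EEC

namespace EEC

open EEC.Dual

/-- The pointwise order on contexts. -/
inductive XLe : List VType → List VType → Type
  | nil : XLe [] []
  | cons {A A' : VType} {Γ Γ' : List VType} : VLe A A' → XLe Γ Γ' → XLe (A :: Γ) (A' :: Γ')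

/-- The pointwise order on stoups. -/
inductive OLe : Option CType → Option CType → Type
  | none : OLe none none
  | some {A A' : CType} : CLe A A' → OLe (some A) (some A')

def XLe.refl : (Γ : List VType) → XLe Γ Γ
  | [] => .nil
  | A :: Γ => .cons (.refl A) (XLe.refl Γ)

def OLe.refl : (Δ : Option CType) → OLe Δ Δ
  | .none => .none
  | .some A => .some (.refl A)

/-- The coercion substitution along an inequality of contexts. -/
noncomputable def XLe.sub (R : CType) : {Γ Γ' : List VType} → XLe Γ Γ' → S R Γ' Γ
  | _, _, .nil => .id
  | _, _, .cons h X => .cons (coeV R h _ (var 0 rfl)) ((XLe.sub R X).comp .wk)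

/-- Restriction along an inequality of stoups. -/
noncomputable def OLe.pull {R : CType} {Γ : List VType} {B : CType} : {Δ Δ' : Option CType} → OLe Δ Δ' →
    K R Γ Δ' B → K R Γ Δ B
  | _, _, .none, x => x
  | _, _, .some h, x => ss x (coeC R h Γ)

section Over

variable {R : CType}

theorem XLe.sub_refl : (Γ : List VType) → (XLe.refl Γ).sub R = .id
  | [] => rfl
  | A :: Γ => by simp [XLe.refl, XLe.sub, XLe.sub_refl Γ, coeV_refl]

theorem OLe.pull_refl {Γ : List VType} {B : CType} : (Δ : Option CType) → (x : K R Γ Δ B) →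
    (OLe.refl Δ).pull x = x
  | .none, _ => rfl
  | .some A, x => by simp [OLe.refl, OLe.pull, coeC_refl]

@[simp] theorem pull_none {Γ : List VType} {B : CType} (x : K R Γ none B) :
    OLe.none.pull x = x := rfl

@[simp] theorem pull_some {Γ : List VType} {A A' B : CType} (h : CLe A A')
    (x : K R Γ (some A') B) : (OLe.some h).pull x = ss x (coeC R h Γ) := rfl

theorem pull_ss {Γ : List VType} {Δ Δ' : Option CType} {A B : CType} (O : OLe Δ Δ')
    (k : K R Γ (some A) B) (x : K R Γ Δ' A) : O.pull (ss k x) = ss k (O.pull x) := by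
  cases O <;> simp [ss_ss]

/-- `x` restricts to the coercion of `s`. -/
def OverV {Γ Γ₁ : List VType} {M A : VType} (X : XLe Γ Γ₁) (h : VLe M A) (x : V R Γ₁ A)
    (s : V R Γ M) : Prop :=
  psV (X.sub R) x = coeV R h Γ s

/-- `x` restricts to the coercion of `s`. -/
def OverK {Γ Γ₁ : List VType} {Δ Δ₁ : Option CType} {M B : CType} (X : XLe Γ Γ₁) (O : OLe Δ Δ₁)
    (h : CLe M B) (x : K R Γ₁ Δ₁ B) (s : K R Γ Δ M) : Prop :=
  O.pull (ps (X.sub R) x) = ss (coeC R h Γ) s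

variable {Γ Γ₁ : List VType} {Δ Δ₁ : Option CType} {X : XLe Γ Γ₁} {O : OLe Δ Δ₁}

theorem OverV.toK {M B : CType} {h : CLe M B} {x : V R Γ₁ (.comp B)} {s : V R Γ (.comp M)}
    (H : OverV X (.comp h) x s) : OverK X .none h (toK x) (toK s) := by
  have := congrArg Dual.toK H
  simpa [coeV, OverK, OLe.pull] using this

theorem OverK.ofK {M B : CType} {h : CLe M B} {x : K R Γ₁ none B} {s : K R Γ none M}
    (H : OverK X .none h x s) : OverV X (.comp h) (ofK x) (ofK s) := by
  have : ps _ x = _ := H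
  simp [OverV, coeV, this]

/-- A computation over `0̲` may be composed with anything. -/
theorem OverK.elim_zero {A B : CType} {h : CLe .czero A} {x : K R Γ₁ Δ₁ A} {s : K R Γ Δ .czero}
    (H : OverK X O h x s) (k : K R Γ₁ (some A) B) : OverK X O (.zero B) (ss k x) s := by
  have e : O.pull (ps (X.sub R) (ss k x)) = ss (ps (X.sub R) k) (O.pull (ps (X.sub R) x)) := by
    rw [ps_ss, pull_ss]
  rw [OverK, e, H, ← ss_ss, coeC, czero_eta svar (ss (ps (X.sub R) k) (coeC R h Γ)), ss_svar_right]

theorem OverV.var : {Γ Γ₁ : List VType} → (X : XLe Γ Γ₁) → (n : ℕ) → {A : VType} →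
    (h : Γ₁[n]? = some A) → ∃ M, ∃ hM : Γ[n]? = some M, ∃ l : VLe M A,
      OverV X l (var (R := R) n h) (var n hM)
  | _, _, .cons (A := A) l X, 0, _, rfl => ⟨A, rfl, l, by simp [OverV, XLe.sub]⟩
  | _, _, .cons (A := C) _ X, n + 1, _, h => by
    obtain ⟨M, hM, l, H⟩ := OverV.var X n (by simpa using h)
    refine ⟨M, by simpa using hM, l, ?_⟩
    have H := congrArg (psV (.wk (A := C))) H
    simpa [OverV, XLe.sub, psV_coeV] using H

@[simp] theorem pull_cunit :
    O.pull (cunit : K R Γ Δ₁ .cunit) = cunit := by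
  cases O <;> simp [OLe.pull]

@[simp] theorem pull_cpair {A B : CType} (t : K R Γ Δ₁ A) (u : K R Γ Δ₁ B) :
    O.pull (cpair t u : K R Γ Δ₁ (.cand A B)) = cpair (O.pull t) (O.pull u) := by
  cases O <;> simp [OLe.pull]

@[simp] theorem pull_cfst {A B : CType} (t : K R Γ Δ₁ (.cand A B)) :
    O.pull (cfst t : K R Γ Δ₁ A) = cfst (O.pull t) := by
  cases O <;> simp [OLe.pull]

@[simp] theorem pull_csnd {A B : CType} (t : K R Γ Δ₁ (.cand A B)) :
    O.pull (csnd t : K R Γ Δ₁ B) = csnd (O.pull t) := by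
  cases O <;> simp [OLe.pull]

@[simp] theorem pull_clam {A : VType} {B : CType} (t : K R (A :: Γ) Δ₁ B) :
    O.pull (clam t : K R Γ Δ₁ (.carr A B)) = clam (O.pull t) := by
  cases O <;> simp [OLe.pull, ps_coeC]

@[simp] theorem pull_capp {A : VType} {B : CType} (s : K R Γ Δ₁ (.carr A B)) (t : V R Γ A) :
    O.pull (capp s t : K R Γ Δ₁ B) = capp (O.pull s) t := by
  cases O <;> simp [OLe.pull]

@[simp] theorem pull_ilet {A : CType} (t : K R Γ Δ₁ .iunit) (u : K R Γ none A) :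
    O.pull (ilet t u : K R Γ Δ₁ A) = ilet (O.pull t) u := by
  cases O <;> simp [OLe.pull]

@[simp] theorem pull_banglet {A : VType} {B : CType} (t : K R Γ Δ₁ (.bang A)) (u : K R (A :: Γ) none B) :
    O.pull (banglet t u : K R Γ Δ₁ B) = banglet (O.pull t) u := by
  cases O <;> simp [OLe.pull]

@[simp] theorem pull_copow {A : VType} {B : CType} (t : V R Γ A) (u : K R Γ Δ₁ B) :
    O.pull (copow t u : K R Γ Δ₁ (.copow A B)) = copow t (O.pull u) := by
  cases O <;> simp [OLe.pull]

@[simp] theorem pull_copowlet {A : VType} {B C : CType} (s : K R Γ Δ₁ (.copow A B)) (t : K R (A :: Γ) (some B) C) :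
    O.pull (copowlet s t : K R Γ Δ₁ C) = copowlet (O.pull s) t := by
  cases O <;> simp [OLe.pull]

@[simp] theorem pull_cimage (A : CType) (t : K R Γ Δ₁ .czero) :
    O.pull (cimage A t : K R Γ Δ₁ A) = cimage A (O.pull t) := by
  cases O <;> simp [OLe.pull]

@[simp] theorem pull_cinl {A B : CType} (t : K R Γ Δ₁ A) :
    O.pull (cinl (B := B) t : K R Γ Δ₁ (.csum A B)) = cinl (B := B) (O.pull t) := by
  cases O <;> simp [OLe.pull]

@[simp] theorem pull_cinr {A B : CType} (t : K R Γ Δ₁ B) :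
    O.pull (cinr (A := A) t : K R Γ Δ₁ (.csum A B)) = cinr (A := A) (O.pull t) := by
  cases O <;> simp [OLe.pull]

@[simp] theorem pull_ccase {A B C : CType} (s : K R Γ Δ₁ (.csum A B)) (t : K R Γ (some A) C) (u : K R Γ (some B) C) :
    O.pull (ccase s t u : K R Γ Δ₁ C) = ccase (O.pull s) t u := by
  cases O <;> simp [OLe.pull]

@[simp] theorem pull_lapp {A B : CType} (s : V R Γ (.lin A B)) (t : K R Γ Δ₁ A) :
    O.pull (lapp s t : K R Γ Δ₁ B) = lapp s (O.pull t) := by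
  cases O <;> simp [OLe.pull]

theorem banglet_banglet {A A' : VType} {B : CType} (s : K R Γ Δ (.bang A)) (w : V R (A :: Γ) A')
    (u : K R (A' :: Γ) none B) :
    banglet (banglet s (bang w)) u = banglet s (ps (.cons w .wk) u) := by
  have := ss_banglet_comm (banglet svar u) s (bang w)
  simpa using this

theorem copowlet_copowlet {A A' : VType} {B B' C : CType} (s : K R Γ Δ (.copow A B))
    (w : V R (A :: Γ) A') (e : K R (A :: Γ) (some B) B') (u : K R (A' :: Γ) (some B') C) :
    copowlet (copowlet s (copow w e)) u = copowlet s (ss (ps (.cons w .wk) u) e) := by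
  have := ss_copowlet_comm (copowlet svar u) s (copow w e)
  simpa using this

theorem ccase_ccase {A A' B B' C : CType} (s : K R Γ Δ (.csum A B)) (a : K R Γ (some A) A')
    (b : K R Γ (some B) B') (t : K R Γ (some A') C) (u : K R Γ (some B') C) :
    ccase (ccase s (cinl a) (cinr b)) t u = ccase s (ss t a) (ss u b) := by
  have := ss_ccase_comm (ccase svar t u) s (cinl a) (cinr b)
  simpa using this

end Over

end EEC

namespace EEC

open EEC.Dual

section Ops

variable {R : CType} {Γ Γ₁ : List VType} {Δ Δ₁ : Option CType} {X : XLe Γ Γ₁} {O : OLe Δ Δ₁}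

theorem OverV.vpair {M A N B : VType} {h : VLe M A} {k : VLe N B} {x : V R Γ₁ A} {y : V R Γ₁ B}
    {s : V R Γ M} {t : V R Γ N} (H : OverV X h x s) (H' : OverV X k y t) :
    OverV X (.prod h k) (vpair x y) (vpair s t) := by
  simp only [OverV] at *; simp [*, coeV]

theorem OverV.vfst {M A N B : VType} {h : VLe M A} {k : VLe N B} {x : V R Γ₁ (.prod A B)}
    {s : V R Γ (.prod M N)} (H : OverV X (.prod h k) x s) : OverV X h (vfst x) (vfst s) := by
  simp only [OverV] at *; simp [*, coeV]

theorem OverV.vsnd {M A N B : VType} {h : VLe M A} {k : VLe N B} {x : V R Γ₁ (.prod A B)}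
    {s : V R Γ (.prod M N)} (H : OverV X (.prod h k) x s) : OverV X k (vsnd x) (vsnd s) := by
  simp only [OverV] at *; simp [*, coeV]

theorem OverV.vlam {A M B : VType} {h : VLe M B} {x : V R (A :: Γ₁) B}
    {s : V R (A :: Γ) M} (H : OverV (.cons (.refl A) X) h x s) :
    OverV X (.arr A h) (vlam x) (vlam s) := by
  simp only [OverV, XLe.sub, coeV_refl] at *; simp [*, coeV]

theorem OverV.vapp {A M B N : VType} {h : VLe M B} {k : VLe N A} {x : V R Γ₁ (.arr A B)}
    {y : V R Γ₁ A} {s : V R Γ (.arr A M)} {t : V R Γ N} (H : OverV X (.arr A h) x s)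
    (H' : OverV X k y t) : OverV X h (vapp x y) (vapp s (coeV R k Γ t)) := by
  simp only [OverV] at *; simp [*, coeV, psV_coeV]

theorem OverV.llam {A M B : CType} {h : CLe M B} {x : K R Γ₁ (some A) B} {s : K R Γ (some A) M}
    (H : OverK X (.some (.refl A)) h x s) : OverV X (.lin A h) (llam x) (llam s) := by
  simp only [OverV, OverK, pull_some, coeC_refl, ss_svar_right] at *; simp [*, coeV]

theorem OverK.cpair {M A N B : CType} {h : CLe M A} {k : CLe N B} {x : K R Γ₁ Δ₁ A}
    {y : K R Γ₁ Δ₁ B} {s : K R Γ Δ M} {t : K R Γ Δ N} (H : OverK X O h x s) (H' : OverK X O k y t) :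
    OverK X O (.cand h k) (cpair x y) (cpair s t) := by
  simp only [OverK] at *
  simp [*, ss_ss, coeC]

theorem OverK.cfst {M A N B : CType} {h : CLe M A} {k : CLe N B} {x : K R Γ₁ Δ₁ (.cand A B)}
    {s : K R Γ Δ (.cand M N)} (H : OverK X O (.cand h k) x s) : OverK X O h (cfst x) (cfst s) := by
  simp only [OverK] at *; simp [*, ss_ss, coeC]

theorem OverK.csnd {M A N B : CType} {h : CLe M A} {k : CLe N B} {x : K R Γ₁ Δ₁ (.cand A B)}
    {s : K R Γ Δ (.cand M N)} (H : OverK X O (.cand h k) x s) : OverK X O k (csnd x) (csnd s) := by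
  simp only [OverK] at *; simp [*, ss_ss, coeC]

theorem OverK.clam {A : VType} {M B : CType} {h : CLe M B} {x : K R (A :: Γ₁) Δ₁ B}
    {s : K R (A :: Γ) Δ M} (H : OverK (.cons (.refl A) X) O h x s) :
    OverK X O (.carr A h) (clam x) (clam s) := by
  simp only [OverK, XLe.sub, coeV_refl] at *; simp [*, ss_ss, coeC]

theorem OverK.capp {A N : VType} {M B : CType} {h : CLe M B} {k : VLe N A}
    {x : K R Γ₁ Δ₁ (.carr A B)} {y : V R Γ₁ A} {s : K R Γ Δ (.carr A M)} {t : V R Γ N}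
    (H : OverK X O (.carr A h) x s) (H' : OverV X k y t) :
    OverK X O h (capp x y) (capp s (coeV R k Γ t)) := by
  simp only [OverV, OverK] at *; simp [*, ss_ss, coeC, ps_coeC]

theorem OverK.ilet {M A : CType} {h : CLe M A} {x : K R Γ₁ Δ₁ .iunit} {y : K R Γ₁ none A}
    {s : K R Γ Δ .iunit} {t : K R Γ none M} (H : OverK X O .iunit x s)
    (H' : OverK X .none h y t) : OverK X O h (ilet x y) (ilet s t) := by
  simp only [OverK, pull_none] at *; simp [*, coeC, ss_ilet_comm]

theorem OverK.bang {M A : VType} {h : VLe M A} {x : V R Γ₁ A} {s : V R Γ M} (H : OverV X h x s) :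
    OverK X .none (.bang h) (bang x) (bang s) := by
  simp only [OverK, OverV, OLe.pull] at *; simp [*, coeC, psV_coeV]

theorem OverK.banglet {M A : VType} {N B : CType} {h : VLe M A} {k : CLe N B}
    {x : K R Γ₁ Δ₁ (.bang A)} {y : K R (A :: Γ₁) none B} {s : K R Γ Δ (.bang M)}
    {t : K R (M :: Γ) none N} (H : OverK X O (.bang h) x s) (H' : OverK (.cons h X) .none k y t) :
    OverK X O k (banglet x y) (banglet s t) := by
  simp only [OverK, pull_none, XLe.sub] at *
  simp [*, coeC, ss_banglet_comm, banglet_banglet, ps_coeC]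

theorem OverK.copow {M A : VType} {N B : CType} {h : VLe M A} {k : CLe N B}
    {x : V R Γ₁ A} {y : K R Γ₁ Δ₁ B} {s : V R Γ M} {t : K R Γ Δ N} (H : OverV X h x s)
    (H' : OverK X O k y t) : OverK X O (.copow h k) (copow x y) (copow s t) := by
  simp only [OverK, OverV] at *
  simp [*, coeC, psV_coeV, ps_coeC]

theorem OverK.copowlet {M A : VType} {N B P C : CType} {h : VLe M A} {k : CLe N B} {l : CLe P C}
    {x : K R Γ₁ Δ₁ (.copow A B)} {y : K R (A :: Γ₁) (some B) C} {s : K R Γ Δ (.copow M N)}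
    {t : K R (M :: Γ) (some N) P} (H : OverK X O (.copow h k) x s)
    (H' : OverK (.cons h X) (.some k) l y t) : OverK X O l (copowlet x y) (copowlet s t) := by
  simp only [OverK, pull_some, XLe.sub] at *
  simp [*, coeC, ss_copowlet_comm, copowlet_copowlet, ps_coeC]

theorem OverK.cimage (A : CType) {h : CLe .czero .czero} {x : K R Γ₁ Δ₁ .czero}
    {s : K R Γ Δ .czero} (H : OverK X O h x s) :
    OverK X O (.refl A) (cimage A x) (cimage A s) := by
  rw [CLe.eq h (.refl _)] at H
  simp only [OverK, coeC_refl, ss_svar_left] at *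
  simp [*]

theorem OverK.cinl {M A N B : CType} {h : CLe M A} {k : CLe N B} {x : K R Γ₁ Δ₁ A}
    {s : K R Γ Δ M} (H : OverK X O h x s) :
    OverK X O (.csum h k) (cinl (B := B) x) (cinl (B := N) s) := by
  simp only [OverK] at *; simp [*, coeC]

theorem OverK.cinr {M A N B : CType} {h : CLe M A} {k : CLe N B} {x : K R Γ₁ Δ₁ B}
    {s : K R Γ Δ N} (H : OverK X O k x s) :
    OverK X O (.csum h k) (cinr (A := A) x) (cinr (A := M) s) := by
  simp only [OverK] at *; simp [*, coeC]

theorem OverK.ccase {M A N B P C : CType} {h : CLe M A} {k : CLe N B} {l : CLe P C}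
    {x : K R Γ₁ Δ₁ (.csum A B)} {y : K R Γ₁ (some A) C} {z : K R Γ₁ (some B) C}
    {s : K R Γ Δ (.csum M N)} {t : K R Γ (some M) P} {u : K R Γ (some N) P}
    (H : OverK X O (.csum h k) x s) (H' : OverK X (.some h) l y t) (H'' : OverK X (.some k) l z u) :
    OverK X O l (ccase x y z) (ccase s t u) := by
  simp only [OverK, pull_some] at *
  simp [*, coeC, ss_ccase_comm, ccase_ccase]

theorem OverK.lapp {A M B N : CType} {h : CLe M B} {k : CLe N A} {x : V R Γ₁ (.lin A B)}
    {y : K R Γ₁ Δ₁ A} {s : V R Γ (.lin A M)} {t : K R Γ Δ N} (H : OverV X (.lin A h) x s)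
    (H' : OverK X O k y t) : OverK X O h (lapp x y) (lapp s (ss (coeC R k Γ) t)) := by
  simp only [OverV, OverK] at *; simp [*, coeV, ss_ss, pull_ss]

/-- A computation may be coerced before comparing. -/
theorem OverK.coe {M N B : CType} {h : CLe M B} {x : K R Γ₁ Δ₁ B} {s : K R Γ Δ M}
    (H : OverK X O h x s) (k : CLe M N) (l : CLe N B) : OverK X O l x (ss (coeC R k Γ) s) := by
  rw [OverK, ← ss_ss, coeC_trans k l h]
  exact H

end Ops

end EEC

namespace EEC

open EEC.Dual

/-- `x₁` and `x₂` both restrict to coercions of a common term. -/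
def SpanV {R : CType} {Γ Γ₁ Γ₂ : List VType} {A₁ A₂ : VType} (X₁ : XLe Γ Γ₁) (X₂ : XLe Γ Γ₂)
    (x₁ : V R Γ₁ A₁) (x₂ : V R Γ₂ A₂) : Prop :=
  ∃ M, ∃ h₁ : VLe M A₁, ∃ h₂ : VLe M A₂, ∃ s : V R Γ M, OverV X₁ h₁ x₁ s ∧ OverV X₂ h₂ x₂ s

/-- `x₁` and `x₂` both restrict to coercions of a common term. -/
def SpanK {R : CType} {Γ Γ₁ Γ₂ : List VType} {Δ Δ₁ Δ₂ : Option CType} {B₁ B₂ : CType}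
    (X₁ : XLe Γ Γ₁) (X₂ : XLe Γ Γ₂) (O₁ : OLe Δ Δ₁) (O₂ : OLe Δ Δ₂)
    (x₁ : K R Γ₁ Δ₁ B₁) (x₂ : K R Γ₂ Δ₂ B₂) : Prop :=
  ∃ M, ∃ h₁ : CLe M B₁, ∃ h₂ : CLe M B₂, ∃ s : K R Γ Δ M, OverK X₁ O₁ h₁ x₁ s ∧ OverK X₂ O₂ h₂ x₂ s

/-- Any two derivations for the same raw term have translations restricting to a common term. -/
theorem span (R : CType) :
    (∀ {Γ₁ : List VType} {t : Tm} {A₁ : VType} (d₁ : Deriv Γ₁ none t A₁) {Γ Γ₂ : List VType}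
      {A₂ : VType} (d₂ : Deriv Γ₂ none t A₂) (X₁ : XLe Γ Γ₁) (X₂ : XLe Γ Γ₂),
      SpanV X₁ X₂ (FV R d₁) (FV R d₂)) ∧
    (∀ {Γ₁ : List VType} {Δ₁ : Option CType} {t : Tm} {B₁ : CType} (d₁ : Deriv Γ₁ Δ₁ t (.comp B₁))
      {Γ Γ₂ : List VType} {Δ Δ₂ : Option CType} {A₂ : VType} (d₂ : Deriv Γ₂ Δ₂ t A₂)
      (X₁ : XLe Γ Γ₁) (X₂ : XLe Γ Γ₂) (O₁ : OLe Δ Δ₁) (O₂ : OLe Δ Δ₂),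
      ∃ B₂, ∃ e : A₂ = .comp B₂, SpanK X₁ X₂ O₁ O₂ (FK R d₁) (FK R (e ▸ d₂))) := by
  apply Deriv.vk
  case vk =>
    intro Γ₁ t B₁ d₁
    constructor
    · intro H Γ Γ₂ Δ Δ₂ A₂ d₂ X₁ X₂ O₁ O₂
      cases O₁
      cases O₂
      obtain ⟨_, h₁, h₂, s, H₁, H₂⟩ := H d₂ X₁ X₂
      cases h₁
      cases h₂
      exact ⟨_, rfl, _, _, _, _, H₁.toK, H₂.toK⟩
    · intro H Γ Γ₂ A₂ d₂ X₁ X₂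
      obtain ⟨_, rfl, _, h₁, h₂, s, H₁, H₂⟩ := H d₂ X₁ X₂ .none .none
      rw [FV_comp, FV_comp]
      exact ⟨_, _, _, _, H₁.ofK, H₂.ofK⟩
  case var =>
    intro Γ₁ n A₁ h Γ Γ₂ A₂ d₂ X₁ X₂
    cases d₂ with | var _ _ _ h' =>
    obtain ⟨M, hM, h₁, H₁⟩ := OverV.var (R := R) X₁ n h
    obtain ⟨M', hM', h₂, H₂⟩ := OverV.var (R := R) X₂ n h'
    cases hM.symm.trans hM'
    exact ⟨_, _, _, _, H₁, H₂⟩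
  case svar =>
    intro Γ₁ A Γ Γ₂ Δ Δ₂ A₂ d₂ X₁ X₂ O₁ O₂
    cases d₂
    cases O₁ with | some h₁ =>
    cases O₂ with | some h₂ =>
    refine ⟨_, rfl, _, h₁, h₂, svar, ?_, ?_⟩ <;> simp [OverK, FK_svar]
  case unit =>
    intro Γ₁ Γ Γ₂ A₂ d₂ X₁ X₂
    cases d₂
    exact ⟨_, .unit, .unit, unit, unit_uniq _, unit_uniq _⟩
  case vpair =>
    intro Γ₁ t u A B d d' ih ih' Γ Γ₂ A₂ d₂ X₁ X₂
    cases d₂ with | vpair _ _ _ _ _ e e' =>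
    obtain ⟨_, h₁, h₂, s, H₁, H₂⟩ := ih e X₁ X₂
    obtain ⟨_, h₁', h₂', s', H₁', H₂'⟩ := ih' e' X₁ X₂
    exact ⟨_, _, _, _, H₁.vpair H₁', H₂.vpair H₂'⟩
  case vfst =>
    intro Γ₁ t A B d ih Γ Γ₂ A₂ d₂ X₁ X₂
    cases d₂ with | vfst _ _ _ _ e =>
    obtain ⟨_, h₁, h₂, s, H₁, H₂⟩ := ih e X₁ X₂
    cases h₁
    cases h₂
    exact ⟨_, _, _, _, H₁.vfst, H₂.vfst⟩
  case vsnd =>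
    intro Γ₁ t A B d ih Γ Γ₂ A₂ d₂ X₁ X₂
    cases d₂ with | vsnd _ _ _ _ e =>
    obtain ⟨_, h₁, h₂, s, H₁, H₂⟩ := ih e X₁ X₂
    cases h₁
    cases h₂
    exact ⟨_, _, _, _, H₁.vsnd, H₂.vsnd⟩
  case vlam =>
    intro Γ₁ t A B d ih Γ Γ₂ A₂ d₂ X₁ X₂
    cases d₂ with | vlam _ _ _ _ e =>
    obtain ⟨_, h₁, h₂, s, H₁, H₂⟩ := ih e (.cons (.refl A) X₁) (.cons (.refl A) X₂)
    exact ⟨_, _, _, _, H₁.vlam, H₂.vlam⟩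
  case vapp =>
    intro Γ₁ s t A B d d' ih ih' Γ Γ₂ A₂ d₂ X₁ X₂
    cases d₂ with | vapp _ _ _ _ _ e e' =>
    obtain ⟨_, h₁, h₂, s, H₁, H₂⟩ := ih e X₁ X₂
    obtain ⟨_, h₁', h₂', s', H₁', H₂'⟩ := ih' e' X₁ X₂
    cases h₁
    cases h₂
    cases VLe.eq h₁' h₂'
    exact ⟨_, _, _, _, H₁.vapp H₁', H₂.vapp H₂'⟩
  case llam =>
    intro Γ₁ t A B d ih Γ Γ₂ A₂ d₂ X₁ X₂
    cases d₂ with | llam _ _ _ _ e =>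
    obtain ⟨_, ⟨⟩, _, h₁, h₂, s, H₁, H₂⟩ := ih e X₁ X₂ (.some (.refl A)) (.some (.refl A))
    exact ⟨_, _, _, _, OverV.llam H₁, OverV.llam H₂⟩
  case cunit =>
    intro Γ₁ Δ₁ Γ Γ₂ Δ Δ₂ A₂ d₂ X₁ X₂ O₁ O₂
    cases d₂
    exact ⟨_, rfl, _, .cunit, .cunit, cunit, (cunit_uniq _).trans (cunit_uniq _).symm,
      (cunit_uniq _).trans (cunit_uniq _).symm⟩
  case cpair =>
    intro Γ₁ Δ₁ t u A B d d' ih ih' Γ Γ₂ Δ Δ₂ A₂ d₂ X₁ X₂ O₁ O₂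
    cases d₂ with | cpair _ _ _ _ _ _ e e' =>
    obtain ⟨_, ⟨⟩, _, h₁, h₂, s, H₁, H₂⟩ := ih e X₁ X₂ O₁ O₂
    obtain ⟨_, ⟨⟩, _, h₁', h₂', s', H₁', H₂'⟩ := ih' e' X₁ X₂ O₁ O₂
    refine ⟨_, rfl, ?_⟩
    rw [FK_cpair, FK_cpair]
    exact ⟨_, _, _, _, H₁.cpair H₁', H₂.cpair H₂'⟩
  case cfst =>
    intro Γ₁ Δ₁ t A B d ih Γ Γ₂ Δ Δ₂ A₂ d₂ X₁ X₂ O₁ O₂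
    cases d₂ with | cfst _ _ _ _ _ e =>
    obtain ⟨_, ⟨⟩, _, h₁, h₂, s, H₁, H₂⟩ := ih e X₁ X₂ O₁ O₂
    refine ⟨_, rfl, ?_⟩
    rw [FK_cfst, FK_cfst]
    cases h₁
    · have H₁ := H₁.elim_zero (cfst svar)
      have H₂ := H₂.elim_zero (cfst svar)
      rw [ss_cfst, ss_svar_left] at H₁ H₂
      exact ⟨_, _, _, _, H₁, H₂⟩
    · cases h₂
      exact ⟨_, _, _, _, H₁.cfst, H₂.cfst⟩
  case csnd =>
    intro Γ₁ Δ₁ t A B d ih Γ Γ₂ Δ Δ₂ A₂ d₂ X₁ X₂ O₁ O₂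
    cases d₂ with | csnd _ _ _ _ _ e =>
    obtain ⟨_, ⟨⟩, _, h₁, h₂, s, H₁, H₂⟩ := ih e X₁ X₂ O₁ O₂
    refine ⟨_, rfl, ?_⟩
    rw [FK_csnd, FK_csnd]
    cases h₁
    · have H₁ := H₁.elim_zero (csnd svar)
      have H₂ := H₂.elim_zero (csnd svar)
      rw [ss_csnd, ss_svar_left] at H₁ H₂
      exact ⟨_, _, _, _, H₁, H₂⟩
    · cases h₂
      exact ⟨_, _, _, _, H₁.csnd, H₂.csnd⟩
  case clam =>
    intro Γ₁ Δ₁ t A B d ih Γ Γ₂ Δ Δ₂ A₂ d₂ X₁ X₂ O₁ O₂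
    cases d₂ with | clam _ _ _ _ _ e =>
    obtain ⟨_, ⟨⟩, _, h₁, h₂, s, H₁, H₂⟩ := ih e (.cons (.refl A) X₁) (.cons (.refl A) X₂) O₁ O₂
    refine ⟨_, rfl, ?_⟩
    rw [FK_clam, FK_clam]
    exact ⟨_, _, _, _, H₁.clam, H₂.clam⟩
  case capp =>
    intro Γ₁ Δ₁ s t A B d d' ih ih' Γ Γ₂ Δ Δ₂ A₂ d₂ X₁ X₂ O₁ O₂
    cases d₂ with | capp _ _ _ _ _ _ e e' =>
    obtain ⟨_, ⟨⟩, _, h₁, h₂, s, H₁, H₂⟩ := ih e X₁ X₂ O₁ O₂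
    obtain ⟨_, h₁', h₂', s', H₁', H₂'⟩ := ih' e' X₁ X₂
    refine ⟨_, rfl, ?_⟩
    rw [FK_capp, FK_capp]
    cases h₁
    · have H₁ := H₁.elim_zero (capp svar (FV R d'))
      have H₂ := H₂.elim_zero (capp svar (FV R e'))
      rw [ss_capp, ss_svar_left] at H₁ H₂
      exact ⟨_, _, _, _, H₁, H₂⟩
    · cases h₂
      cases VLe.eq h₁' h₂'
      exact ⟨_, _, _, _, H₁.capp H₁', H₂.capp H₂'⟩
  case top =>
    intro Γ₁ Γ Γ₂ Δ Δ₂ A₂ d₂ X₁ X₂ O₁ O₂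
    cases d₂
    cases O₁
    cases O₂
    refine ⟨_, rfl, _, .iunit, .iunit, top, ?_, ?_⟩ <;> simp [OverK, FK_top, coeC]
  case ilet =>
    intro Γ₁ Δ₁ t u A d d' ih ih' Γ Γ₂ Δ Δ₂ A₂ d₂ X₁ X₂ O₁ O₂
    cases d₂ with | ilet _ _ _ _ _ e e' =>
    obtain ⟨_, ⟨⟩, _, h₁, h₂, s, H₁, H₂⟩ := ih e X₁ X₂ O₁ O₂
    obtain ⟨_, ⟨⟩, _, h₁', h₂', s', H₁', H₂'⟩ := ih' e' X₁ X₂ .none .none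
    refine ⟨_, rfl, ?_⟩
    rw [FK_ilet, FK_ilet]
    cases h₁
    · have H₁ := H₁.elim_zero (ilet svar (FK R d'))
      have H₂ := H₂.elim_zero (ilet svar (FK R e'))
      rw [ss_ilet, ss_svar_left] at H₁ H₂
      exact ⟨_, _, _, _, H₁, H₂⟩
    · cases h₂
      exact ⟨_, _, _, _, H₁.ilet H₁', H₂.ilet H₂'⟩
  case bang =>
    intro Γ₁ t A d ih Γ Γ₂ Δ Δ₂ A₂ d₂ X₁ X₂ O₁ O₂
    cases d₂ with | bang _ _ _ e =>
    cases O₁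
    cases O₂
    obtain ⟨_, h₁, h₂, s, H₁, H₂⟩ := ih e X₁ X₂
    refine ⟨_, rfl, ?_⟩
    rw [FK_bang, FK_bang]
    exact ⟨_, _, _, _, OverK.bang H₁, OverK.bang H₂⟩
  case banglet =>
    intro Γ₁ Δ₁ t u A B d d' ih ih' Γ Γ₂ Δ Δ₂ A₂ d₂ X₁ X₂ O₁ O₂
    cases d₂ with | banglet _ _ _ _ _ _ e e' =>
    obtain ⟨_, ⟨⟩, _, h₁, h₂, s, H₁, H₂⟩ := ih e X₁ X₂ O₁ O₂
    refine ⟨_, rfl, ?_⟩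
    rw [FK_banglet, FK_banglet]
    cases h₁ with
    | zero =>
      have H₁ := H₁.elim_zero (banglet svar (FK R d'))
      have H₂ := H₂.elim_zero (banglet svar (FK R e'))
      rw [ss_banglet, ss_svar_left] at H₁ H₂
      exact ⟨_, _, _, _, H₁, H₂⟩
    | bang k₁ =>
      cases h₂ with | bang k₂ =>
      obtain ⟨_, ⟨⟩, _, h₁', h₂', s', H₁', H₂'⟩ := ih' e' (.cons k₁ X₁) (.cons k₂ X₂) .none .none
      exact ⟨_, _, _, _, H₁.banglet H₁', H₂.banglet H₂'⟩
  case copow =>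
    intro Γ₁ Δ₁ t u A B d d' ih ih' Γ Γ₂ Δ Δ₂ A₂ d₂ X₁ X₂ O₁ O₂
    cases d₂ with | copow _ _ _ _ _ _ e e' =>
    obtain ⟨_, h₁, h₂, s, H₁, H₂⟩ := ih e X₁ X₂
    obtain ⟨_, ⟨⟩, _, h₁', h₂', s', H₁', H₂'⟩ := ih' e' X₁ X₂ O₁ O₂
    refine ⟨_, rfl, ?_⟩
    rw [FK_copow, FK_copow]
    exact ⟨_, _, _, _, OverK.copow H₁ H₁', OverK.copow H₂ H₂'⟩
  case copowlet =>
    intro Γ₁ Δ₁ s t A B C d d' ih ih' Γ Γ₂ Δ Δ₂ A₂ d₂ X₁ X₂ O₁ O₂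
    cases d₂ with | copowlet _ _ _ _ _ _ _ e e' =>
    obtain ⟨_, ⟨⟩, _, h₁, h₂, s, H₁, H₂⟩ := ih e X₁ X₂ O₁ O₂
    refine ⟨_, rfl, ?_⟩
    rw [FK_copowlet, FK_copowlet]
    cases h₁ with
    | zero =>
      have H₁ := H₁.elim_zero (copowlet svar (FK R d'))
      have H₂ := H₂.elim_zero (copowlet svar (FK R e'))
      rw [ss_copowlet, ss_svar_left] at H₁ H₂
      exact ⟨_, _, _, _, H₁, H₂⟩
    | copow k₁ l₁ =>
      cases h₂ with | copow k₂ l₂ =>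
      obtain ⟨_, ⟨⟩, _, h₁', h₂', s', H₁', H₂'⟩ :=
        ih' e' (.cons k₁ X₁) (.cons k₂ X₂) (.some l₁) (.some l₂)
      exact ⟨_, _, _, _, H₁.copowlet H₁', H₂.copowlet H₂'⟩
  case cimage =>
    intro Γ₁ Δ₁ t A d ih Γ Γ₂ Δ Δ₂ A₂ d₂ X₁ X₂ O₁ O₂
    cases d₂ with | cimage _ _ _ _ e =>
    obtain ⟨_, ⟨⟩, _, h₁, h₂, s, H₁, H₂⟩ := ih e X₁ X₂ O₁ O₂
    refine ⟨_, rfl, ?_⟩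
    rw [FK_cimage, FK_cimage]
    cases h₁
    exact ⟨_, _, _, _, H₁.cimage A, H₂.cimage A⟩
  case cinl =>
    intro Γ₁ Δ₁ t A B d ih Γ Γ₂ Δ Δ₂ A₂ d₂ X₁ X₂ O₁ O₂
    cases d₂ with | cinl _ _ _ _ B' e =>
    obtain ⟨_, ⟨⟩, _, h₁, h₂, s, H₁, H₂⟩ := ih e X₁ X₂ O₁ O₂
    refine ⟨_, rfl, ?_⟩
    rw [FK_cinl, FK_cinl]
    exact ⟨_, _, _, _, H₁.cinl (k := .zero B), H₂.cinl (k := .zero B')⟩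
  case cinr =>
    intro Γ₁ Δ₁ t A B d ih Γ Γ₂ Δ Δ₂ A₂ d₂ X₁ X₂ O₁ O₂
    cases d₂ with | cinr _ _ _ A' _ e =>
    obtain ⟨_, ⟨⟩, _, h₁, h₂, s, H₁, H₂⟩ := ih e X₁ X₂ O₁ O₂
    refine ⟨_, rfl, ?_⟩
    rw [FK_cinr, FK_cinr]
    exact ⟨_, _, _, _, H₁.cinr (h := .zero A), H₂.cinr (h := .zero A')⟩
  case ccase =>
    intro Γ₁ Δ₁ s t u A B C d d' d'' ih ih' ih'' Γ Γ₂ Δ Δ₂ A₂ d₂ X₁ X₂ O₁ O₂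
    cases d₂ with | ccase _ _ _ _ _ _ _ _ e e' e'' =>
    obtain ⟨_, ⟨⟩, _, h₁, h₂, s, H₁, H₂⟩ := ih e X₁ X₂ O₁ O₂
    refine ⟨_, rfl, ?_⟩
    rw [FK_ccase, FK_ccase]
    cases h₁ with
    | zero =>
      have H₁ := H₁.elim_zero (ccase svar (FK R d') (FK R d''))
      have H₂ := H₂.elim_zero (ccase svar (FK R e') (FK R e''))
      rw [ss_ccase, ss_svar_left] at H₁ H₂
      exact ⟨_, _, _, _, H₁, H₂⟩
    | csum k₁ l₁ =>
      cases h₂ with | csum k₂ l₂ =>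
      obtain ⟨_, ⟨⟩, _, h₁', h₂', s', H₁', H₂'⟩ := ih' e' X₁ X₂ (.some k₁) (.some k₂)
      obtain ⟨_, ⟨⟩, _, h₁'', h₂'', s'', H₁'', H₂''⟩ := ih'' e'' X₁ X₂ (.some l₁) (.some l₂)
      obtain ⟨_, ⟨a⟩, ⟨b⟩, ⟨c⟩, ⟨c'⟩⟩ := CLe.lub h₁' h₂' h₁'' h₂''
      exact ⟨_, _, _, _, H₁.ccase (H₁'.coe a c) (H₁''.coe b c),
        H₂.ccase (H₂'.coe a c') (H₂''.coe b c')⟩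
  case lapp =>
    intro Γ₁ Δ₁ s t A B d d' ih ih' Γ Γ₂ Δ Δ₂ A₂ d₂ X₁ X₂ O₁ O₂
    cases d₂ with | lapp _ _ _ _ _ _ e e' =>
    obtain ⟨_, h₁, h₂, s, H₁, H₂⟩ := ih e X₁ X₂
    obtain ⟨_, ⟨⟩, _, h₁', h₂', s', H₁', H₂'⟩ := ih' e' X₁ X₂ O₁ O₂
    refine ⟨_, rfl, ?_⟩
    rw [FK_lapp, FK_lapp]
    cases h₁
    cases h₂
    cases CLe.eq h₁' h₂'
    exact ⟨_, _, _, _, OverK.lapp H₁ H₁', OverK.lapp H₂ H₂'⟩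

/-- The translation of a value term does not depend on its derivation. -/
theorem HasV.unique {R : CType} {Γ : List VType} {t : Tm} {A : VType} {x y : V R Γ A}
    (hx : HasV R Γ t x) (hy : HasV R Γ t y) : x = y := by
  obtain ⟨d, rfl⟩ := hx
  obtain ⟨e, rfl⟩ := hy
  obtain ⟨_, h₁, h₂, s, H₁, H₂⟩ := (span R).1 d e (.refl Γ) (.refl Γ)
  cases VLe.eq h₁ h₂
  simpa only [XLe.sub_refl, psV_id] using H₁.trans H₂.symm

/-- The translation of a computation term does not depend on its derivation. -/
theorem HasK.unique {R : CType} {Γ : List VType} {Δ : Option CType} {t : Tm} {B : CType}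
    {x y : K R Γ Δ B} (hx : HasK R Γ Δ t x) (hy : HasK R Γ Δ t y) : x = y := by
  obtain ⟨d, rfl⟩ := hx
  obtain ⟨e, rfl⟩ := hy
  obtain ⟨_, ⟨⟩, _, h₁, h₂, s, H₁, H₂⟩ := (span R).2 d e (.refl Γ) (.refl Γ) (.refl Δ) (.refl Δ)
  cases CLe.eq h₁ h₂
  simpa only [XLe.sub_refl, OLe.pull_refl, ps_id] using H₁.trans H₂.symm

end EEC

namespace EEC
open EEC.Dual

/-! ## Soundness of the self-translation -/

/-- Every typable term has a translation, as a value term. -/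
theorem Deriv.hasV (R : CType) {Γ : List VType} {t : Tm} {A : VType} (d : Deriv Γ none t A) :
    ∃ x : V R Γ A, HasV R Γ t x := ⟨_, d, rfl⟩

/-- Every typable term has a translation, as a computation term. -/
theorem Deriv.hasK (R : CType) {Γ : List VType} {Δ : Option CType} {t : Tm} {B : CType}
    (d : Deriv Γ Δ t (.comp B)) : ∃ x : K R Γ Δ B, HasK R Γ Δ t x := ⟨_, d, rfl⟩

/-- `t` and `u` have a common translation. -/
inductive SameTr (R : CType) : List VType → Option CType → Tm → Tm → VType → Prop
  | V {Γ : List VType} {t u : Tm} {A : VType} {x : V R Γ A} :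
      HasV R Γ t x → HasV R Γ u x → SameTr R Γ none t u A
  | K {Γ : List VType} {Δ : Option CType} {t u : Tm} {B : CType} {x : K R Γ Δ B} :
      HasK R Γ Δ t x → HasK R Γ Δ u x → SameTr R Γ Δ t u (.comp B)

variable {R : CType} {Γ : List VType} {Δ : Option CType} {t u : Tm}

theorem SameTr.v {A : VType} (h : SameTr R Γ none t u A) :
    ∃ x : Dual.V R Γ A, HasV R Γ t x ∧ HasV R Γ u x := by
  cases h with
  | V h k => exact ⟨_, h, k⟩
  | K h k => exact ⟨_, h.ofK, k.ofK⟩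

theorem SameTr.k {B : CType} (h : SameTr R Γ Δ t u (.comp B)) :
    ∃ x : Dual.K R Γ Δ B, HasK R Γ Δ t x ∧ HasK R Γ Δ u x := by
  cases h with
  | V h k => exact ⟨_, h.toK, k.toK⟩
  | K h k => exact ⟨_, h, k⟩

theorem SameTr.V_of {A : VType} {x y : Dual.V R Γ A} (h : HasV R Γ t x) (k : HasV R Γ u y)
    (e : x = y) : SameTr R Γ none t u A := .V h (e ▸ k)

theorem SameTr.K_of {B : CType} {x y : Dual.K R Γ Δ B} (h : HasK R Γ Δ t x) (k : HasK R Γ Δ u y)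
    (e : x = y) : SameTr R Γ Δ t u (.comp B) := .K h (e ▸ k)

/-- Provably equal terms have equal translations. -/
theorem EEq.sameTr {A : VType} (h : EEq Γ Δ t u A) : SameTr R Γ Δ t u A := by
  induction h with
  | @refl Γ Δ t A d =>
    obtain ⟨rfl⟩ | ⟨B, rfl⟩ : Δ = none ∨ ∃ B, A = .comp B := by
      cases d <;> simp
    · exact .V ⟨d, rfl⟩ ⟨d, rfl⟩
    · exact .K ⟨d, rfl⟩ ⟨d, rfl⟩
  | symm _ ih =>
    cases ih with
    | V h k => exact .V k h
    | K h k => exact .K k h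
  | trans _ _ i j =>
    cases i with
    | V h k =>
      obtain ⟨_, h', k'⟩ := j.v
      cases k.unique h'
      exact .V h k'
    | K h k =>
      obtain ⟨_, h', k'⟩ := j.k
      cases k.unique h'
      exact .K h k'
  | vpair_cong _ _ i0 i1 =>
    obtain ⟨_, p0, q0⟩ := i0.v
    obtain ⟨_, p1, q1⟩ := i1.v
    exact .V (HasV.vpair p0 p1) (HasV.vpair q0 q1)
  | vfst_cong _ i0 =>
    obtain ⟨_, p0, q0⟩ := i0.v
    exact .V (HasV.vfst p0) (HasV.vfst q0)
  | vsnd_cong _ i0 =>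
    obtain ⟨_, p0, q0⟩ := i0.v
    exact .V (HasV.vsnd p0) (HasV.vsnd q0)
  | vlam_cong _ i0 =>
    obtain ⟨_, p0, q0⟩ := i0.v
    exact .V (HasV.vlam p0) (HasV.vlam q0)
  | vapp_cong _ _ i0 i1 =>
    obtain ⟨_, p0, q0⟩ := i0.v
    obtain ⟨_, p1, q1⟩ := i1.v
    exact .V (HasV.vapp p0 p1) (HasV.vapp q0 q1)
  | cpair_cong _ _ i0 i1 =>
    obtain ⟨_, p0, q0⟩ := i0.k
    obtain ⟨_, p1, q1⟩ := i1.k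
    exact .K (HasK.cpair p0 p1) (HasK.cpair q0 q1)
  | cfst_cong _ i0 =>
    obtain ⟨_, p0, q0⟩ := i0.k
    exact .K (HasK.cfst p0) (HasK.cfst q0)
  | csnd_cong _ i0 =>
    obtain ⟨_, p0, q0⟩ := i0.k
    exact .K (HasK.csnd p0) (HasK.csnd q0)
  | clam_cong _ i0 =>
    obtain ⟨_, p0, q0⟩ := i0.k
    exact .K (HasK.clam p0) (HasK.clam q0)
  | capp_cong _ _ i0 i1 =>
    obtain ⟨_, p0, q0⟩ := i0.k
    obtain ⟨_, p1, q1⟩ := i1.v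
    exact .K (HasK.capp p0 p1) (HasK.capp q0 q1)
  | ilet_cong _ _ i0 i1 =>
    obtain ⟨_, p0, q0⟩ := i0.k
    obtain ⟨_, p1, q1⟩ := i1.k
    exact .K (HasK.ilet p0 p1) (HasK.ilet q0 q1)
  | bang_cong _ i0 =>
    obtain ⟨_, p0, q0⟩ := i0.v
    exact .K (HasK.bang p0) (HasK.bang q0)
  | banglet_cong _ _ i0 i1 =>
    obtain ⟨_, p0, q0⟩ := i0.k
    obtain ⟨_, p1, q1⟩ := i1.k
    exact .K (HasK.banglet p0 p1) (HasK.banglet q0 q1)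
  | copow_cong _ _ i0 i1 =>
    obtain ⟨_, p0, q0⟩ := i0.v
    obtain ⟨_, p1, q1⟩ := i1.k
    exact .K (HasK.copow p0 p1) (HasK.copow q0 q1)
  | copowlet_cong _ _ i0 i1 =>
    obtain ⟨_, p0, q0⟩ := i0.k
    obtain ⟨_, p1, q1⟩ := i1.k
    exact .K (HasK.copowlet p0 p1) (HasK.copowlet q0 q1)
  | cimage_cong _ i0 =>
    obtain ⟨_, p0, q0⟩ := i0.k
    exact .K (HasK.cimage p0) (HasK.cimage q0)
  | cinl_cong _ i0 =>
    obtain ⟨_, p0, q0⟩ := i0.k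
    exact .K (HasK.cinl p0) (HasK.cinl q0)
  | cinr_cong _ i0 =>
    obtain ⟨_, p0, q0⟩ := i0.k
    exact .K (HasK.cinr p0) (HasK.cinr q0)
  | ccase_cong _ _ _ i0 i1 i2 =>
    obtain ⟨_, p0, q0⟩ := i0.k
    obtain ⟨_, p1, q1⟩ := i1.k
    obtain ⟨_, p2, q2⟩ := i2.k
    exact .K (HasK.ccase p0 p1 p2) (HasK.ccase q0 q1 q2)
  | llam_cong _ i0 =>
    obtain ⟨_, p0, q0⟩ := i0.k
    exact .V (HasV.llam p0) (HasV.llam q0)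
  | lapp_cong _ _ i0 i1 =>
    obtain ⟨_, p0, q0⟩ := i0.v
    obtain ⟨_, p1, q1⟩ := i1.k
    exact .K (HasK.lapp p0 p1) (HasK.lapp q0 q1)
  | unit_eta d =>
    obtain ⟨x, h⟩ := d.hasV R
    exact .V_of h .unit (unit_uniq x)
  | vfst_beta d e =>
    obtain ⟨x, h⟩ := d.hasV R
    obtain ⟨y, k⟩ := e.hasV R
    exact .V_of (.vfst (.vpair h k)) h (vfst_vpair x y)
  | vsnd_beta d e =>
    obtain ⟨x, h⟩ := d.hasV R
    obtain ⟨y, k⟩ := e.hasV R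
    exact .V_of (.vsnd (.vpair h k)) k (vsnd_vpair x y)
  | vpair_eta d =>
    obtain ⟨x, h⟩ := d.hasV R
    exact .V_of (.vpair (.vfst h) (.vsnd h)) h (Dual.vpair_eta x)
  | vlam_beta d e =>
    obtain ⟨x, h⟩ := d.hasV R
    obtain ⟨y, k⟩ := e.hasV R
    exact .V_of (.vapp (.vlam h) k) (h.subst0 k) (vapp_vlam x y)
  | vlam_eta d =>
    obtain ⟨x, h⟩ := d.hasV R
    exact .V_of (.vlam (.vapp h.shift (.var 0 rfl))) h (Dual.vlam_eta x)
  | cunit_eta d =>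
    obtain ⟨x, h⟩ := d.hasK R
    exact .K_of h .cunit (cunit_uniq x)
  | cfst_beta d e =>
    obtain ⟨x, h⟩ := d.hasK R
    obtain ⟨y, k⟩ := e.hasK R
    exact .K_of (.cfst (.cpair h k)) h (cfst_cpair x y)
  | csnd_beta d e =>
    obtain ⟨x, h⟩ := d.hasK R
    obtain ⟨y, k⟩ := e.hasK R
    exact .K_of (.csnd (.cpair h k)) k (csnd_cpair x y)
  | cpair_eta d =>
    obtain ⟨x, h⟩ := d.hasK R
    exact .K_of (.cpair (.cfst h) (.csnd h)) h (Dual.cpair_eta x)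
  | clam_beta d e =>
    obtain ⟨x, h⟩ := d.hasK R
    obtain ⟨y, k⟩ := e.hasV R
    exact .K_of (.capp (.clam h) k) (h.subst0 k) (capp_clam x y)
  | clam_eta d =>
    obtain ⟨x, h⟩ := d.hasK R
    exact .K_of (.clam (.capp h.shift (.var 0 rfl))) h (Dual.clam_eta x)
  | ilet_beta d =>
    obtain ⟨x, h⟩ := d.hasK R
    exact .K_of (.ilet .top h) h (ilet_top x)
  | ilet_eta d e =>
    obtain ⟨x, h⟩ := d.hasK R
    obtain ⟨y, k⟩ := e.hasK R
    exact .K_of (.ilet h (k.ssubst .top)) (k.ssubst h) (Dual.ilet_eta x y)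
  | bang_beta d e =>
    obtain ⟨x, h⟩ := d.hasV R
    obtain ⟨y, k⟩ := e.hasK R
    exact .K_of (.banglet (.bang h) k) (k.subst0 h) (banglet_bang x y)
  | bang_eta d e =>
    obtain ⟨x, h⟩ := d.hasK R
    obtain ⟨y, k⟩ := e.hasK R
    exact .K_of (.banglet h (k.shift.ssubst (.bang (.var 0 rfl)))) (k.ssubst h) (Dual.bang_eta x y)
  | copow_beta d e f =>
    obtain ⟨x, h⟩ := d.hasV R
    obtain ⟨y, k⟩ := e.hasK R
    obtain ⟨z, l⟩ := f.hasK R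
    exact .K_of (.copowlet (.copow h k) l) ((l.subst0 h).ssubst k) (copowlet_copow x y z)
  | copow_eta d e =>
    obtain ⟨x, h⟩ := d.hasK R
    obtain ⟨y, k⟩ := e.hasK R
    exact .K_of (.copowlet h (k.shift.ssubst (.copow (.var 0 rfl) .svar))) (k.ssubst h)
      (Dual.copow_eta x y)
  | czero_eta d e =>
    obtain ⟨x, h⟩ := d.hasK R
    obtain ⟨y, k⟩ := e.hasK R
    exact .K_of (.cimage h) (k.ssubst h) (Dual.czero_eta x y)
  | csum_beta_inl d e f =>
    obtain ⟨x, h⟩ := d.hasK R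
    obtain ⟨y, k⟩ := e.hasK R
    obtain ⟨z, l⟩ := f.hasK R
    exact .K_of (.ccase (.cinl l) h k) (h.ssubst l) (ccase_cinl z x y)
  | csum_beta_inr d e f =>
    obtain ⟨x, h⟩ := d.hasK R
    obtain ⟨y, k⟩ := e.hasK R
    obtain ⟨z, l⟩ := f.hasK R
    exact .K_of (.ccase (.cinr l) h k) (k.ssubst l) (ccase_cinr z x y)
  | csum_eta d e =>
    obtain ⟨x, h⟩ := d.hasK R
    obtain ⟨y, k⟩ := e.hasK R
    exact .K_of (.ccase h (k.ssubst (.cinl .svar)) (k.ssubst (.cinr .svar))) (k.ssubst h)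
      (Dual.csum_eta x y)
  | llam_beta d e =>
    obtain ⟨x, h⟩ := d.hasK R
    obtain ⟨y, k⟩ := e.hasK R
    exact .K_of (.lapp (.llam h) k) (h.ssubst k) (lapp_llam x y)
  | llam_eta d =>
    obtain ⟨x, h⟩ := d.hasV R
    exact .V_of (.llam (.lapp h .svar)) h (Dual.llam_eta x)

end EEC

namespace EEC.Q

variable {Γ Γ' : List VType} {Δ : Option CType}

/-! ## Transport along equalities of computation types -/

/-- The stoup variable, with its type transported along an equality. -/
def tr {A B : CType} (h : A = B) : Q Γ (some A) (.comp B) := h ▸ svar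

@[simp] theorem tr_rfl {A : CType} : tr (Γ := Γ) (rfl : A = A) = svar := rfl

@[simp] theorem ps_tr {A B : CType} (h : A = B) (σ : Sub Γ Γ') : ps σ (tr h) = tr h := by
  subst h; simp

@[simp] theorem tr_tr {A B : CType} (h : A = B) (k : B = A) :
    ss (tr (Γ := Γ) h) (tr k) = svar := by
  subst h; simp

@[simp] theorem tr_tr_left {A B : CType} (h : A = B) (k : B = A) (t : Q Γ Δ (.comp B)) :
    ss (tr h) (ss (tr k) t) = t := by
  rw [← ss_ss, tr_tr, ss_svar_left]

/-- The generator of a type equal to `I̲`. -/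
def topI {I : CType} (h : I = .iunit) : Q Γ none (.comp I) := ss (tr h.symm) top

/-- The eliminator of a type equal to `I̲`. -/
def iletI {I A : CType} (h : I = .iunit) (t : Q Γ Δ (.comp I)) (u : Q Γ none (.comp A)) :
    Q Γ Δ (.comp A) := ilet (ss (tr h) t) u

section

variable {I A B X : CType} (h : I = .iunit)

@[simp] theorem ps_topI (σ : Sub Γ Γ') : ps σ (topI h) = topI h := by simp [topI]

@[simp] theorem ps_iletI (σ : Sub Γ Γ') (t : Q Γ Δ (.comp I)) (u : Q Γ none (.comp A)) :
    ps σ (iletI h t u) = iletI h (ps σ t) (ps σ u) := by simp [iletI]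

@[simp] theorem iletI_topI (u : Q Γ none (.comp A)) : iletI h (topI h) u = u := by
  simp [iletI, topI]

theorem iletI_eta (t : Q Γ Δ (.comp I)) (u : Q Γ (some I) (.comp A)) :
    iletI h t (ss u (topI h)) = ss u t := by
  subst h; simpa [iletI, topI] using ilet_eta t u

@[simp] theorem iletI_topI_right (t : Q Γ Δ (.comp I)) : iletI h t (topI h) = t := by
  simpa using iletI_eta h t svar

@[simp] theorem ss_iletI (t : Q Γ (some X) (.comp I)) (u : Q Γ none (.comp A))
    (w : Q Γ Δ (.comp X)) : ss (iletI h t u) w = iletI h (ss t w) u := by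
  simp [iletI, ss_ss]

@[simp] theorem ss_iletI_comm (k : Q Γ (some A) (.comp B)) (t : Q Γ Δ (.comp I))
    (u : Q Γ none (.comp A)) : ss k (iletI h t u) = iletI h t (ss k u) := by
  simp [iletI]

end

end EEC.Q

namespace EEC

open Q

mutual
  /-- Value types that are isomorphic by identifying a value type `I̲ ⊸ A̲` with `A̲` and a
  computation type `!A ⊗ I̲` with `!A`, for a type `I` equal to the monoidal unit. -/
  inductive IV (I : CType) : VType → VType → Type
    | base (a : ℕ) : IV I (.base a) (.base a)
    | unit : IV I .unit .unit
    | prod {A' A B' B : VType} : IV I A' A → IV I B' B → IV I (.prod A' B') (.prod A B)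
    | arr {A' A B' B : VType} : IV I A' A → IV I B' B → IV I (.arr A' B') (.arr A B)
    | comp {A' A : CType} : IC I A' A → IV I (.lin I A') (.comp A)
    | lin {A' A B' B : CType} : IC I A' A → IC I B' B → IV I (.lin A' B') (.lin A B)
  /-- Isomorphic computation types, accompanying `IV`. -/
  inductive IC (I : CType) : CType → CType → Type
    | eq {A' A : CType} : A' = A → IC I A' A
    | cand {A' A B' B : CType} : IC I A' A → IC I B' B → IC I (.cand A' B') (.cand A B)
    | carr {A' A : VType} {B' B : CType} : IV I A' A → IC I B' B → IC I (.carr A' B') (.carr A B)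
    | bang {A' A : VType} : IV I A' A → IC I (.copow A' I) (.bang A)
    | copow {A' A : VType} {B' B : CType} : IV I A' A → IC I B' B →
        IC I (.copow A' B') (.copow A B)
    | csum {A' A B' B : CType} : IC I A' A → IC I B' B → IC I (.csum A' B') (.csum A B)
end

mutual
  /-- The isomorphism between value types. -/
  noncomputable def IV.to {I : CType} (hI : I = .iunit) : {A' A : VType} → IV I A' A → (Γ : List VType) →
      Q Γ none A' → Q Γ none A
    | _, _, .base _, _, t => t
    | _, _, .unit, _, t => t
    | _, _, .prod a b, Γ, t => vpair (a.to hI Γ (vfst t)) (b.to hI Γ (vsnd t))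
    | _, _, .arr (A := A) a b, Γ, t =>
      vlam (b.to hI (A :: Γ) (vapp (ps .wk t) (a.inv hI (A :: Γ) (var 0 rfl))))
    | _, _, .comp a, Γ, t => ss (a.to hI Γ) (lapp t (topI hI))
    | _, _, .lin a b, Γ, t => llam (ss (b.to hI Γ) (lapp t (a.inv hI Γ)))
  /-- The inverse isomorphism between value types. -/
  noncomputable def IV.inv {I : CType} (hI : I = .iunit) : {A' A : VType} → IV I A' A → (Γ : List VType) →
      Q Γ none A → Q Γ none A'
    | _, _, .base _, _, t => t
    | _, _, .unit, _, t => t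
    | _, _, .prod a b, Γ, t => vpair (a.inv hI Γ (vfst t)) (b.inv hI Γ (vsnd t))
    | _, _, .arr (A' := A') a b, Γ, t =>
      vlam (b.inv hI (A' :: Γ) (vapp (ps .wk t) (a.to hI (A' :: Γ) (var 0 rfl))))
    | _, _, .comp a, Γ, t => llam (iletI hI svar (ss (a.inv hI Γ) t))
    | _, _, .lin a b, Γ, t => llam (ss (b.inv hI Γ) (lapp t (a.to hI Γ)))
  /-- The isomorphism between computation types. -/
  noncomputable def IC.to {I : CType} (hI : I = .iunit) : {A' A : CType} → IC I A' A → (Γ : List VType) →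
      Q Γ (some A') (.comp A)
    | _, _, .eq h, _ => tr h
    | _, _, .cand a b, Γ => cpair (ss (a.to hI Γ) (cfst svar)) (ss (b.to hI Γ) (csnd svar))
    | _, _, .carr (A := A) a b, Γ =>
      clam (ss (b.to hI (A :: Γ)) (capp svar (a.inv hI (A :: Γ) (var 0 rfl))))
    | _, _, .bang (A' := A') a, Γ =>
      copowlet svar (iletI hI svar (bang (a.to hI (A' :: Γ) (var 0 rfl))))
    | _, _, .copow (A' := A') a b, Γ =>
      copowlet svar (copow (a.to hI (A' :: Γ) (var 0 rfl)) (b.to hI (A' :: Γ)))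
    | _, _, .csum a b, Γ => ccase svar (cinl (a.to hI Γ)) (cinr (b.to hI Γ))
  /-- The inverse isomorphism between computation types. -/
  noncomputable def IC.inv {I : CType} (hI : I = .iunit) : {A' A : CType} → IC I A' A → (Γ : List VType) →
      Q Γ (some A) (.comp A')
    | _, _, .eq h, _ => tr h.symm
    | _, _, .cand a b, Γ => cpair (ss (a.inv hI Γ) (cfst svar)) (ss (b.inv hI Γ) (csnd svar))
    | _, _, .carr (A' := A') a b, Γ =>
      clam (ss (b.inv hI (A' :: Γ)) (capp svar (a.to hI (A' :: Γ) (var 0 rfl))))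
    | _, _, .bang (A := A) a, Γ =>
      banglet svar (copow (a.inv hI (A :: Γ) (var 0 rfl)) (topI hI))
    | _, _, .copow (A := A) a b, Γ =>
      copowlet svar (copow (a.inv hI (A :: Γ) (var 0 rfl)) (b.inv hI (A :: Γ)))
    | _, _, .csum a b, Γ => ccase svar (cinl (a.inv hI Γ)) (cinr (b.inv hI Γ))
end

variable {I : CType} (hI : I = .iunit)

mutual
  theorem IV.ps_to : {A' A : VType} → (a : IV I A' A) → {Γ Γ' : List VType} → (σ : Sub Γ Γ') →
      (t : Q Γ none A') → ps σ (a.to hI Γ t) = a.to hI Γ' (ps σ t)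
    | _, _, .base _, _, _, _, _ => by simp only [IV.to]
    | _, _, .unit, _, _, _, _ => by simp only [IV.to]
    | _, _, .prod a b, _, _, σ, t => by simp [IV.to, a.ps_to, b.ps_to]
    | _, _, .arr a b, _, _, σ, t => by simp [IV.to, b.ps_to, a.ps_inv]
    | _, _, .comp a, _, _, σ, t => by simp [IV.to, a.ps_to]
    | _, _, .lin a b, _, _, σ, t => by simp [IV.to, b.ps_to, a.ps_inv]
  theorem IV.ps_inv : {A' A : VType} → (a : IV I A' A) → {Γ Γ' : List VType} → (σ : Sub Γ Γ') →
      (t : Q Γ none A) → ps σ (a.inv hI Γ t) = a.inv hI Γ' (ps σ t)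
    | _, _, .base _, _, _, _, _ => by simp only [IV.inv]
    | _, _, .unit, _, _, _, _ => by simp only [IV.inv]
    | _, _, .prod a b, _, _, σ, t => by simp [IV.inv, a.ps_inv, b.ps_inv]
    | _, _, .arr a b, _, _, σ, t => by simp [IV.inv, b.ps_inv, a.ps_to]
    | _, _, .comp a, _, _, σ, t => by simp [IV.inv, a.ps_inv]
    | _, _, .lin a b, _, _, σ, t => by simp [IV.inv, b.ps_inv, a.ps_to]
  theorem IC.ps_to : {A' A : CType} → (a : IC I A' A) → {Γ Γ' : List VType} → (σ : Sub Γ Γ') →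
      ps σ (a.to hI Γ) = a.to hI Γ'
    | _, _, .eq h, _, _, σ => by simp [IC.to]
    | _, _, .cand a b, _, _, σ => by simp [IC.to, a.ps_to, b.ps_to]
    | _, _, .carr a b, _, _, σ => by simp [IC.to, a.ps_inv, b.ps_to]
    | _, _, .bang a, _, _, σ => by simp [IC.to, a.ps_to]
    | _, _, .copow a b, _, _, σ => by simp [IC.to, a.ps_to, b.ps_to]
    | _, _, .csum a b, _, _, σ => by simp [IC.to, a.ps_to, b.ps_to]
  theorem IC.ps_inv : {A' A : CType} → (a : IC I A' A) → {Γ Γ' : List VType} → (σ : Sub Γ Γ') →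
      ps σ (a.inv hI Γ) = a.inv hI Γ'
    | _, _, .eq h, _, _, σ => by simp [IC.inv]
    | _, _, .cand a b, _, _, σ => by simp [IC.inv, a.ps_inv, b.ps_inv]
    | _, _, .carr a b, _, _, σ => by simp [IC.inv, a.ps_to, b.ps_inv]
    | _, _, .bang a, _, _, σ => by simp [IC.inv, a.ps_inv]
    | _, _, .copow a b, _, _, σ => by simp [IC.inv, a.ps_inv, b.ps_inv]
    | _, _, .csum a b, _, _, σ => by simp [IC.inv, a.ps_inv, b.ps_inv]
end

attribute [simp] IV.ps_to IV.ps_inv IC.ps_to IC.ps_inv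

theorem ss_eq_of_eq_svar {Γ : List VType} {Δ : Option CType} {A B : CType}
    {k : Q Γ (some B) (.comp A)} {l : Q Γ (some A) (.comp B)} (h : ss k l = svar)
    (t : Q Γ Δ (.comp A)) : ss k (ss l t) = t := by
  rw [← ss_ss, h, ss_svar_left]

mutual
  theorem IV.to_inv : {A' A : VType} → (a : IV I A' A) → {Γ : List VType} →
      (t : Q Γ none A) → a.to hI Γ (a.inv hI Γ t) = t
    | _, _, .base _, _, _ => by simp only [IV.to, IV.inv]
    | _, _, .unit, _, _ => by simp only [IV.to, IV.inv]
    | _, _, .prod a b, _, t => by simp [IV.to, IV.inv, a.to_inv, b.to_inv]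
    | _, _, .arr a b, _, t => by simp [IV.to, IV.inv, b.to_inv, a.to_inv]
    | _, _, .comp a, _, t => by simp [IV.to, IV.inv, ss_eq_of_eq_svar a.to_inv]
    | _, _, .lin a b, _, t => by
      simp [IV.to, IV.inv, ss_ss, ss_eq_of_eq_svar b.to_inv, a.to_inv]
  theorem IV.inv_to : {A' A : VType} → (a : IV I A' A) → {Γ : List VType} →
      (t : Q Γ none A') → a.inv hI Γ (a.to hI Γ t) = t
    | _, _, .base _, _, _ => by simp only [IV.to, IV.inv]
    | _, _, .unit, _, _ => by simp only [IV.to, IV.inv]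
    | _, _, .prod a b, _, t => by simp [IV.to, IV.inv, a.inv_to, b.inv_to]
    | _, _, .arr a b, _, t => by simp [IV.to, IV.inv, b.inv_to, a.inv_to]
    | _, _, .comp a, _, t => by
      have := iletI_eta hI svar (lapp t svar)
      simp at this
      simp [IV.to, IV.inv, ss_eq_of_eq_svar a.inv_to, this]
    | _, _, .lin a b, _, t => by
      simp [IV.to, IV.inv, ss_ss, ss_eq_of_eq_svar b.inv_to, a.inv_to]
  theorem IC.to_inv : {A' A : CType} → (a : IC I A' A) → {Γ : List VType} →
      ss (a.to hI Γ) (a.inv hI Γ) = svar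
    | _, _, .eq h, _ => by simp [IC.to, IC.inv]
    | _, _, .cand a b, _ => by
      simp [IC.to, IC.inv, ss_ss, ss_eq_of_eq_svar a.to_inv, ss_eq_of_eq_svar b.to_inv]
    | _, _, .carr a b, _ => by
      apply carr_ext
      simp [IC.to, IC.inv, ss_ss, a.to_inv, ss_eq_of_eq_svar b.to_inv]
    | _, _, .bang a, _ => by
      apply bang_ext
      simp [IC.to, IC.inv, a.to_inv]
    | _, _, .copow a b, _ => by
      apply copow_ext
      simp [IC.to, IC.inv, a.to_inv, b.to_inv]
    | _, _, .csum a b, _ => by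
      apply csum_ext <;> simp [IC.to, IC.inv, a.to_inv, b.to_inv]
  theorem IC.inv_to : {A' A : CType} → (a : IC I A' A) → {Γ : List VType} →
      ss (a.inv hI Γ) (a.to hI Γ) = svar
    | _, _, .eq h, _ => by simp [IC.to, IC.inv]
    | _, _, .cand a b, _ => by
      simp [IC.to, IC.inv, ss_ss, ss_eq_of_eq_svar a.inv_to, ss_eq_of_eq_svar b.inv_to]
    | _, _, .carr a b, _ => by
      apply carr_ext
      simp [IC.to, IC.inv, ss_ss, a.inv_to, ss_eq_of_eq_svar b.inv_to]
    | _, _, .bang (A' := A') a, Γ => by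
      apply copow_ext
      have := iletI_eta hI svar (copow (var (Γ := A' :: Γ) (A := A') 0 rfl) (svar (A := I)))
      simp at this
      simp [IC.to, IC.inv, a.inv_to, this]
    | _, _, .copow a b, _ => by
      apply copow_ext
      simp [IC.to, IC.inv, a.inv_to, b.inv_to]
    | _, _, .csum a b, _ => by
      apply csum_ext <;> simp [IC.to, IC.inv, a.inv_to, b.inv_to]
end

end EEC

namespace EEC
open Q

/-! ## The term formers are compatible with the isomorphisms -/

section

variable {I : CType} (hI : I = .iunit) {Γ Γ' : List VType} {Δ : Option CType} (σ : Sub Γ' Γ)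

/-- Conjugation of a value term by an isomorphism. -/
noncomputable def IV.conj {A' A : VType} (a : IV I A' A) (x : Q Γ' none A') : Q Γ none A :=
  a.to hI Γ (ps σ x)

/-- Conjugation of a computation term by an isomorphism. -/
noncomputable def IC.conj {A' A D' : CType} (a : IC I A' A) (e : Q Γ Δ (.comp D'))
    (x : Q Γ' (some D') (.comp A')) : Q Γ Δ (.comp A) :=
  ss (a.to hI Γ) (ss (ps σ x) e)

/-- Lift of a substitution along an isomorphism. -/
noncomputable abbrev IV.lift {A' A : VType} (a : IV I A' A) : Sub (A' :: Γ') (A :: Γ) :=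
  .cons (a.inv hI (A :: Γ) (var 0 rfl)) (σ.comp .wk)

variable {A' A B' B : VType} {C' C D' D E' E F' : CType} (a : IV I A' A) (b : IV I B' B)
  (c : IC I C' C) (d : IC I D' D) (f : IC I E' E) (e : Q Γ Δ (.comp F'))

theorem conj_vpair (x : Q Γ' none A') (y : Q Γ' none B') :
    (IV.prod a b).conj hI σ (vpair x y) = vpair (a.conj hI σ x) (b.conj hI σ y) := by
  simp [IV.conj, IV.to]

theorem conj_vfst (x : Q Γ' none (.prod A' B')) :
    a.conj hI σ (vfst x) = vfst ((IV.prod a b).conj hI σ x) := by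
  simp [IV.conj, IV.to]

theorem conj_vsnd (x : Q Γ' none (.prod A' B')) :
    b.conj hI σ (vsnd x) = vsnd ((IV.prod a b).conj hI σ x) := by
  simp [IV.conj, IV.to]

theorem conj_vlam (x : Q (A' :: Γ') none B') :
    (IV.arr a b).conj hI σ (vlam x) = vlam (b.conj hI (a.lift hI σ) x) := by
  simp [IV.conj, IV.to]

theorem conj_vapp (x : Q Γ' none (.arr A' B')) (y : Q Γ' none A') :
    b.conj hI σ (vapp x y) = vapp ((IV.arr a b).conj hI σ x) (a.conj hI σ y) := by
  simp [IV.conj, IV.to, a.inv_to hI]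

theorem conj_llam (x : Q Γ' (some C') (.comp D')) :
    (IV.lin c d).conj hI σ (llam x) = llam (d.conj hI σ (c.inv hI Γ) x) := by
  simp [IV.conj, IC.conj, IV.to]

theorem conj_lapp (x : Q Γ' none (.lin C' D')) (y : Q Γ' (some F') (.comp C')) :
    d.conj hI σ e (lapp x y) = lapp ((IV.lin c d).conj hI σ x) (c.conj hI σ e y) := by
  simp [IV.conj, IC.conj, IV.to, ss_ss, ss_eq_of_eq_svar (c.inv_to hI)]

theorem conj_ofK (x : Q Γ' (some I) (.comp C')) :
    (IV.comp c).conj hI σ (llam x) = c.conj hI σ (topI hI) x := by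
  simp [IV.conj, IC.conj, IV.to]

theorem conj_svar : c.conj hI σ (c.inv hI Γ) svar = svar := by
  simp [IC.conj, c.to_inv hI]

theorem conj_cpair (x : Q Γ' (some F') (.comp C')) (y : Q Γ' (some F') (.comp D')) :
    (IC.cand c d).conj hI σ e (cpair x y) = cpair (c.conj hI σ e x) (d.conj hI σ e y) := by
  simp [IC.conj, IC.to, ss_ss]

theorem conj_cfst (x : Q Γ' (some F') (.comp (.cand C' D'))) :
    c.conj hI σ e (cfst x) = cfst ((IC.cand c d).conj hI σ e x) := by
  simp [IC.conj, IC.to, ss_ss]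

theorem conj_csnd (x : Q Γ' (some F') (.comp (.cand C' D'))) :
    d.conj hI σ e (csnd x) = csnd ((IC.cand c d).conj hI σ e x) := by
  simp [IC.conj, IC.to, ss_ss]

theorem conj_clam (x : Q (A' :: Γ') (some F') (.comp C')) :
    (IC.carr a c).conj hI σ e (clam x) = clam (c.conj hI (a.lift hI σ) (ps .wk e) x) := by
  simp [IC.conj, IC.to, ss_ss]

theorem conj_capp (x : Q Γ' (some F') (.comp (.carr A' C'))) (y : Q Γ' none A') :
    c.conj hI σ e (capp x y) = capp ((IC.carr a c).conj hI σ e x) (a.conj hI σ y) := by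
  simp [IV.conj, IC.conj, IC.to, ss_ss, a.inv_to hI]

theorem conj_top : (IC.eq hI).conj hI σ (topI hI) svar = top := by
  simp [IC.conj, IC.to, topI]

theorem conj_ilet (x : Q Γ' (some F') (.comp I)) (y : Q Γ' (some I) (.comp C')) :
    c.conj hI σ e (ss y x) = ilet ((IC.eq hI).conj hI σ e x) (c.conj hI σ (topI hI) y) := by
  have := iletI_eta hI (ss (ps σ x) e) (ss (c.to hI Γ) (ps σ y))
  simp only [iletI, ss_ss] at this
  simp [IC.conj, IC.to, ss_ss, this]

theorem conj_bang (x : Q Γ' none A') :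
    (IC.bang a).conj hI σ (topI hI) (copow x svar) = bang (a.conj hI σ x) := by
  simp [IV.conj, IC.conj, IC.to]

theorem conj_banglet (x : Q Γ' (some F') (.comp (.copow A' I)))
    (y : Q (A' :: Γ') (some I) (.comp C')) :
    c.conj hI σ e (copowlet x y) =
      banglet ((IC.bang a).conj hI σ e x) (c.conj hI (a.lift hI σ) (topI hI) y) := by
  have key : ss (banglet svar (c.conj hI (a.lift hI σ) (topI hI) y)) ((IC.bang a).to hI Γ) =
      ss (c.to hI Γ) (copowlet svar (ps (.cons (var 0 rfl) (σ.comp .wk)) y)) := by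
    apply copow_ext
    have := iletI_eta hI svar (ss (c.to hI (A' :: Γ)) (ps (.cons (var 0 rfl) (σ.comp .wk)) y))
    simp [ss_ss] at this
    simp [IC.conj, IC.to, a.inv_to hI, this]
  have := congrArg (fun k => ss k (ss (ps σ x) e)) key
  simp  at this
  simp [IC.conj] at this ⊢
  simp [this]

theorem conj_copow (x : Q Γ' none A') (y : Q Γ' (some F') (.comp C')) :
    (IC.copow a c).conj hI σ e (copow x y) = copow (a.conj hI σ x) (c.conj hI σ e y) := by
  simp [IV.conj, IC.conj, IC.to]

theorem conj_copowlet (x : Q Γ' (some F') (.comp (.copow A' C')))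
    (y : Q (A' :: Γ') (some C') (.comp D')) :
    d.conj hI σ e (copowlet x y) =
      copowlet ((IC.copow a c).conj hI σ e x) (d.conj hI (a.lift hI σ) (c.inv hI _) y) := by
  have key : ss (copowlet svar (d.conj hI (a.lift hI σ) (c.inv hI _) y))
      ((IC.copow a c).to hI Γ) =
      ss (d.to hI Γ) (copowlet svar (ps (.cons (var 0 rfl) (σ.comp .wk)) y)) := by
    apply copow_ext
    simp [IC.conj, IC.to, a.inv_to hI, ss_ss, c.inv_to hI]
  have := congrArg (fun k => ss k (ss (ps σ x) e)) key
  simp [IC.conj] at this ⊢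
  simp [this]

theorem conj_cimage (x : Q Γ' (some F') (.comp .czero)) :
    c.conj hI σ e (cimage C' x) = cimage C ((IC.eq rfl).conj hI σ e x) := by
  simp [IC.conj, IC.to]

theorem conj_cinl (x : Q Γ' (some F') (.comp C')) :
    (IC.csum c d).conj hI σ e (cinl x) = cinl (c.conj hI σ e x) := by
  simp [IC.conj, IC.to]

theorem conj_cinr (x : Q Γ' (some F') (.comp D')) :
    (IC.csum c d).conj hI σ e (cinr x) = cinr (d.conj hI σ e x) := by
  simp [IC.conj, IC.to]

theorem conj_ccase (x : Q Γ' (some F') (.comp (.csum C' D'))) (y : Q Γ' (some C') (.comp E'))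
    (z : Q Γ' (some D') (.comp E')) :
    f.conj hI σ e (ccase x y z) = ccase ((IC.csum c d).conj hI σ e x)
      (f.conj hI σ (c.inv hI Γ) y) (f.conj hI σ (d.inv hI Γ) z) := by
  have key : ss (ccase svar (f.conj hI σ (c.inv hI Γ) y) (f.conj hI σ (d.inv hI Γ) z))
      ((IC.csum c d).to hI Γ) = ss (f.to hI Γ) (ccase svar (ps σ y) (ps σ z)) := by
    apply csum_ext <;> simp [IC.conj, IC.to, ss_ss, c.inv_to hI, d.inv_to hI]
  have := congrArg (fun k => ss k (ss (ps σ x) e)) key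
  simp [IC.conj] at this ⊢
  simp [this]

end

end EEC

namespace EEC
open Q EEC.Dual

/-! ## The self-translation of terms modulo provable equality -/

theorem exists_trV (R : CType) {Γ : List VType} {A : VType} (x : Q Γ none A) :
    ∃ (y : V R Γ A) (t : Tm) (h : Ty Γ none t A), mk t h = x ∧ HasV R Γ t y := by
  obtain ⟨t, h, rfl⟩ := x.exists_rep
  exact ⟨_, t, h, rfl, h.some, rfl⟩

theorem exists_trK (R : CType) {Γ : List VType} {Δ : Option CType} {A : CType}
    (x : Q Γ Δ (.comp A)) :
    ∃ (y : K R Γ Δ A) (t : Tm) (h : Ty Γ Δ t (.comp A)), mk t h = x ∧ HasK R Γ Δ t y := by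
  obtain ⟨t, h, rfl⟩ := x.exists_rep
  exact ⟨_, t, h, rfl, h.some, rfl⟩

/-- The translation of a value term modulo provable equality. -/
noncomputable def trV (R : CType) {Γ : List VType} {A : VType} (x : Q Γ none A) : V R Γ A :=
  (exists_trV R x).choose

/-- The translation of a computation term modulo provable equality. -/
noncomputable def trK (R : CType) {Γ : List VType} {Δ : Option CType} {A : CType}
    (x : Q Γ Δ (.comp A)) : K R Γ Δ A :=
  (exists_trK R x).choose

variable {R : CType} {Γ : List VType} {Δ : Option CType}

theorem HasV.trV_eq {t : Tm} {A : VType} {y : V R Γ A} (h : HasV R Γ t y) (ht : Ty Γ none t A) :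
    trV R (mk t ht) = y := by
  obtain ⟨u, hu, e, h'⟩ := (exists_trV R (mk t ht)).choose_spec
  obtain ⟨z, h₁, h₂⟩ := (mk_eq.1 e).sameTr (R := R).v
  exact (h'.unique h₁).trans (h₂.unique h)

theorem HasK.trK_eq {t : Tm} {A : CType} {y : K R Γ Δ A} (h : HasK R Γ Δ t y)
    (ht : Ty Γ Δ t (.comp A)) : trK R (mk t ht) = y := by
  obtain ⟨u, hu, e, h'⟩ := (exists_trK R (mk t ht)).choose_spec
  obtain ⟨z, h₁, h₂⟩ := (mk_eq.1 e).sameTr (R := R).k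
  exact (h'.unique h₁).trans (h₂.unique h)

theorem hasV_trV {t : Tm} {A : VType} (ht : Ty Γ none t A) : HasV R Γ t (trV R (mk t ht)) := by
  obtain ⟨y, h⟩ := ht.some.hasV R
  rwa [h.trV_eq]

theorem hasK_trK {t : Tm} {A : CType} (ht : Ty Γ Δ t (.comp A)) :
    HasK R Γ Δ t (trK R (mk t ht)) := by
  obtain ⟨y, h⟩ := ht.some.hasK R
  rwa [h.trK_eq]

theorem trV_var (n : ℕ) {A : VType} (h : Γ[n]? = some A) :
    trV R (Q.var n h) = Dual.var n h := (HasV.var n h).trV_eq _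

theorem trK_svar {A : CType} : trK R (Q.svar (Γ := Γ) (A := A)) = Dual.svar := HasK.svar.trK_eq _

theorem trK_cunit : trK R (Q.cunit (Γ := Γ) (Δ := Δ)) = Dual.cunit := HasK.cunit.trK_eq _

theorem trV_vpair {A B : VType} (x : Q Γ none A) (y : Q Γ none B) :
    trV R (Q.vpair x y) = Dual.vpair (trV R x) (trV R y) := by
  obtain ⟨x, hx, rfl⟩ := x.exists_rep
  obtain ⟨y, hy, rfl⟩ := y.exists_rep
  exact (HasV.vpair (hasV_trV hx) (hasV_trV hy)).trV_eq _

theorem trV_vfst {A B : VType} (x : Q Γ none (.prod A B)) :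
    trV R (Q.vfst x) = Dual.vfst (trV R x) := by
  obtain ⟨x, hx, rfl⟩ := x.exists_rep
  exact (HasV.vfst (hasV_trV hx)).trV_eq _

theorem trV_vsnd {A B : VType} (x : Q Γ none (.prod A B)) :
    trV R (Q.vsnd x) = Dual.vsnd (trV R x) := by
  obtain ⟨x, hx, rfl⟩ := x.exists_rep
  exact (HasV.vsnd (hasV_trV hx)).trV_eq _

theorem trV_vlam {A B : VType} (x : Q (A :: Γ) none B) :
    trV R (Q.vlam x) = Dual.vlam (trV R x) := by
  obtain ⟨x, hx, rfl⟩ := x.exists_rep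
  exact (HasV.vlam (hasV_trV hx)).trV_eq _

theorem trV_vapp {A B : VType} (x : Q Γ none (.arr A B)) (y : Q Γ none A) :
    trV R (Q.vapp x y) = Dual.vapp (trV R x) (trV R y) := by
  obtain ⟨x, hx, rfl⟩ := x.exists_rep
  obtain ⟨y, hy, rfl⟩ := y.exists_rep
  exact (HasV.vapp (hasV_trV hx) (hasV_trV hy)).trV_eq _

theorem trV_llam {A B : CType} (x : Q Γ (some A) (.comp B)) :
    trV R (Q.llam x) = Dual.llam (trK R x) := by
  obtain ⟨x, hx, rfl⟩ := x.exists_rep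
  exact (HasV.llam (hasK_trK hx)).trV_eq _

theorem trK_lapp {A B : CType} (x : Q Γ none (.lin A B)) (y : Q Γ Δ (.comp A)) :
    trK R (Q.lapp x y) = Dual.lapp (trV R x) (trK R y) := by
  obtain ⟨x, hx, rfl⟩ := x.exists_rep
  obtain ⟨y, hy, rfl⟩ := y.exists_rep
  exact (HasK.lapp (hasV_trV hx) (hasK_trK hy)).trK_eq _

theorem trK_cpair {A B : CType} (x : Q Γ Δ (.comp A)) (y : Q Γ Δ (.comp B)) :
    trK R (Q.cpair x y) = Dual.cpair (trK R x) (trK R y) := by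
  obtain ⟨x, hx, rfl⟩ := x.exists_rep
  obtain ⟨y, hy, rfl⟩ := y.exists_rep
  exact (HasK.cpair (hasK_trK hx) (hasK_trK hy)).trK_eq _

theorem trK_cfst {A B : CType} (x : Q Γ Δ (.comp (.cand A B))) :
    trK R (Q.cfst x) = Dual.cfst (trK R x) := by
  obtain ⟨x, hx, rfl⟩ := x.exists_rep
  exact (HasK.cfst (hasK_trK hx)).trK_eq _

theorem trK_csnd {A B : CType} (x : Q Γ Δ (.comp (.cand A B))) :
    trK R (Q.csnd x) = Dual.csnd (trK R x) := by
  obtain ⟨x, hx, rfl⟩ := x.exists_rep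
  exact (HasK.csnd (hasK_trK hx)).trK_eq _

theorem trK_clam {A : VType} {B : CType} (x : Q (A :: Γ) Δ (.comp B)) :
    trK R (Q.clam x) = Dual.clam (trK R x) := by
  obtain ⟨x, hx, rfl⟩ := x.exists_rep
  exact (HasK.clam (hasK_trK hx)).trK_eq _

theorem trK_capp {A : VType} {B : CType} (x : Q Γ Δ (.comp (.carr A B))) (y : Q Γ none A) :
    trK R (Q.capp x y) = Dual.capp (trK R x) (trV R y) := by
  obtain ⟨x, hx, rfl⟩ := x.exists_rep
  obtain ⟨y, hy, rfl⟩ := y.exists_rep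
  exact (HasK.capp (hasK_trK hx) (hasV_trV hy)).trK_eq _

theorem trK_copow {A : VType} {B : CType} (x : Q Γ none A) (y : Q Γ Δ (.comp B)) :
    trK R (Q.copow x y) = Dual.copow (trV R x) (trK R y) := by
  obtain ⟨x, hx, rfl⟩ := x.exists_rep
  obtain ⟨y, hy, rfl⟩ := y.exists_rep
  exact (HasK.copow (hasV_trV hx) (hasK_trK hy)).trK_eq _

theorem trK_copowlet {A : VType} {B C : CType} (x : Q Γ Δ (.comp (.copow A B)))
    (y : Q (A :: Γ) (some B) (.comp C)) :
    trK R (Q.copowlet x y) = Dual.copowlet (trK R x) (trK R y) := by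
  obtain ⟨x, hx, rfl⟩ := x.exists_rep
  obtain ⟨y, hy, rfl⟩ := y.exists_rep
  exact (HasK.copowlet (hasK_trK hx) (hasK_trK hy)).trK_eq _

theorem trK_cinl {A B : CType} (x : Q Γ Δ (.comp A)) :
    trK R (Q.cinl (B := B) x) = Dual.cinl (B := B) (trK R x) := by
  obtain ⟨x, hx, rfl⟩ := x.exists_rep
  exact (HasK.cinl (hasK_trK hx)).trK_eq _

theorem trK_cinr {A B : CType} (x : Q Γ Δ (.comp B)) :
    trK R (Q.cinr (A := A) x) = Dual.cinr (A := A) (trK R x) := by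
  obtain ⟨x, hx, rfl⟩ := x.exists_rep
  exact (HasK.cinr (hasK_trK hx)).trK_eq _

theorem trK_ccase {A B C : CType} (x : Q Γ Δ (.comp (.csum A B)))
    (y : Q Γ (some A) (.comp C)) (z : Q Γ (some B) (.comp C)) :
    trK R (Q.ccase x y z) = Dual.ccase (trK R x) (trK R y) (trK R z) := by
  obtain ⟨x, hx, rfl⟩ := x.exists_rep
  obtain ⟨y, hy, rfl⟩ := y.exists_rep
  obtain ⟨z, hz, rfl⟩ := z.exists_rep
  exact (HasK.ccase (hasK_trK hx) (hasK_trK hy) (hasK_trK hz)).trK_eq _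

theorem trK_ss {A B : CType} (x : Q Γ (some A) (.comp B)) (y : Q Γ Δ (.comp A)) :
    trK R (Q.ss x y) = Dual.ss (trK R x) (trK R y) := by
  obtain ⟨x, hx, rfl⟩ := x.exists_rep
  obtain ⟨y, hy, rfl⟩ := y.exists_rep
  exact (HasK.ssubst (hasK_trK hx) (hasK_trK hy)).trK_eq _

theorem trV_mk {t : Tm} {A : VType} (d : Deriv Γ none t A) : trV R (mk t ⟨d⟩) = FV R d :=
  HasV.trV_eq ⟨d, rfl⟩ _

theorem trK_mk {t : Tm} {A : CType} (d : Deriv Γ Δ t (.comp A)) : trK R (mk t ⟨d⟩) = FK R d :=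
  HasK.trK_eq ⟨d, rfl⟩ _

end EEC

namespace EEC
open Q EEC.Dual

/-! ## The double translation is isomorphic to the identity -/

/-- The condition on the answer type. -/
abbrev IsAnswer (R : CType) : Prop := (∃ a : ℕ, R = .base a) ∨ R = .iunit

section

variable {R : CType} (hR : IsAnswer R)
include hR

theorem IsAnswer.cpsC_self : cpsC R R = .iunit := by
  obtain ⟨a, rfl⟩ | rfl := hR <;> simp [cpsC]

theorem IsAnswer.cpsC_cpsC_base (a : ℕ) : cpsC R (cpsC R (.base a)) = .base a := by
  obtain ⟨b, rfl⟩ | rfl := hR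
  · by_cases h : b = a <;> simp [cpsC, h]
  · rfl

end

mutual
  /-- A value type is isomorphic to its double translation. -/
  def doubleV {R : CType} (hR : IsAnswer R) : (A : VType) → IV (cpsC R R) (cpsV R (cpsV R A)) A
    | .base a => .base a
    | .unit => .unit
    | .prod A B => .prod (doubleV hR A) (doubleV hR B)
    | .arr A B => .arr (doubleV hR A) (doubleV hR B)
    | .comp A => .comp (doubleC hR A)
    | .lin A B => .lin (doubleC hR A) (doubleC hR B)
  /-- A computation type is isomorphic to its double translation. -/
  def doubleC {R : CType} (hR : IsAnswer R) : (A : CType) → IC (cpsC R R) (cpsC R (cpsC R A)) A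
    | .base a => .eq (hR.cpsC_cpsC_base a)
    | .cunit => .eq rfl
    | .cand A B => .cand (doubleC hR A) (doubleC hR B)
    | .carr A B => .carr (doubleV hR A) (doubleC hR B)
    | .iunit => .eq hR.cpsC_self
    | .bang A => .bang (doubleV hR A)
    | .copow A B => .copow (doubleV hR A) (doubleC hR B)
    | .czero => .eq rfl
    | .csum A B => .csum (doubleC hR A) (doubleC hR B)
end

/-- The substitution along the isomorphisms from the doubly translated context. -/
noncomputable def doubleS {R : CType} (hR : IsAnswer R) :
    (Γ : List VType) → Sub (cpsCtx R (cpsCtx R Γ)) Γ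
  | [] => fun _ _ h => absurd h (by simp [cpsCtx])
  | A :: Γ => Sub.cons (Γ := cpsCtx R (cpsCtx R Γ)) (Γ' := A :: Γ)
      ((doubleV hR A).inv hR.cpsC_self (A :: Γ) (Q.var 0 rfl)) ((doubleS hR Γ).comp .wk)

/-- The isomorphism to the double translation of a stoup. -/
noncomputable def doubleR {R : CType} (hR : IsAnswer R) (Γ : List VType) :
    (Δ : Option CType) → Q Γ Δ (.comp (cpsC R (res R Δ)))
  | none => topI hR.cpsC_self
  | some D => (doubleC hR D).inv hR.cpsC_self Γ

theorem doubleS_apply {R : CType} (hR : IsAnswer R) {Γ : List VType} {n : ℕ} {A : VType}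
    (h : Γ[n]? = some A) : doubleS hR Γ n _ (cpsCtx_get (cpsCtx_get h)) =
      (doubleV hR A).inv hR.cpsC_self Γ (Q.var n h) := by
  induction Γ generalizing n with
  | nil => simp at h
  | cons B Γ ih =>
    cases n with
    | zero =>
      obtain rfl : B = A := by simpa using h
      rfl
    | succ n =>
      refine (congrArg (Q.ps .wk) (ih (n := n) (by simpa using h))).trans ?_
      simp

@[simp] theorem ps_doubleR {R : CType} (hR : IsAnswer R) {Γ Γ' : List VType} (σ : Sub Γ Γ')
    (Δ : Option CType) : ps σ (doubleR hR Γ Δ) = doubleR hR Γ' Δ := by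
  cases Δ <;> simp [doubleR]

variable {R : CType} (hR : IsAnswer R) {Γ : List VType} {Δ : Option CType}

/-- The value term obtained from its translation. -/
noncomputable def backV {A : VType} (x : V R Γ A) : Q Γ none A :=
  (doubleV hR A).conj hR.cpsC_self (doubleS hR Γ) (trV R x)

/-- The computation term obtained from its translation. -/
noncomputable def backK {A : CType} (x : K R Γ Δ A) : Q Γ Δ (.comp A) :=
  (doubleC hR A).conj hR.cpsC_self (doubleS hR Γ) (doubleR hR Γ Δ) (trK R x)

theorem backV_var (n : ℕ) {A : VType} (h : Γ[n]? = some A) :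
    backV hR (Dual.var n h) = Q.var n h := by
  have : trV R (Dual.var (R := R) n h) = _ := trV_var n (cpsCtx_get h)
  rw [backV, this]
  refine (congrArg ((doubleV hR A).to _ Γ) ((ps_var _ n _).trans (doubleS_apply hR h))).trans ?_
  simp [IV.to_inv]

theorem backK_svar {A : CType} : backK hR (Dual.svar (Γ := Γ) (A := A)) = Q.svar := by
  have : trK R (Dual.svar (R := R) (Γ := Γ) (A := A)) = _ := trK_svar
  rw [backK, this]
  exact conj_svar _ _ _

end EEC

namespace EEC
open Q EEC.Dual

/-! ## Translations of the terms that occur in translations -/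

section

variable {R : CType} {Γ : List VType} {Δ : Option CType} {A B : VType} {C D E : CType}

theorem trK_ss_lapp (x : Q Γ none (.lin C D)) (y : Q Γ (some D) (.comp E)) :
    trK R (Q.ss y (Q.lapp x .svar)) =
      Q.lapp (A := cpsC R D) (B := cpsC R C) (trV R x) (trK R y) := by
  rw [trK_ss, trK_lapp, trK_svar]
  have key {Γ Δ A B} (x : Q Γ none (.lin A B)) (y : Q Γ Δ (.comp A)) :
    Q.ss (Q.ss .svar (Q.lapp x .svar)) y = Q.lapp x y := by simp
  exact key (A := cpsC R D) (B := cpsC R C) _ _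

theorem trK_ccase_svar (x : Q Γ (some C) (.comp E)) (y : Q Γ (some D) (.comp E)) :
    trK R (Q.ccase .svar x y) = Q.cpair (trK R x) (trK R y) := by
  rw [trK_ccase, trK_svar]
  exact Q.ss_svar_left _

theorem trK_ss_cinl (x : Q Γ (some (.csum C D)) (.comp E)) :
    trK R (Q.ss x (Q.cinl .svar)) = Q.cfst (A := cpsC R C) (B := cpsC R D) (trK R x) := by
  rw [trK_ss, trK_cinl, trK_svar]
  have key {Γ Δ A B} (x : Q Γ Δ (.comp (.cand A B))) :
    Q.ss (Q.ss .svar (Q.cfst .svar)) x = Q.cfst x := by simp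
  exact key (A := cpsC R C) (B := cpsC R D) _

theorem trK_ss_cinr (x : Q Γ (some (.csum C D)) (.comp E)) :
    trK R (Q.ss x (Q.cinr .svar)) = Q.csnd (A := cpsC R C) (B := cpsC R D) (trK R x) := by
  rw [trK_ss, trK_cinr, trK_svar]
  have key {Γ Δ A B} (x : Q Γ Δ (.comp (.cand A B))) :
    Q.ss (Q.ss .svar (Q.csnd .svar)) x = Q.csnd x := by simp
  exact key (A := cpsC R C) (B := cpsC R D) _

theorem trK_copowlet_svar (x : Q (A :: Γ) (some C) (.comp D)) :
    trK R (Q.copowlet .svar x) = Q.clam (Γ := cpsCtx R Γ) (trK R x) := by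
  rw [trK_copowlet, trK_svar]
  exact Q.ss_svar_left _

theorem trK_ss_copow (x : Q Γ (some (.copow A C)) (.comp D)) (y : Q Γ none A) :
    trK R (Q.ss x (Q.copow y .svar)) =
      Q.capp (A := cpsV R A) (B := cpsC R C) (trK R x) (trV R y) := by
  rw [trK_ss, trK_copow, trK_svar]
  have key {Γ Δ A B} (x : Q Γ Δ (.comp (.carr A B))) (y : Q Γ none A) :
    Q.ss (Q.ss .svar (Q.capp .svar y)) x = Q.capp x y := by simp
  exact key (A := cpsV R A) (B := cpsC R C) _ _

theorem trK_capp_svar (y : Q Γ none A) :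
    trK R (Q.capp (B := C) .svar y) =
      Q.copow (A := cpsV R A) (B := cpsC R C) (trV R y) .svar := by
  rw [trK_capp, trK_svar]
  exact Q.ss_svar_left _

theorem trK_ss_clam (x : Q Γ (some (.carr A C)) (.comp E)) (y : Q (A :: Γ) (some D) (.comp C)) :
    trK R (Q.ss x (Q.clam y)) =
      Q.copowlet (Γ := cpsCtx R Γ) (A := cpsV R A) (B := cpsC R C) (trK R x) (trK R y) := by
  rw [trK_ss, trK_clam]
  have key {Γ Δ A B C} (x : Q Γ Δ (.comp (.copow A B))) (y : Q (A :: Γ) (some B) (.comp C)) :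
    Q.ss (Q.copowlet .svar y) x = Q.copowlet x y := by simp
  exact key (Γ := cpsCtx R Γ) (A := cpsV R A) (B := cpsC R C) _ _

theorem trK_ss_capp (x : Q Γ (some C) (.comp E)) (y : Q Γ none A) :
    trK R (Q.ss x (Q.capp .svar y)) =
      Q.copow (A := cpsV R A) (B := cpsC R C) (trV R y) (trK R x) := by
  rw [trK_ss, trK_capp_svar]
  have key {Γ Δ A B} (x : Q Γ Δ (.comp B)) (y : Q Γ none A) :
    Q.ss (Q.copow y .svar) x = Q.copow y x := by simp
  exact key (A := cpsV R A) (B := cpsC R C) _ _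

theorem trK_ss_cunit (x : Q Γ (some .cunit) (.comp E)) :
    trK R (Q.ss x (Q.cunit (Δ := some D))) = Q.cimage (cpsC R D) (trK R x) := by
  rw [trK_ss, trK_cunit]
  have key {Γ Δ A} (x : Q Γ Δ (.comp .czero)) : Q.ss (Q.cimage A .svar) x = Q.cimage A x := by
    simp
  exact key _

theorem trK_ss_cfst (x : Q Γ (some C) (.comp E)) :
    trK R (Q.ss x (Q.cfst (B := D) .svar)) =
      Q.cinl (A := cpsC R C) (B := cpsC R D) (trK R x) := by
  rw [trK_ss, trK_cfst, trK_svar]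
  have key {Γ Δ A B} (x : Q Γ Δ (.comp A)) :
    Q.ss (Q.ss .svar (Q.cinl (B := B) .svar)) x = Q.cinl x := by simp
  exact key (A := cpsC R C) (B := cpsC R D) _

theorem trK_ss_csnd (x : Q Γ (some D) (.comp E)) :
    trK R (Q.ss x (Q.csnd (A := C) .svar)) =
      Q.cinr (A := cpsC R C) (B := cpsC R D) (trK R x) := by
  rw [trK_ss, trK_csnd, trK_svar]
  have key {Γ Δ A B} (x : Q Γ Δ (.comp B)) :
    Q.ss (Q.ss .svar (Q.cinr (A := A) .svar)) x = Q.cinr x := by simp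
  exact key (A := cpsC R C) (B := cpsC R D) _

theorem trK_ss_cpair {F : CType} (x : Q Γ (some (.cand C D)) (.comp E))
    (y : Q Γ (some F) (.comp C)) (z : Q Γ (some F) (.comp D)) :
    trK R (Q.ss x (Q.cpair y z)) =
      Q.ccase (A := cpsC R C) (B := cpsC R D) (trK R x) (trK R y) (trK R z) := by
  rw [trK_ss, trK_cpair]
  have key {Γ Δ A B C} (x : Q Γ Δ (.comp (.csum A B))) (y : Q Γ (some A) (.comp C))
    (z : Q Γ (some B) (.comp C)) : Q.ss (Q.ccase .svar y z) x = Q.ccase x y z := by simp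
  exact key (A := cpsC R C) (B := cpsC R D) _ _ _

end

end EEC

namespace EEC
open Q EEC.Dual

/-! ## Recovering a term from its double translation -/

section

variable {R : CType} (hR : IsAnswer R) {Γ : List VType} {Δ : Option CType} {A B : VType}
  {C D E : CType}

theorem backV_eq {x : V R Γ A} {y : Q (cpsCtx R (cpsCtx R Γ)) none (cpsV R (cpsV R A))}
    (h : trV R x = y) :
    backV hR x = (doubleV hR A).conj hR.cpsC_self (doubleS hR Γ) y := h ▸ rfl

theorem backK_eq {x : K R Γ Δ C}
    {y : Q (cpsCtx R (cpsCtx R Γ)) (some (cpsC R (res R Δ))) (.comp (cpsC R (cpsC R C)))}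
    (h : trK R x = y) :
    backK hR x =
      (doubleC hR C).conj hR.cpsC_self (doubleS hR Γ) (doubleR hR Γ Δ) y := h ▸ rfl

theorem backV_unit : backV hR (Dual.unit (Γ := Γ)) = Q.unit := unit_uniq _

theorem backV_vpair (x : V R Γ A) (y : V R Γ B) :
    backV hR (Dual.vpair x y) = Q.vpair (backV hR x) (backV hR y) :=
  (backV_eq hR (trV_vpair _ _)).trans (conj_vpair _ _ _ _ _ _)

theorem backV_vfst (x : V R Γ (.prod A B)) :
    backV hR (Dual.vfst x) = Q.vfst (backV hR x) :=
  (backV_eq hR (trV_vfst (A := cpsV R A) (B := cpsV R B) _)).trans (conj_vfst _ _ _ _ _)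

theorem backV_vsnd (x : V R Γ (.prod A B)) :
    backV hR (Dual.vsnd x) = Q.vsnd (backV hR x) :=
  (backV_eq hR (trV_vsnd (A := cpsV R A) (B := cpsV R B) _)).trans (conj_vsnd _ _ _ _ _)

theorem backV_vlam (x : V R (A :: Γ) B) : backV hR (Dual.vlam x) = Q.vlam (backV hR x) :=
  (backV_eq hR (trV_vlam (Γ := cpsCtx R Γ) _)).trans (conj_vlam _ _ _ _ _)

theorem backV_vapp (x : V R Γ (.arr A B)) (y : V R Γ A) :
    backV hR (Dual.vapp x y) = Q.vapp (backV hR x) (backV hR y) :=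
  (backV_eq hR (trV_vapp (A := cpsV R A) (B := cpsV R B) _ _)).trans (conj_vapp _ _ _ _ _ _)

theorem backV_llam (x : K R Γ (some C) D) : backV hR (Dual.llam x) = Q.llam (backK hR x) :=
  (backV_eq hR (trV_llam _)).trans (conj_llam _ _ _ _ _)

theorem backK_lapp (x : V R Γ (.lin C D)) (y : K R Γ Δ C) :
    backK hR (Dual.lapp x y) = Q.lapp (backV hR x) (backK hR y) :=
  (backK_eq hR (trK_ss_lapp (C := cpsC R D) (D := cpsC R C) _ _)).trans
    (conj_lapp _ _ _ _ _ _ _)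

theorem backV_ofK (x : K R Γ none C) : backV hR (Dual.ofK x) = backK hR x :=
  (backV_eq hR (trV_llam _)).trans (conj_ofK _ _ _ _)

theorem backK_cunit : backK hR (Dual.cunit (Γ := Γ) (Δ := Δ)) = Q.cunit := cunit_uniq _

theorem backK_cpair (x : K R Γ Δ C) (y : K R Γ Δ D) :
    backK hR (Dual.cpair x y) = Q.cpair (backK hR x) (backK hR y) :=
  (backK_eq hR (trK_ccase_svar _ _)).trans (conj_cpair _ _ _ _ _ _ _)

theorem backK_cfst (x : K R Γ Δ (.cand C D)) :
    backK hR (Dual.cfst x) = Q.cfst (backK hR x) :=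
  (backK_eq hR (trK_ss_cinl (C := cpsC R C) (D := cpsC R D) _)).trans (conj_cfst _ _ _ _ _ _)

theorem backK_csnd (x : K R Γ Δ (.cand C D)) :
    backK hR (Dual.csnd x) = Q.csnd (backK hR x) :=
  (backK_eq hR (trK_ss_cinr (C := cpsC R C) (D := cpsC R D) _)).trans (conj_csnd _ _ _ _ _ _)

theorem backK_clam (x : K R (A :: Γ) Δ C) :
    backK hR (Dual.clam x) = Q.clam (backK hR x) :=
  (backK_eq hR (trK_copowlet_svar (Γ := cpsCtx R Γ) _)).trans <|
    (conj_clam _ _ _ _ _ _).trans (by rw [ps_doubleR]; rfl)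

theorem backK_capp (x : K R Γ Δ (.carr A C)) (y : V R Γ A) :
    backK hR (Dual.capp x y) = Q.capp (backK hR x) (backV hR y) :=
  (backK_eq hR (trK_ss_copow (A := cpsV R A) (C := cpsC R C) _ _)).trans
    (conj_capp _ _ _ _ _ _ _)

theorem backK_top : backK hR (Dual.top (Γ := Γ)) = Q.top :=
  (backK_eq hR trK_svar).trans (conj_top _ _)

theorem backK_ilet (x : K R Γ Δ .iunit) (y : K R Γ none C) :
    backK hR (Dual.ilet x y) = Q.ilet (backK hR x) (backK hR y) :=
  (backK_eq hR (trK_ss (A := R) _ _)).trans (conj_ilet _ _ _ _ _ _)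

theorem backK_bang (x : V R Γ A) : backK hR (Dual.bang x) = Q.bang (backV hR x) :=
  (backK_eq hR (trK_capp_svar (C := R) _)).trans (conj_bang _ _ _ _)

theorem backK_banglet (x : K R Γ Δ (.bang A)) (y : K R (A :: Γ) none C) :
    backK hR (Dual.banglet x y) = Q.banglet (backK hR x) (backK hR y) :=
  (backK_eq hR (trK_ss_clam (Γ := cpsCtx R Γ) (A := cpsV R A) (C := R) _ _)).trans
    (conj_banglet _ _ _ _ _ _ _)

theorem backK_copow (x : V R Γ A) (y : K R Γ Δ C) :
    backK hR (Dual.copow x y) = Q.copow (backV hR x) (backK hR y) :=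
  (backK_eq hR (trK_ss_capp (A := cpsV R A) (C := cpsC R C) _ _)).trans
    (conj_copow _ _ _ _ _ _ _)

theorem backK_copowlet (x : K R Γ Δ (.copow A C)) (y : K R (A :: Γ) (some C) D) :
    backK hR (Dual.copowlet x y) = Q.copowlet (backK hR x) (backK hR y) :=
  (backK_eq hR (trK_ss_clam (Γ := cpsCtx R Γ) (A := cpsV R A) (C := cpsC R C) _ _)).trans
    (conj_copowlet _ _ _ _ _ _ _ _)

theorem backK_cimage (x : K R Γ Δ .czero) :
    backK hR (Dual.cimage C x) = Q.cimage C (backK hR x) :=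
  (backK_eq hR (trK_ss_cunit _)).trans (conj_cimage _ _ _ _ _)

theorem backK_cinl (x : K R Γ Δ C) :
    backK hR (Dual.cinl (B := D) x) = Q.cinl (backK hR x) :=
  (backK_eq hR (trK_ss_cfst (C := cpsC R C) (D := cpsC R D) _)).trans (conj_cinl _ _ _ _ _ _)

theorem backK_cinr (x : K R Γ Δ D) :
    backK hR (Dual.cinr (A := C) x) = Q.cinr (backK hR x) :=
  (backK_eq hR (trK_ss_csnd (C := cpsC R C) (D := cpsC R D) _)).trans (conj_cinr _ _ _ _ _ _)

theorem backK_ccase (x : K R Γ Δ (.csum C D)) (y : K R Γ (some C) E) (z : K R Γ (some D) E) :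
    backK hR (Dual.ccase x y z) = Q.ccase (backK hR x) (backK hR y) (backK hR z) :=
  (backK_eq hR (trK_ss_cpair (C := cpsC R C) (D := cpsC R D) _ _ _)).trans
    (conj_ccase _ _ _ _ _ _ _ _ _)

end

end EEC

namespace EEC
open Q EEC.Dual

/-! ## Full completeness -/

section

variable {R : CType} (hR : IsAnswer R)
include hR

/-- Translating a term twice and conjugating by the isomorphisms gives back the term. -/
theorem back_F :
    (∀ {Γ : List VType} {t : Tm} {A : VType} (d : Deriv Γ none t A),
      backV hR (FV R d) = Q.mk t ⟨d⟩) ∧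
    (∀ {Γ : List VType} {Δ : Option CType} {t : Tm} {B : CType} (d : Deriv Γ Δ t (.comp B)),
      backK hR (FK R d) = Q.mk t ⟨d⟩) := by
  refine Deriv.vk (fun {_ t _} d => backV hR (FV R d) = Q.mk t ⟨d⟩)
    (fun {_ _ t _} d => backK hR (FK R d) = Q.mk t ⟨d⟩) ?vk ?var ?svar ?unit ?vpair ?vfst ?vsnd
    ?vlam ?vapp ?cunit ?cpair ?cfst ?csnd ?clam ?capp ?top ?ilet ?bang ?banglet ?copow ?copowlet
    ?cimage ?cinl ?cinr ?ccase ?llam ?lapp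
  case vk => intro _ _ _ d; rw [FV_comp d, backV_ofK]
  case var => intro _ n _ h; exact backV_var hR n h
  case svar => intros; exact backK_svar hR
  case unit => intros; exact backV_unit hR
  case vpair => intro _ _ _ _ _ d e h k; rw [FV_vpair, backV_vpair, h, k]; rfl
  case vfst => intro _ _ _ _ d h; rw [FV_vfst, backV_vfst, h]; rfl
  case vsnd => intro _ _ _ _ d h; rw [FV_vsnd, backV_vsnd, h]; rfl
  case vlam => intro _ _ _ _ d h; rw [FV_vlam, backV_vlam, h]; rfl
  case vapp => intro _ _ _ _ _ d e h k; rw [FV_vapp, backV_vapp, h, k]; rfl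
  case cunit => intros; rw [FK_cunit, backK_cunit]; rfl
  case cpair => intro _ _ _ _ _ _ d e h k; rw [FK_cpair, backK_cpair, h, k]; rfl
  case cfst => intro _ _ _ _ _ d h; rw [FK_cfst, backK_cfst, h]; rfl
  case csnd => intro _ _ _ _ _ d h; rw [FK_csnd, backK_csnd, h]; rfl
  case clam => intro _ _ _ _ _ d h; rw [FK_clam, backK_clam, h]; rfl
  case capp => intro _ _ _ _ _ _ d e h k; rw [FK_capp, backK_capp, h, k]; rfl
  case top => intros; rw [FK_top, backK_top]; rfl
  case ilet => intro _ _ _ _ _ d e h k; rw [FK_ilet, backK_ilet, h, k]; rfl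
  case bang => intro _ _ _ d h; rw [FK_bang, backK_bang, h]; rfl
  case banglet => intro _ _ _ _ _ _ d e h k; rw [FK_banglet, backK_banglet, h, k]; rfl
  case copow => intro _ _ _ _ _ _ d e h k; rw [FK_copow, backK_copow, h, k]; rfl
  case copowlet => intro _ _ _ _ _ _ _ d e h k; rw [FK_copowlet, backK_copowlet, h, k]; rfl
  case cimage => intro _ _ _ _ d h; rw [FK_cimage, backK_cimage, h]; rfl
  case cinl => intro _ _ _ _ _ d h; rw [FK_cinl, backK_cinl, h]; rfl
  case cinr => intro _ _ _ _ _ d h; rw [FK_cinr, backK_cinr, h]; rfl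
  case ccase => intro _ _ _ _ _ _ _ _ d e f h k l; rw [FK_ccase, backK_ccase, h, k, l]; rfl
  case llam => intro _ _ _ _ d h; rw [FV_llam, backV_llam, h]; rfl
  case lapp => intro _ _ _ _ _ _ d e h k; rw [FK_lapp, backK_lapp, h, k]; rfl

variable {Γ : List VType} {Δ : Option CType}

theorem exists_comp_doubleS (Γ : List VType) :
    ∃ τ : Sub Γ (cpsCtx R (cpsCtx R Γ)), (doubleS hR Γ).comp τ = Sub.id := by
  refine ⟨fun n A h => (doubleV hR A).to hR.cpsC_self _ (Q.var n (cpsCtx_get (cpsCtx_get h))), ?_⟩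
  funext n A h
  obtain ⟨B, hB, rfl⟩ : ∃ B, Γ[n]? = some B ∧ cpsV R (cpsV R B) = A := by
    simpa [cpsCtx] using h
  refine (congrArg (Q.ps _) (doubleS_apply hR hB)).trans ?_
  refine ((doubleV hR B).ps_inv hR.cpsC_self _ _).trans ?_
  refine (congrArg ((doubleV hR B).inv _ _) (ps_var _ n hB)).trans ?_
  exact (doubleV hR B).inv_to hR.cpsC_self _

theorem ps_doubleS_injective {A : VType} :
    Function.Injective
      (ps (doubleS hR Γ) : Q (cpsCtx R (cpsCtx R Γ)) Δ A → Q Γ Δ A) := by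
  obtain ⟨τ, hτ⟩ := exists_comp_doubleS hR Γ
  refine Function.LeftInverse.injective (g := Q.ps τ) fun x => ?_
  rw [Q.ps_ps, hτ, Q.ps_id]

theorem trV_injective {A : VType} : Function.Injective (trV R : Q Γ none A → V R Γ A) := by
  intro x y h
  obtain ⟨t, ⟨d⟩, rfl⟩ := x.exists_rep
  obtain ⟨u, ⟨e⟩, rfl⟩ := y.exists_rep
  rw [trV_mk, trV_mk] at h
  rw [← (back_F hR).1 d, h, (back_F hR).1 e]

theorem trK_injective {A : CType} :
    Function.Injective (trK R : Q Γ Δ (.comp A) → K R Γ Δ A) := by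
  intro x y h
  obtain ⟨t, ⟨d⟩, rfl⟩ := x.exists_rep
  obtain ⟨u, ⟨e⟩, rfl⟩ := y.exists_rep
  rw [trK_mk, trK_mk] at h
  rw [← (back_F hR).2 d, h, (back_F hR).2 e]

theorem backV_injective {A : VType} : Function.Injective (backV hR : V R Γ A → Q Γ none A) := by
  intro x y h
  refine trV_injective hR (ps_doubleS_injective hR ?_)
  have := congrArg ((doubleV hR A).inv hR.cpsC_self Γ) h
  simpa only [backV, IV.conj, IV.inv_to] using this

theorem backK_injective {A C : CType} :
    Function.Injective (backK hR : K R Γ (some C) A → Q Γ (some C) (.comp A)) := by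
  intro x y h
  refine trK_injective hR (ps_doubleS_injective hR ?_)
  have key (z : Q (cpsCtx R (cpsCtx R Γ)) (some (cpsC R (cpsC R C)))
      (.comp (cpsC R (cpsC R A)))) :
      Q.ss (Q.ss ((doubleC hR A).inv hR.cpsC_self Γ)
        ((doubleC hR A).conj hR.cpsC_self (doubleS hR Γ) (doubleR hR Γ (some C)) z))
        ((doubleC hR C).to hR.cpsC_self Γ) = Q.ps (doubleS hR Γ) z := by
    rw [IC.conj, ss_eq_of_eq_svar ((doubleC hR A).inv_to _), Q.ss_ss]
    refine (congrArg _ ((doubleC hR C).inv_to hR.cpsC_self)).trans ?_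
    exact ss_svar_right _
  exact (key _).symm.trans ((congrArg (fun w => Q.ss (Q.ss _ w) _) h).trans (key _))

theorem exists_FV_eq {A : VType} (x : V R Γ A) :
    ∃ (t : Tm) (d : Deriv Γ none t A), FV R d = x := by
  obtain ⟨t, ⟨d⟩, h⟩ := (backV hR x).exists_rep
  exact ⟨t, d, backV_injective hR (((back_F hR).1 d).trans h)⟩

theorem exists_FK_eq {A C : CType} (x : K R Γ (some C) A) :
    ∃ (t : Tm) (d : Deriv Γ (some C) t (.comp A)), FK R d = x := by
  obtain ⟨t, ⟨d⟩, h⟩ := (backK hR x).exists_rep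
  exact ⟨t, d, backK_injective hR (((back_F hR).2 d).trans h)⟩

end

end EEC

namespace EEC

/-- **Full completeness of the generic linear-use CPS self-translation**
(Theorem 5.5): suppose `R̲` is either a computation-type constant or the
type `I̲`.  Then the self-translation is complete and full, both on value
judgements and on stoup judgements. -/
theorem cps_fully_complete (R : CType)
    (hR : (∃ a : ℕ, R = CType.base a) ∨ R = CType.iunit) :
    (∀ (Γ : List VType) (t u : Tm) (A : VType)
        (dt : Deriv Γ none t A) (du : Deriv Γ none u A),
      EEq (cpsCtx R Γ) none (cps R dt) (cps R du) (cpsV R A) →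
      EEq Γ none t u A) ∧
    (∀ (Γ : List VType) (t : Tm) (A : VType),
      Nonempty (Deriv (cpsCtx R Γ) none t (cpsV R A)) →
      ∃ (u : Tm) (du : Deriv Γ none u A),
        EEq (cpsCtx R Γ) none t (cps R du) (cpsV R A)) ∧
    (∀ (Γ : List VType) (t u : Tm) (A B : CType)
        (dt : Deriv Γ (some A) t (.comp B)) (du : Deriv Γ (some A) u (.comp B)),
      EEq (cpsCtx R Γ) (some (cpsC R B)) (cps R dt) (cps R du) (.comp (cpsC R A)) →
      EEq Γ (some A) t u (.comp B)) ∧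
    (∀ (Γ : List VType) (t : Tm) (A B : CType),
      Nonempty (Deriv (cpsCtx R Γ) (some (cpsC R B)) t (.comp (cpsC R A))) →
      ∃ (u : Tm) (du : Deriv Γ (some A) u (.comp B)),
        EEq (cpsCtx R Γ) (some (cpsC R B)) t (cps R du) (.comp (cpsC R A))) := by
  refine ⟨fun Γ t u A dt du h => ?_, fun Γ t A ⟨h⟩ => ?_, fun Γ t u A B dt du h => ?_,
    fun Γ t A B ⟨h⟩ => ?_⟩
  · have e : FV R dt = FV R du := Q.mk_eq.2 h
    exact Q.mk_eq.1 (((back_F hR).1 dt).symm.trans ((congrArg _ e).trans ((back_F hR).1 du)))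
  · obtain ⟨u, d, e⟩ := exists_FV_eq hR (Q.mk t ⟨h⟩ : Dual.V R Γ A)
    exact ⟨u, d, Q.mk_eq.1 e.symm⟩
  · have e : FK R dt = FK R du := Q.mk_eq.2 h
    exact Q.mk_eq.1 (((back_F hR).2 dt).symm.trans ((congrArg _ e).trans ((back_F hR).2 du)))
  · obtain ⟨u, d, e⟩ := exists_FK_eq hR (Q.mk t ⟨h⟩ : Dual.K R Γ (some A) B)
    exact ⟨u, d, Q.mk_eq.1 e.symm⟩

end EEC
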